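/- arXiv:2109.02932 — 2 statements merged into one kernel-verified Lean document; each statement's English description precedes it below -/
import Mathlib

section
/- For every integer n ≥ 2 and every nonzero integer D, there exists a finite set S ⊆ ℤ[X] such that every polynomial f ∈ ℤ[X] of degree n with discriminant D(f) = D is GL₂(ℤ)-equivalent to some polynomial in S. (Equivalently: the polynomials in ℤ[X] of given degree n and given nonzero discriminant D lie in only finitely many GL₂(ℤ)-equivalence classes.) -/
open Polynomial

/-- The Hermite form `[f]` of an integer polynomial viewed as degree `n`:
`f₀^(n-1) · ∏ᵢ (αᵢ^(n-1) X₁ + αᵢ^(n-2) X₂ + ⋯ + X_n)`, where the `αᵢ` are the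
complex roots of `f` counted with multiplicity. -/
noncomputable def hermiteForm (n : ℕ) (f : Polynomial ℤ) : MvPolynomial (Fin n) ℂ :=
  MvPolynomial.C ((f.leadingCoeff : ℂ) ^ (n - 1)) *
    (Multiset.map
      (fun α : ℂ => ∑ j : Fin n, MvPolynomial.C (α ^ (n - 1 - (j : ℕ))) * MvPolynomial.X j)
      ((f.map (Int.castRingHom ℂ)).roots)).prod

/-- `f` and `g`, viewed as degree-`n` polynomials, are Hermite equivalent if there are
`U ∈ GL_n(ℤ)` and `ε ∈ {1,-1}` with `[g](U·X) = ε·[f](X)`. -/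
def HermiteEquiv (n : ℕ) (f g : Polynomial ℤ) : Prop :=
  ∃ (U : Matrix (Fin n) (Fin n) ℤ) (ε : ℤ), IsUnit U.det ∧ (ε = 1 ∨ ε = -1) ∧
    MvPolynomial.bind₁
        (fun i : Fin n => ∑ j : Fin n, MvPolynomial.C ((U i j : ℂ)) * MvPolynomial.X j)
        (hermiteForm n g)
      = MvPolynomial.C ((ε : ℂ)) * hermiteForm n f

/-- The translate `(f∘M)(X) = ∑ₖ f_k (aX+b)^k (cX+d)^(n-k)` of `f`, viewed as a
degree-`n` polynomial, by the matrix `M = (a b; c d)`. -/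
noncomputable def glTranslate (n : ℕ) (f : Polynomial ℤ) (M : Matrix (Fin 2) (Fin 2) ℤ) : Polynomial ℤ :=
  ∑ k ∈ Finset.range (n + 1),
    Polynomial.C (f.coeff k) * (Polynomial.C (M 0 0) * Polynomial.X + Polynomial.C (M 0 1)) ^ k *
      (Polynomial.C (M 1 0) * Polynomial.X + Polynomial.C (M 1 1)) ^ (n - k)

/-- `f` and `g`, viewed as degree-`n` polynomials, are `GL₂(ℤ)`-equivalent if
`g = ±(f∘M)` for some `M ∈ GL₂(ℤ)`. -/
def GL2Equiv (n : ℕ) (f g : Polynomial ℤ) : Prop :=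
  ∃ M : Matrix (Fin 2) (Fin 2) ℤ, IsUnit M.det ∧
    (g = glTranslate n f M ∨ g = -glTranslate n f M)

/-- The list of complex roots of `f`, counted with multiplicity (in some order). -/
noncomputable def rootList (f : Polynomial ℤ) : List ℂ :=
  ((f.map (Int.castRingHom ℂ)).roots).toList

/-- The discriminant `D(f) = f₀^(2n-2) ∏_{i<j} (αᵢ - α_j)²` of `f` (as a complex number;
it is independent of the ordering of the roots since the product is symmetric). -/
noncomputable def discC (f : Polynomial ℤ) : ℂ :=
  (f.leadingCoeff : ℂ) ^ (2 * f.natDegree - 2) *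
    ∏ p : Fin (rootList f).length × Fin (rootList f).length,
      if (p.1 : ℕ) < (p.2 : ℕ) then ((rootList f).get p.1 - (rootList f).get p.2) ^ 2 else 1

/-- `K_f := ℚ[X]/(f)`. -/
abbrev Kf (f : Polynomial ℤ) : Type := AdjoinRoot (f.map (Int.castRingHom ℚ))

/-- The residue class `α` of `X` in `K_f`. -/
noncomputable def rootOf (f : Polynomial ℤ) : Kf f := AdjoinRoot.root _

/-- `ζᵢ = f₀ αⁱ + f₁ α^(i-1) + ⋯ + f_{i-1} α`, where `f_j` is the coefficient of
`X^(n-j)` in `f`. -/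
noncomputable def zeta (f : Polynomial ℤ) (i : ℕ) : Kf f :=
  ∑ j ∈ Finset.range i, ((f.coeff (f.natDegree - j) : ℤ) : Kf f) * rootOf f ^ (i - j)

/-- The invariant module `I_f(k)`: the ℤ-span of `1, α, …, α^k, ζ_{k+1}, …, ζ_{n-1}`
inside `K_f`.  In particular `R_f = I_f(0)` and `I_f = I_f(1)`. -/
noncomputable def invModule (f : Polynomial ℤ) (k : ℕ) : Submodule ℤ (Kf f) :=
  Submodule.span ℤ
    ({x | ∃ j ≤ k, x = rootOf f ^ j} ∪
     {x | ∃ i, k + 1 ≤ i ∧ i ≤ f.natDegree - 1 ∧ x = zeta f i})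

/-- `f` and `g` are ℤ-equivalent: `g(X) = εⁿ f(εX + a)` with `ε = ±1`, `a ∈ ℤ`. -/
def ZEquiv (f g : Polynomial ℤ) : Prop :=
  ∃ ε a : ℤ, (ε = 1 ∨ ε = -1) ∧
    g = Polynomial.C (ε ^ f.natDegree) * f.comp (Polynomial.C ε * Polynomial.X + Polynomial.C a)

/-- The `(n-2)`-th partial sum `a⁽ⁿ⁾(X) = ∑_{i=0}^{n-2} Cᵢ Xⁱ` of the Catalan
generating function. -/
noncomputable def aPoly (n : ℕ) : Polynomial ℤ :=
  ∑ i ∈ Finset.range (n - 1), Polynomial.C ((catalan i : ℤ)) * Polynomial.X ^ i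

theorem exists_dvd_of_coeff_mul_prod (m : ℕ) (a : ℕ → ℤ) (e : ℕ) (P : ℤ[X])
    (h : (1 - X) ^ (e + m) ∣ P) :
    ∃ G : ℤ[X], (∀ k : ℕ, G.coeff k = (∏ i ∈ Finset.range m, ((k : ℤ) - a i)) * P.coeff k) ∧
      (1 - X) ^ e ∣ G := by
  induction m generalizing e with
  | zero => exact ⟨P, by simp, by simpa using h⟩
  | succ m ih =>
    obtain ⟨G, hG, hd⟩ := ih (e + 1) (by convert h using 2; ring)
    refine ⟨X * derivative G - C (a m) * G, fun k => ?_, ?_⟩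
    · rw [Finset.prod_range_succ]
      rcases k with _ | k
      · simp [hG]; ring
      · simp [hG, coeff_X_mul, coeff_derivative]; ring
    · obtain ⟨H, rfl⟩ := hd
      refine Dvd.intro (X * (-((e + 1 : ℕ) : ℤ[X]) * H + (1 - X) * derivative H) -
        C (a m) * ((1 - X) * H)) ?_
      rw [derivative_mul, derivative_pow]
      simp only [derivative_sub, derivative_one, derivative_X, C_eq_natCast, Nat.add_sub_cancel]
      ring

theorem abs_ring_choose_le (a : ℤ) (m b : ℕ) (h1 : a ≤ b) (h2 : -a + m ≤ b) :
    |Ring.choose a m| ≤ 2 ^ b := by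
  rcases le_or_gt 0 a with h | h
  · lift a to ℕ using h
    rw [Ring.choose_natCast]
    have h3 : a.choose m ≤ 2 ^ b :=
      (Nat.choose_le_two_pow a m).trans (Nat.pow_le_pow_right (by norm_num) (by exact_mod_cast h1))
    rw [abs_of_nonneg (by positivity)]
    exact_mod_cast h3
  · obtain ⟨c, rfl⟩ : ∃ c : ℕ, a = -((c : ℤ) + 1) := ⟨(-a - 1).toNat, by omega⟩
    rw [Ring.choose_neg]
    have h4 : ((c : ℤ) + 1 + m - 1) = ((c + m : ℕ) : ℤ) := by push_cast; ring
    rw [h4, Ring.choose_natCast]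
    have h3 : (c + m).choose m ≤ 2 ^ b :=
      (Nat.choose_le_two_pow _ m).trans (Nat.pow_le_pow_right (by norm_num) (by omega))
    rw [Units.smul_def, smul_eq_mul, abs_mul]
    simp only [Int.coe_negOnePow_natCast, abs_pow, abs_neg, abs_one, one_pow, one_mul]
    rw [abs_of_nonneg (by positivity)]
    exact_mod_cast h3

theorem coeff_one_sub_X_pow (R k : ℕ) :
    ((1 - X : ℤ[X]) ^ R).coeff k = (-1) ^ k * (R.choose k : ℤ) := by
  have : (1 - X : ℤ[X]) ^ R = ((1 + X : ℤ[X]) ^ R).comp (C (-1) * X) := by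
    simp [sub_eq_add_neg]
  rw [this, comp_C_mul_X_coeff, coeff_one_add_X_pow, mul_comm]

theorem dvd_of_one_sub_X_pow_dvd_C_mul {e : ℕ} {c : ℤ} (hc : c ≠ 0) {F : ℤ[X]}
    (h : (1 - X) ^ e ∣ C c * F) : (1 - X) ^ e ∣ F := by
  have h1 : ∀ G : ℤ[X], (1 - X) ^ e ∣ G ↔ (X - 1) ^ e ∣ G := fun G => by
    rw [← neg_sub X 1, neg_pow]
    exact (IsUnit.mul_left_dvd (IsUnit.pow _ isUnit_one.neg))
  rw [h1] at h ⊢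
  have hm : ((X - 1 : ℤ[X]) ^ e).Monic := (monic_X_sub_C (1 : ℤ)).pow e
  rw [← modByMonic_eq_zero_iff_dvd hm] at h ⊢
  rw [← smul_eq_C_mul, smul_modByMonic] at h
  exact (smul_eq_zero.mp h).resolve_left hc

/-- The hypergeometric polynomial behind the Padé approximations to `(1 - X) ^ (2 * N)`. -/
theorem exists_lacunary_poly (m : ℕ) :
    ∃ F : ℤ[X], (∀ k, |F.coeff k| ≤ 2 ^ (5 * (m + 1))) ∧
      (∀ k, m + 1 < k → k < 2 * (m + 1) → F.coeff k = 0) ∧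
      (∀ k, 3 * (m + 1) < k → F.coeff k = 0) ∧ F.coeff 0 ≠ 0 ∧ F.coeff (2 * (m + 1)) ≠ 0 ∧
      (1 - X) ^ (2 * (m + 1) + 1) ∣ F := by
  obtain ⟨G, hG, hd⟩ := exists_dvd_of_coeff_mul_prod m (fun i => (m : ℤ) + 2 + i)
    (2 * (m + 1) + 1) ((1 - X) ^ (3 * (m + 1))) (pow_dvd_pow _ (by omega))
  let q : ℕ → ℤ := fun k => Ring.choose ((k : ℤ) - (m + 2)) m
  have hq : ∀ k : ℕ, (∏ i ∈ Finset.range m, ((k : ℤ) - ((m : ℤ) + 2 + i))) = m.factorial * q k := by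
    intro k
    have := Ring.descPochhammer_eq_factorial_smul_choose ((k : ℤ) - (m + 2)) m
    rw [← nsmul_eq_mul, ← this, ← eval_eq_smeval, descPochhammer_eval_eq_prod_range]
    exact Finset.prod_congr rfl fun i _ => by ring
  let F : ℤ[X] := ∑ k ∈ Finset.range (3 * (m + 1) + 1),
    monomial k ((-1) ^ k * ((3 * (m + 1)).choose k : ℤ) * q k)
  have hF : ∀ k, F.coeff k = (-1) ^ k * ((3 * (m + 1)).choose k : ℤ) * q k := by
    intro k
    simp only [F, finsetSum_coeff, coeff_monomial, Finset.sum_ite_eq', Finset.mem_range]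
    split_ifs with h
    · rfl
    · rw [Nat.choose_eq_zero_of_lt (by omega)]; simp
  have hnz : ∀ k, k ≤ 3 * (m + 1) → (∀ i < m, k ≠ m + 2 + i) → F.coeff k ≠ 0 := by
    intro k hk hi h0
    have h1 := hG k
    have h2 : (∏ i ∈ Finset.range m, ((k : ℤ) - ((m : ℤ) + 2 + i))) ≠ 0 := by
      rw [Finset.prod_ne_zero_iff]
      intro i hi'
      have := hi i (Finset.mem_range.mp hi')
      omega
    rw [hq] at h2
    rw [hF] at h0
    have h3 := (Nat.choose_pos hk).ne'
    simp_all
  refine ⟨F, fun k => ?_, fun k h1 h2 => ?_, fun k hk => ?_, ?_, ?_, ?_⟩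
  · rw [hF]
    rcases le_or_gt k (3 * (m + 1)) with hk | hk
    · rw [abs_mul, abs_mul, abs_pow, abs_neg, abs_one, one_pow, one_mul]
      have h1 : |(((3 * (m + 1)).choose k : ℕ) : ℤ)| ≤ 2 ^ (3 * (m + 1)) := by
        rw [abs_of_nonneg (by positivity)]
        exact_mod_cast Nat.choose_le_two_pow _ _
      have h2 : |q k| ≤ 2 ^ (2 * (m + 1)) :=
        abs_ring_choose_le _ _ _ (by push_cast; omega) (by push_cast; omega)
      calc _ ≤ (2 : ℤ) ^ (3 * (m + 1)) * 2 ^ (2 * (m + 1)) := by gcongr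
        _ = _ := by rw [← pow_add]; ring_nf
    · rw [Nat.choose_eq_zero_of_lt hk]; simp
  · rw [hF]
    have : q k = 0 := by
      have h3 : ((k : ℤ) - (m + 2)) = ((k - (m + 2) : ℕ) : ℤ) := by push_cast [Nat.cast_sub (show m + 2 ≤ k by omega)]; ring
      simp only [q, h3, Ring.choose_natCast]
      rw [Nat.choose_eq_zero_of_lt (by omega)]; simp
    simp [this]
  · rw [hF, Nat.choose_eq_zero_of_lt hk]; simp
  · exact hnz 0 (by omega) (by omega)
  · exact hnz _ (by omega) (by omega)
  · apply dvd_of_one_sub_X_pow_dvd_C_mul (c := m.factorial) (by exact_mod_cast m.factorial_ne_zero)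
    convert hd
    ext k
    rw [hG, hq, coeff_one_sub_X_pow, coeff_C_mul, hF]
    ring


theorem abs_coeff_le_of_mul_one_sub_X_pow {N M : ℕ} (hM : 1 ≤ M) {W : ℤ} {F B : ℤ[X]}
    (hF : ∀ k, |F.coeff k| ≤ W) (h : B * (1 - X) ^ M = F) (k : ℕ) (hk : k ≤ N) :
    |B.coeff k| ≤ (N + 1) * (W * 2 ^ (M + N)) := by
  obtain ⟨d, rfl⟩ : ∃ d, M = d + 1 := ⟨M - 1, by omega⟩
  have hW : 0 ≤ W := (abs_nonneg _).trans (hF 0)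
  have h1 : (B : PowerSeries ℤ) =
      (PowerSeries.mk fun n => ((d + n).choose d : ℤ)) * (F : PowerSeries ℤ) := by
    have h2 := PowerSeries.mk_add_choose_mul_one_sub_pow_eq_one ℤ d
    rw [← h]
    push_cast
    rw [mul_comm (B : PowerSeries ℤ), ← mul_assoc]
    rw [h2, one_mul]
  have h3 : B.coeff k = PowerSeries.coeff k (B : PowerSeries ℤ) := by simp
  rw [h3, h1, PowerSeries.coeff_mul]
  calc _ ≤ ∑ p ∈ Finset.HasAntidiagonal.antidiagonal k, W * 2 ^ (d + 1 + N) := by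
        refine (Finset.abs_sum_le_sum_abs _ _).trans (Finset.sum_le_sum fun p hp => ?_)
        have h4 : p.1 ≤ N := by have := Finset.HasAntidiagonal.mem_antidiagonal.mp hp; omega
        rw [PowerSeries.coeff_mk, abs_mul, mul_comm, coeff_coe]
        have h5 : |((d + p.1).choose d : ℤ)| ≤ 2 ^ (d + 1 + N) := by
          rw [abs_of_nonneg (by positivity)]
          have := (Nat.choose_le_two_pow (d + p.1) d).trans
            (Nat.pow_le_pow_right (by norm_num) (show d + p.1 ≤ d + 1 + N by omega))
          exact_mod_cast this
        exact mul_le_mul (hF _) h5 (abs_nonneg _) hW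
    _ = (k + 1) * (W * 2 ^ (d + 1 + N)) := by simp
    _ ≤ _ := by gcongr

theorem exists_pade_of_lacunary {N : ℕ} (hN : 1 ≤ N) {W : ℤ} {F : ℤ[X]}
    (hW : ∀ k, |F.coeff k| ≤ W) (hgap : ∀ k, N < k → k < 2 * N → F.coeff k = 0)
    (htop : ∀ k, 3 * N < k → F.coeff k = 0) (hd : (1 - X) ^ (2 * N) ∣ F) :
    ∃ A B C : ℤ[X], (A.natDegree ≤ N ∧ B.natDegree ≤ N ∧ C.natDegree ≤ N) ∧
      (∀ k, |A.coeff k| ≤ W * 16 ^ N ∧ |B.coeff k| ≤ W * 16 ^ N ∧ |C.coeff k| ≤ W * 16 ^ N) ∧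
      A * X ^ (2 * N) + B * (1 - X) ^ (2 * N) + C = 0 ∧
      A.coeff 0 = F.coeff (2 * N) ∧ C.coeff 0 = F.coeff 0 := by
  have hW0 : 0 ≤ W := (abs_nonneg _).trans (hW 0)
  have hWW : W ≤ W * 16 ^ N := le_mul_of_one_le_right hW0 (one_le_pow₀ (by norm_num))
  obtain ⟨B, hB⟩ := hd
  let A : ℤ[X] := ∑ k ∈ Finset.range (N + 1), monomial k (F.coeff (2 * N + k))
  let C' : ℤ[X] := ∑ k ∈ Finset.range (N + 1), monomial k (F.coeff k)
  have hA : ∀ k, A.coeff k = if k < N + 1 then F.coeff (2 * N + k) else 0 := fun k => by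
    simp only [A, finsetSum_coeff, coeff_monomial, Finset.sum_ite_eq', Finset.mem_range]
  have hC : ∀ k, C'.coeff k = if k < N + 1 then F.coeff k else 0 := fun k => by
    simp only [C', finsetSum_coeff, coeff_monomial, Finset.sum_ite_eq', Finset.mem_range]
  have hsum : A * X ^ (2 * N) + C' = F := by
    ext k
    rw [coeff_add, coeff_mul_X_pow', hA, hC]
    rcases le_or_gt (2 * N) k with h | h
    · rw [if_pos h, if_neg (by omega : ¬ k < N + 1), add_zero]
      split_ifs with h2
      · congr 1; omega
      · rw [htop k (by omega)]
    · rw [if_neg (by omega)]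
      split_ifs with h2
      · simp
      · rw [hgap k (by omega) h]; simp
  have hBF : -B * (1 - X) ^ (2 * N) = -F := by rw [hB]; ring
  have hAd : A.natDegree ≤ N := natDegree_le_iff_coeff_eq_zero.mpr fun k hk => by
    rw [hA, if_neg (by omega)]
  have hCd : C'.natDegree ≤ N := natDegree_le_iff_coeff_eq_zero.mpr fun k hk => by
    rw [hC, if_neg (by omega)]
  have hBd : (-B).natDegree ≤ N := by
    rw [natDegree_neg]
    rcases eq_or_ne B 0 with rfl | hB0
    · simp
    have h1 : F.natDegree ≤ 3 * N := natDegree_le_iff_coeff_eq_zero.mpr htop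
    have h2 : (1 - X : ℤ[X]).natDegree = 1 := by
      rw [← neg_sub, natDegree_neg]; exact natDegree_X_sub_C 1
    have h3 : (1 - X : ℤ[X]) ≠ 0 := by intro h; simp [h] at h2
    rw [hB, natDegree_mul (pow_ne_zero _ h3) hB0, natDegree_pow, h2] at h1
    omega
  have h2N : ((N : ℤ) + 1) * (W * 2 ^ (2 * N + N)) ≤ W * 16 ^ N := by
    have h1 : ((N : ℤ) + 1) ≤ 2 ^ N := by exact_mod_cast Nat.lt_two_pow_self (n := N)
    calc ((N : ℤ) + 1) * (W * 2 ^ (2 * N + N)) ≤ 2 ^ N * (W * 2 ^ (2 * N + N)) := by gcongr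
      _ = W * 16 ^ N := by
        rw [show (16 : ℤ) = 2 ^ 4 by norm_num, ← pow_mul, mul_left_comm, ← pow_add]; ring_nf
  refine ⟨A, -B, C', ⟨hAd, hBd, hCd⟩, fun k => ⟨?_, ?_, ?_⟩, ?_, ?_, ?_⟩
  · rw [hA]
    split_ifs
    · exact (hW _).trans hWW
    · simpa using hW0.trans hWW
  · rcases le_or_gt k N with hk | hk
    · exact (abs_coeff_le_of_mul_one_sub_X_pow (by omega) (F := -F) (by simpa using hW) hBF k
        hk).trans h2N
    · rw [coeff_eq_zero_of_natDegree_lt (by omega)]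
      simpa using hW0.trans hWW
  · rw [hC]
    split_ifs
    · exact (hW _).trans hWW
    · simpa using hW0.trans hWW
  · rw [hBF, ← hsum]; ring
  · simp [hA]
  · simp [hC]

/-- Two independent Padé-type relations between `X ^ (2 * N)`, `(1 - X) ^ (2 * N)` and `1`. -/
theorem exists_pade_relations {N : ℕ} (hN : 1 ≤ N) :
    ∃ A B C : Fin 2 → ℤ[X],
      (∀ i, (A i).natDegree ≤ N ∧ (B i).natDegree ≤ N ∧ (C i).natDegree ≤ N) ∧
      (∀ i k, |(A i).coeff k| ≤ 2048 ^ N ∧ |(B i).coeff k| ≤ 2048 ^ N ∧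
        |(C i).coeff k| ≤ 2048 ^ N) ∧
      (∀ i, A i * X ^ (2 * N) + B i * (1 - X) ^ (2 * N) + C i = 0) ∧
      ∃ c : ℤ, c ≠ 0 ∧ A 0 * B 1 - A 1 * B 0 = Polynomial.C c := by
  obtain ⟨m, rfl⟩ : ∃ m, N = m + 1 := ⟨N - 1, by omega⟩
  obtain ⟨F, hb, hgap, htop, h0, hM, hd⟩ := exists_lacunary_poly m
  set N := m + 1 with hNdef
  have hb' : ∀ k, |F.coeff k| ≤ 2 ^ (7 * N) := fun k =>
    (hb k).trans (pow_le_pow_right₀ (by norm_num) (by omega))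
  have hc : ∀ k, (X * derivative F).coeff k = k * F.coeff k := fun k => by
    rcases k with _ | k
    · simp
    · rw [coeff_X_mul, coeff_derivative]; push_cast; ring
  have hb2 : ∀ k, |(X * derivative F).coeff k| ≤ 2 ^ (7 * N) := fun k => by
    rw [hc, abs_mul]
    rcases le_or_gt k (3 * N) with hk | hk
    · have h1 : |(k : ℤ)| ≤ 2 ^ (2 * N) := by
        rw [abs_of_nonneg (by positivity)]
        have h2 : ∀ m : ℕ, 3 * (m + 1) ≤ 2 ^ (2 * (m + 1)) := fun m => by
          induction m with
          | zero => norm_num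
          | succ m ih => rw [mul_add 2 (m + 1), pow_add]; omega
        exact_mod_cast hk.trans (h2 m)
      calc _ ≤ (2 : ℤ) ^ (2 * N) * 2 ^ (5 * N) := mul_le_mul h1 (hb k) (abs_nonneg _) (by positivity)
        _ = _ := by rw [← pow_add]; ring_nf
    · rw [htop k hk]; simp
  obtain ⟨A₀, B₀, C₀, hdeg₀, hco₀, hrel₀, hA₀, hC₀⟩ := exists_pade_of_lacunary hN hb' hgap htop
    ((pow_dvd_pow _ (by omega)).trans hd)
  obtain ⟨A₁, B₁, C₁, hdeg₁, hco₁, hrel₁, hA₁, hC₁⟩ := exists_pade_of_lacunary hN hb2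
    (fun k h1 h2 => by rw [hc, hgap k h1 h2, mul_zero]) (fun k h => by rw [hc, htop k h, mul_zero])
    (by
      obtain ⟨H, rfl⟩ := hd
      refine Dvd.intro (X * (-((2 * N + 1 : ℕ) : ℤ[X]) * H + (1 - X) * derivative H)) ?_
      rw [derivative_mul, derivative_pow]
      simp only [derivative_sub, derivative_one, derivative_X, C_eq_natCast, Nat.add_sub_cancel]
      ring)
  have hbd : (2 : ℤ) ^ (7 * N) * 16 ^ N = 2048 ^ N := by
    rw [pow_mul, ← mul_pow]; norm_num
  rw [hbd] at hco₀ hco₁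
  have hdet : (A₀ * B₁ - A₁ * B₀) * (1 - X) ^ (2 * N) = A₁ * C₀ - A₀ * C₁ := by
    linear_combination A₀ * hrel₁ - A₁ * hrel₀
  have hval : (A₀ * B₁ - A₁ * B₀).coeff 0 = 2 * N * F.coeff (2 * N) * F.coeff 0 := by
    have := congrArg (fun p => coeff p 0) hdet
    simp only [mul_coeff_zero, coeff_sub, hA₁, hA₀, hC₀, hC₁, hc] at this ⊢
    simpa [coeff_zero_eq_eval_zero] using this
  have hne : (2 * N * F.coeff (2 * N) * F.coeff 0 : ℤ) ≠ 0 := by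
    have : (N : ℤ) ≠ 0 := by positivity
    exact mul_ne_zero (mul_ne_zero (mul_ne_zero two_ne_zero this) hM) h0
  refine ⟨![A₀, A₁], ![B₀, B₁], ![C₀, C₁], ?_, ?_, ?_, _, hne, ?_⟩
  · intro i; fin_cases i <;> simpa
  · intro i k; fin_cases i
    · simpa using hco₀ k
    · simpa using hco₁ k
  · intro i; fin_cases i <;> simpa
  · simp only [Matrix.cons_val_zero, Matrix.cons_val_one]
    rw [← hval]
    apply eq_C_of_natDegree_eq_zero
    have h2 : (1 - X : ℤ[X]).natDegree = 1 := by
      rw [← neg_sub, natDegree_neg]; exact natDegree_X_sub_C 1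
    have h3 : (1 - X : ℤ[X]) ≠ 0 := by intro h; simp [h] at h2
    have h4 : (A₀ * B₁ - A₁ * B₀) ≠ 0 := by
      intro h; rw [h] at hval; exact hne (by rw [← hval]; simp)
    have h5 := congrArg natDegree hdet
    rw [natDegree_mul h4 (pow_ne_zero _ h3), natDegree_pow, h2] at h5
    have h6 : (A₁ * C₀ - A₀ * C₁).natDegree ≤ N + N :=
      (natDegree_sub_le_of_le (natDegree_mul_le_of_le hdeg₁.1 hdeg₀.2.2)
        (natDegree_mul_le_of_le hdeg₀.1 hdeg₁.2.2)).trans (max_self _).le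
    omega

theorem norm_aeval_le {N : ℕ} {W : ℤ} {P : ℤ[X]} (hd : P.natDegree ≤ N)
    (hW : ∀ k, |P.coeff k| ≤ W) (z : ℂ) :
    ‖aeval z P‖ ≤ (N + 1) * W * max 1 ‖z‖ ^ N := by
  rw [aeval_eq_sum_range' (Nat.lt_succ_of_le hd)]
  calc _ ≤ ∑ k ∈ Finset.range (N + 1), (W : ℝ) * max 1 ‖z‖ ^ N := by
        refine norm_sum_le_of_le _ fun k hk => ?_
        rw [zsmul_eq_mul, norm_mul, norm_pow, Complex.norm_intCast]
        have h1 : |(P.coeff k : ℝ)| ≤ W := by exact_mod_cast hW k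
        have h2 : ‖z‖ ^ k ≤ max 1 ‖z‖ ^ N :=
          (pow_le_pow_left₀ (norm_nonneg _) (le_max_right _ _) k).trans
            (pow_le_pow_right₀ (le_max_left _ _) (Nat.lt_succ_iff.mp (Finset.mem_range.mp hk)))
        exact mul_le_mul h1 h2 (by positivity) ((abs_nonneg _).trans h1)
    _ = _ := by simp; ring

theorem isIntegral_pow_mul_aeval {K : Type*} [Field K] {D : ℤ} {x : K}
    (hx : IsIntegral ℤ ((D : K) * x)) {N : ℕ} {P : ℤ[X]} (hd : P.natDegree ≤ N) :
    IsIntegral ℤ ((D : K) ^ N * aeval x P) := by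
  rw [aeval_eq_sum_range' (Nat.lt_succ_of_le hd), Finset.mul_sum]
  refine IsIntegral.sum _ fun k hk => ?_
  have hk' : k ≤ N := Nat.lt_succ_iff.mp (Finset.mem_range.mp hk)
  have : (D : K) ^ N * (P.coeff k • x ^ k) =
      ((P.coeff k * D ^ (N - k) : ℤ) : K) * ((D : K) * x) ^ k := by
    rw [zsmul_eq_mul, mul_pow, ← Nat.sub_add_cancel hk', pow_add]
    push_cast
    rw [Nat.sub_add_cancel hk']
    ring
  rw [this]
  exact (isIntegral_algebraMap (R := ℤ) (x := P.coeff k * D ^ (N - k))).mul (hx.pow k)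

/-- `x` and `x⁻¹` are integral up to the denominator `D`. -/
def IsAlmostUnit {K : Type*} [Field K] (D : ℤ) (x : K) : Prop :=
  x ≠ 0 ∧ IsIntegral ℤ ((D : K) * x) ∧ IsIntegral ℤ ((D : K) * x⁻¹)

section Height

variable {K : Type*} [Field K] [NumberField K]

theorem one_le_prod_norm_embeddings {x : K} (hx : x ≠ 0) (hi : IsIntegral ℤ x) :
    1 ≤ ∏ σ : K →+* ℂ, ‖σ x‖ := by
  have h1 : (∏ σ : K →+* ℂ, σ x) = ((Algebra.norm ℚ x : ℚ) : ℂ) := by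
    have := Algebra.norm_eq_prod_embeddings ℚ ℂ x
    rw [eq_ratCast] at this
    rw [this]
    exact Fintype.prod_equiv (RingHom.equivRatAlgHom K ℂ) _ _ fun _ => rfl
  have h2 : IsIntegral ℤ (Algebra.norm ℚ x) := Algebra.isIntegral_norm ℚ hi
  obtain ⟨m, hm⟩ := IsIntegrallyClosed.isIntegral_iff.mp h2
  have h3 : m ≠ 0 := by
    rintro rfl
    have := (Algebra.norm_ne_zero_iff (R := ℚ)).mpr hx
    simp at hm
    exact this hm.symm
  rw [← norm_prod, h1, ← hm]
  simp only [algebraMap_int_eq, eq_intCast, Rat.cast_intCast, Complex.norm_intCast]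
  exact_mod_cast Int.one_le_abs h3

theorem sum_log_norm_embeddings_ge {D : ℤ} (hD : D ≠ 0) {n : ℕ} {x : K} (hx : x ≠ 0)
    (hi : IsIntegral ℤ ((D : K) ^ n * x)) :
    -(Fintype.card (K →+* ℂ) * (n * Real.log |(D : ℝ)|)) ≤ ∑ σ : K →+* ℂ, Real.log ‖σ x‖ := by
  have hD' : (D : K) ≠ 0 := by exact_mod_cast hD
  have h1 := one_le_prod_norm_embeddings (mul_ne_zero (pow_ne_zero n hD') hx) hi
  have h2 := Real.log_nonneg h1
  rw [Real.log_prod (fun σ _ => by simp [hD, hx])] at h2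
  have h3 : ∀ σ : K →+* ℂ, Real.log ‖σ ((D : K) ^ n * x)‖ =
      n * Real.log |(D : ℝ)| + Real.log ‖σ x‖ := fun σ => by
    rw [map_mul, norm_mul, Real.log_mul (by simp [hD]) (by simp [hx])]
    simp [Real.log_pow]
  simp only [h3, Finset.sum_add_distrib, Finset.sum_const, Finset.card_univ, nsmul_eq_mul] at h2
  linarith

/-- The archimedean part of the logarithmic height of `x`. -/
noncomputable def archHeight (x : K) : ℝ := ∑ σ : K →+* ℂ, Real.log (max 1 ‖σ x‖)

/-- The logarithmic embedding of the pair `(x, 1 - x)`. -/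
noncomputable def logPair (x : K) : (K →+* ℂ) ⊕ (K →+* ℂ) → ℝ :=
  Sum.elim (fun σ => Real.log ‖σ x‖) (fun σ => Real.log ‖σ (1 - x)‖)


theorem archHeight_le {D : ℤ} (hD : D ≠ 0) {N : ℕ} (hN : 1 ≤ N) {x x' : K}
    (hx : IsAlmostUnit D x) (hy : IsAlmostUnit D (1 - x))
    (hx' : IsAlmostUnit D x') (hy' : IsAlmostUnit D (1 - x')) :
    N * archHeight x ≤ (∑ i, |(logPair x' - (2 * N : ℝ) • logPair x) i|) +
      N * (Fintype.card (K →+* ℂ) * (4 * Real.log |(D : ℝ)| + Real.log 8192)) := by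
  obtain ⟨A, B, C, hdeg, hco, hrel, c, hc, hdet⟩ := exists_pade_relations hN
  set ξ : K := x' * x⁻¹ ^ (2 * N) with hξ
  set η : K := (1 - x') * (1 - x)⁻¹ ^ (2 * N) with hη
  have hx0 := hx.1
  have hy0 := hy.1
  have hξ0 : ξ ≠ 0 := mul_ne_zero hx'.1 (pow_ne_zero _ (inv_ne_zero hx.1))
  have hη0 : η ≠ 0 := mul_ne_zero hy'.1 (pow_ne_zero _ (inv_ne_zero hy.1))
  have hξx : ξ * x ^ (2 * N) = x' := by
    rw [hξ, mul_assoc, ← mul_pow, inv_mul_cancel₀ hx0, one_pow, mul_one]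
  have hηy : η * (1 - x) ^ (2 * N) = 1 - x' := by
    rw [hη, mul_assoc, ← mul_pow, inv_mul_cancel₀ hy0, one_pow, mul_one]
  have hone : ξ * x ^ (2 * N) + η * (1 - x) ^ (2 * N) = 1 := by rw [hξx, hηy]; ring
  have hrel' : ∀ i, aeval x (A i) * x ^ (2 * N) + aeval x (B i) * (1 - x) ^ (2 * N) +
      aeval x (C i) = 0 := fun i => by
    simpa using congrArg (aeval x) (hrel i)
  have hdet' : aeval x (A 0) * aeval x (B 1) - aeval x (A 1) * aeval x (B 0) = (c : K) := by
    simpa using congrArg (aeval x) hdet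
  have hcK : (c : K) ≠ 0 := by exact_mod_cast hc
  obtain ⟨i, hi⟩ : ∃ i, ξ * aeval x (B i) - η * aeval x (A i) ≠ 0 := by
    by_contra! h
    apply hcK
    have : ξ * (c : K) = 0 := by
      rw [← hdet']
      linear_combination aeval x (A 0) * h 1 - aeval x (A 1) * h 0
    exact (mul_eq_zero.mp this).resolve_left hξ0
  set l := ξ * aeval x (B i) - η * aeval x (A i) with hl
  have hlx : l * x ^ (2 * N) = η * aeval x (C i) + aeval x (B i) := by
    rw [hl]
    linear_combination aeval x (B i) * hone - η * hrel' i
  have hint : IsIntegral ℤ ((D : K) ^ (3 * N + 1) * l) := by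
    have h1 : (D : K) ^ (3 * N + 1) * l =
        ((D : K) * x') * ((D : K) * x⁻¹) ^ (2 * N) * ((D : K) ^ N * aeval x (B i)) -
        ((D : K) * (1 - x')) * ((D : K) * (1 - x)⁻¹) ^ (2 * N) *
          ((D : K) ^ N * aeval x (A i)) := by
      rw [hl, hξ, hη]; ring
    rw [h1]
    exact ((hx'.2.1.mul (hx.2.2.pow _)).mul (isIntegral_pow_mul_aeval hx.2.1 (hdeg i).2.1)).sub
      ((hy'.2.1.mul (hy.2.2.pow _)).mul (isIntegral_pow_mul_aeval hx.2.1 (hdeg i).1))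
  clear_value ξ η
  have hlow := sum_log_norm_embeddings_ge hD hi hint
  have hlogD : 0 ≤ Real.log |(D : ℝ)| :=
    Real.log_nonneg (by exact_mod_cast Int.one_le_abs hD)
  have key : ∀ σ : K →+* ℂ, Real.log ‖σ l‖ + N * Real.log (max 1 ‖σ x‖) ≤
      (|Real.log ‖σ x'‖ - 2 * N * Real.log ‖σ x‖| +
        |Real.log ‖σ (1 - x')‖ - 2 * N * Real.log ‖σ (1 - x)‖|) + N * Real.log 8192 := by
    intro σ
    have n0 : ∀ {z : K}, z ≠ 0 → 0 < ‖σ z‖ := fun hz => norm_pos_iff.mpr ((map_ne_zero σ).mpr hz)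
    have e1 : Real.log ‖σ x'‖ - 2 * N * Real.log ‖σ x‖ = Real.log ‖σ ξ‖ := by
      rw [← hξx, map_mul, map_pow, norm_mul, norm_pow,
        Real.log_mul (n0 hξ0).ne' (pow_pos (n0 hx0) _).ne', Real.log_pow]
      push_cast; ring
    have e2 : Real.log ‖σ (1 - x')‖ - 2 * N * Real.log ‖σ (1 - x)‖ = Real.log ‖σ η‖ := by
      rw [← hηy, map_mul, map_pow, norm_mul, norm_pow,
        Real.log_mul (n0 hη0).ne' (pow_pos (n0 hy0) _).ne', Real.log_pow]
      push_cast; ring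
    rw [e1, e2]
    set m := max 1 ‖σ x‖ with hm
    have hm1 : 1 ≤ m := le_max_left _ _
    set E := Real.exp (|Real.log ‖σ ξ‖| + |Real.log ‖σ η‖|) with hE
    have hEξ : ‖σ ξ‖ ≤ E := by
      rw [← Real.exp_log (n0 hξ0)]
      exact Real.exp_le_exp.mpr
        ((le_abs_self _).trans (le_add_of_nonneg_right (abs_nonneg _)))
    have hEη : ‖σ η‖ ≤ E := by
      rw [← Real.exp_log (n0 hη0)]
      exact Real.exp_le_exp.mpr
        ((le_abs_self _).trans (le_add_of_nonneg_left (abs_nonneg _)))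
    have hE1 : 1 ≤ E := Real.one_le_exp (by positivity)
    have hev : ∀ P : ℤ[X], P.natDegree ≤ N → (∀ k, |P.coeff k| ≤ 2048 ^ N) →
        ‖σ (aeval x P)‖ ≤ (N + 1) * 2048 ^ N * m ^ N := fun P h1 h2 => by
      have h3 : σ (aeval x P) = aeval (σ x) P :=
        (Polynomial.aeval_algHom_apply σ.toIntAlgHom x P).symm
      rw [h3]
      simpa using norm_aeval_le h1 h2 (σ x)
    set W : ℝ := (N + 1) * 2048 ^ N * m ^ N with hW
    have hW0 : 0 ≤ W := by positivity
    have hbd : ‖σ l‖ * m ^ (2 * N) ≤ E * W + E * W := by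
      rcases le_total ‖σ x‖ 1 with h | h
      · rw [hm, max_eq_left h, one_pow, mul_one, hl, map_sub, map_mul, map_mul]
        refine (norm_sub_le _ _).trans ?_
        rw [norm_mul, norm_mul]
        exact add_le_add
          (mul_le_mul hEξ (hev _ (hdeg i).2.1 fun k => (hco i k).2.1) (norm_nonneg _) (by positivity))
          (mul_le_mul hEη (hev _ (hdeg i).1 fun k => (hco i k).1) (norm_nonneg _) (by positivity))
      · rw [hm, max_eq_right h, ← norm_pow, ← norm_mul, ← map_pow, ← map_mul, hlx, map_add, map_mul]
        refine (norm_add_le _ _).trans ?_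
        rw [norm_mul]
        refine add_le_add
          (mul_le_mul hEη (hev _ (hdeg i).2.2 fun k => (hco i k).2.2) (norm_nonneg _) (by positivity))
          ((hev _ (hdeg i).2.1 fun k => (hco i k).2.1).trans (le_mul_of_one_le_left hW0 hE1))
    have h4 : (2 * (N + 1) : ℝ) ≤ 4 ^ N := by
      obtain ⟨k, rfl⟩ : ∃ k, N = k + 1 := ⟨N - 1, by omega⟩
      have : ∀ k : ℕ, 2 * (k + 1 + 1) ≤ 4 ^ (k + 1) := fun k => by
        induction k with
        | zero => norm_num
        | succ k ih => rw [pow_succ]; omega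
      exact_mod_cast this k
    have hbd2 : ‖σ l‖ * m ^ N ≤ E * 8192 ^ N := by
      have h5 : (‖σ l‖ * m ^ N) * m ^ N ≤ (E * 8192 ^ N) * m ^ N := by
        calc (‖σ l‖ * m ^ N) * m ^ N = ‖σ l‖ * m ^ (2 * N) := by ring
          _ ≤ E * W + E * W := hbd
          _ = (2 * (N + 1)) * (E * 2048 ^ N * m ^ N) := by rw [hW]; ring
          _ ≤ 4 ^ N * (E * 2048 ^ N * m ^ N) := by gcongr
          _ = E * (4 ^ N * 2048 ^ N) * m ^ N := by ring
          _ = _ := by rw [← mul_pow]; norm_num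
      exact le_of_mul_le_mul_right h5 (by positivity)
    have h6 := Real.log_le_log (mul_pos (n0 hi) (by positivity)) hbd2
    rw [Real.log_mul (n0 hi).ne' (by positivity), Real.log_mul (by positivity) (by positivity),
      Real.log_pow, Real.log_pow, hE, Real.log_exp] at h6
    exact h6
  have hsum := Finset.sum_le_sum fun (σ : K →+* ℂ) (_ : σ ∈ Finset.univ) => key σ
  simp only [Finset.sum_add_distrib, ← Finset.mul_sum, Finset.sum_const, Finset.card_univ,
    nsmul_eq_mul] at hsum
  have hsplit : (∑ i, |(logPair x' - (2 * N : ℝ) • logPair x) i|) =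
      (∑ σ : K →+* ℂ, |Real.log ‖σ x'‖ - 2 * N * Real.log ‖σ x‖|) +
        ∑ σ : K →+* ℂ, |Real.log ‖σ (1 - x')‖ - 2 * N * Real.log ‖σ (1 - x)‖| := by
    rw [Fintype.sum_sum_type]
    simp [logPair]
  rw [hsplit, archHeight]
  push_cast at hlow
  have hN1 : (1 : ℝ) ≤ N := by exact_mod_cast hN
  have hd0 : (0 : ℝ) ≤ Fintype.card (K →+* ℂ) * Real.log |(D : ℝ)| := by positivity
  nlinarith [mul_le_mul_of_nonneg_right hN1 hd0]

theorem norm_logPair_le {D : ℤ} (hD : D ≠ 0) {x : K}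
    (hx : IsAlmostUnit D x) (hy : IsAlmostUnit D (1 - x)) :
    ‖logPair x‖ ≤ 2 * archHeight x +
      Fintype.card (K →+* ℂ) * (2 * Real.log 2 + Real.log |(D : ℝ)|) := by
  have hlog2 : 0 ≤ Real.log 2 := Real.log_nonneg (by norm_num)
  have habs : ∀ t : ℝ, 0 < t → |Real.log t| = 2 * Real.log (max 1 t) - Real.log t := fun t ht => by
    rcases le_total t 1 with h | h
    · rw [max_eq_left h, abs_of_nonpos (Real.log_nonpos ht.le h)]; simp
    · rw [max_eq_right h, abs_of_nonneg (Real.log_nonneg h)]; ring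
  have main : ∀ z : K, IsAlmostUnit D z →
      (∀ σ : K →+* ℂ, Real.log (max 1 ‖σ z‖) ≤ Real.log 2 + Real.log (max 1 ‖σ x‖)) →
      ∀ σ : K →+* ℂ, |Real.log ‖σ z‖| ≤ 2 * archHeight x +
      Fintype.card (K →+* ℂ) * (2 * Real.log 2 + Real.log |(D : ℝ)|) := by
    intro z hz hle σ
    have h1 := sum_log_norm_embeddings_ge hD (n := 1) hz.1 (by simpa using hz.2.1)
    have h2 : |Real.log ‖σ z‖| ≤ ∑ τ : K →+* ℂ, |Real.log ‖τ z‖| :=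
      Finset.single_le_sum (f := fun τ : K →+* ℂ => |Real.log ‖τ z‖|)
        (fun τ _ => abs_nonneg _) (Finset.mem_univ σ)
    have h3 : ∑ τ : K →+* ℂ, |Real.log ‖τ z‖| ≤
        ∑ τ : K →+* ℂ, (2 * (Real.log 2 + Real.log (max 1 ‖τ x‖)) - Real.log ‖τ z‖) :=
      Finset.sum_le_sum fun τ _ => by
        rw [habs _ (norm_pos_iff.mpr ((map_ne_zero τ).mpr hz.1))]
        linarith [hle τ]
    simp only [Finset.sum_sub_distrib, ← Finset.mul_sum, Finset.sum_add_distrib, Finset.sum_const,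
      Finset.card_univ, nsmul_eq_mul] at h3
    rw [archHeight]
    push_cast at h1
    linarith
  have hh : 0 ≤ 2 * archHeight x +
      Fintype.card (K →+* ℂ) * (2 * Real.log 2 + Real.log |(D : ℝ)|) := by
    have h1 : 0 ≤ archHeight x := Finset.sum_nonneg fun σ _ => Real.log_nonneg (le_max_left _ _)
    have h2 : 0 ≤ Real.log |(D : ℝ)| := Real.log_nonneg (by exact_mod_cast Int.one_le_abs hD)
    positivity
  rw [pi_norm_le_iff_of_nonneg hh]
  rintro (σ | σ)
  · exact main x hx (fun τ => by linarith) σ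
  · refine main (1 - x) hy (fun τ => ?_) σ
    rw [← Real.log_mul (by norm_num) (by positivity)]
    refine Real.log_le_log (by positivity) (max_le ?_ ?_)
    · linarith [le_max_left 1 ‖τ x‖]
    · rw [map_sub, map_one]
      refine (norm_sub_le _ _).trans ?_
      rw [norm_one]
      linarith [le_max_left 1 ‖τ x‖, le_max_right 1 ‖τ x‖]

end Height

/-- A gap principle: a set of vectors in which nearly parallel vectors of very different lengths
repel each other is bounded. -/
theorem exists_norm_le_of_gap {E : Type*} [NormedAddCommGroup E] [NormedSpace ℝ E]
    [FiniteDimensional ℝ E] {T : Set E} {κ c : ℝ} (hκ : 0 ≤ κ) (hc : 0 ≤ c)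
    (h : ∀ p ∈ T, ∀ p' ∈ T, ∀ N : ℕ, 1 ≤ N →
      N * ‖p‖ ≤ κ * ‖p' - (2 * N : ℝ) • p‖ + c * N) :
    ∃ R : ℝ, ∀ p ∈ T, ‖p‖ ≤ R := by
  have : ProperSpace E := FiniteDimensional.proper ℝ E
  by_contra! hunb
  set ε : ℝ := 1 / (16 * κ + 16) with hε
  have hε0 : 0 < ε := by positivity
  obtain ⟨t, htf, hcov⟩ := Metric.totallyBounded_iff.mp
    (isCompact_closedBall (0 : E) 1).totallyBounded ε hε0
  have hpig : ∃ y ∈ t, ∀ R : ℝ, ∃ p ∈ T, R < ‖p‖ ∧ ‖‖p‖⁻¹ • p - y‖ < ε := by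
    by_contra! hno
    choose! R hR using hno
    obtain ⟨M, hM⟩ := (htf.image R).bddAbove
    obtain ⟨p, hp, hpM⟩ := hunb (max M 0)
    have hp0 : ‖p‖ ≠ 0 := ((le_max_right M 0).trans_lt hpM).ne'
    have h1 : ‖p‖⁻¹ • p ∈ Metric.closedBall (0 : E) 1 := by
      rw [mem_closedBall_zero_iff, norm_smul, norm_inv, norm_norm, inv_mul_cancel₀ hp0]
    obtain ⟨y, hy, hdist⟩ := Set.mem_iUnion₂.mp (hcov h1)
    have h2 : ‖‖p‖⁻¹ • p - y‖ < ε := by rw [← dist_eq_norm]; exact hdist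
    exact absurd h2 (not_lt.mpr
      (hR y hy p hp ((hM ⟨y, hy, rfl⟩).trans_lt ((le_max_left _ _).trans_lt hpM))))
  obtain ⟨y, -, hy⟩ := hpig
  obtain ⟨p, hp, hpR, hpy⟩ := hy (4 * c + 1)
  obtain ⟨p', hp', hpR', hpy'⟩ := hy (4 * (2 * κ + 1) * ‖p‖ + 4 * ‖p‖)
  set a := ‖p‖ with ha
  set b := ‖p'‖ with hb
  have ha0 : 0 < a := by linarith
  have hb0 : 0 < b := lt_of_le_of_lt (by positivity) hpR'
  have hba : 4 * a ≤ b := by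
    have : 0 ≤ 4 * (2 * κ + 1) * a := by positivity
    linarith
  set N := ⌊b / (2 * a)⌋₊ with hN
  have hq : b / (2 * a) * (2 * a) = b := by field_simp
  have hq1 : 1 ≤ b / (2 * a) := by rw [le_div_iff₀ (by positivity)]; linarith
  have hN1 : 1 ≤ N := Nat.one_le_floor_iff _ |>.mpr hq1
  have hNle : (N : ℝ) ≤ b / (2 * a) := Nat.floor_le (by positivity)
  have hNgt : b / (2 * a) < N + 1 := Nat.lt_floor_add_one _
  have hNle' : N * (2 * a) ≤ b := by
    rw [← hq]; exact mul_le_mul_of_nonneg_right hNle (by positivity)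
  have hNgt' : b < (N + 1) * (2 * a) := by
    rw [← hq]; exact mul_lt_mul_of_pos_right hNgt (by positivity)
  have hdir : ‖b⁻¹ • p' - a⁻¹ • p‖ ≤ 2 * ε := by
    have : b⁻¹ • p' - a⁻¹ • p = (b⁻¹ • p' - y) - (a⁻¹ • p - y) := by abel
    rw [this]
    exact (norm_sub_le _ _).trans (by linarith)
  have hdist : ‖p' - (2 * N : ℝ) • p‖ ≤ 2 * ε * b + 2 * a := by
    have h1 : p' - (2 * N : ℝ) • p = b • (b⁻¹ • p' - a⁻¹ • p) + (b / a - 2 * N) • p := by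
      rw [smul_sub, smul_smul, smul_smul, mul_inv_cancel₀ hb0.ne', one_smul, sub_smul,
        div_eq_mul_inv]
      abel
    rw [h1]
    refine (norm_add_le _ _).trans (add_le_add ?_ ?_)
    · rw [norm_smul, Real.norm_of_nonneg hb0.le, mul_comm]
      exact mul_le_mul_of_nonneg_right hdir hb0.le
    · rw [norm_smul, ← ha]
      refine mul_le_mul_of_nonneg_right ?_ ha0.le
      have h2 : b / a = 2 * (b / (2 * a)) := by field_simp
      rw [Real.norm_eq_abs, abs_le, h2]
      constructor <;> linarith
  have key := h p hp p' hp' N hN1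
  have h5 : κ * ε ≤ 1 / 16 := by
    rw [hε, mul_one_div, div_le_div_iff₀ (by positivity) (by norm_num)]
    linarith
  have h6 : κ * ‖p' - (2 * N : ℝ) • p‖ ≤ b / 8 + 2 * κ * a := by
    calc _ ≤ κ * (2 * ε * b + 2 * a) := mul_le_mul_of_nonneg_left hdist hκ
      _ = 2 * (κ * ε) * b + 2 * κ * a := by ring
      _ ≤ 2 * (1 / 16) * b + 2 * κ * a := by gcongr
      _ = _ := by ring
  have h7 : c * N ≤ b / 8 := by
    have : 4 * c * N ≤ a * N := mul_le_mul_of_nonneg_right (by linarith) (by positivity)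
    linarith
  rw [← ha] at key
  nlinarith

/-- Finiteness of the solutions of the unit equation `x + y = 1`, for elements `x, y` that are
units up to a fixed denominator. -/
theorem finite_isAlmostUnit_one_sub (K : Type*) [Field K] [NumberField K] {D : ℤ} (hD : D ≠ 0) :
    {x : K | IsAlmostUnit D x ∧ IsAlmostUnit D (1 - x)}.Finite := by
  set s := {x : K | IsAlmostUnit D x ∧ IsAlmostUnit D (1 - x)} with hs
  set d : ℝ := (Fintype.card (K →+* ℂ) : ℝ) with hd
  have hlogD : 0 ≤ Real.log |(D : ℝ)| := Real.log_nonneg (by exact_mod_cast Int.one_le_abs hD)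
  have hlog2 : 0 ≤ Real.log 2 := Real.log_nonneg (by norm_num)
  have hlog8 : 0 ≤ Real.log 8192 := Real.log_nonneg (by norm_num)
  have hd0 : 0 ≤ d := Nat.cast_nonneg _
  obtain ⟨R, hR⟩ := exists_norm_le_of_gap (T := logPair '' s) (κ := 4 * d)
    (c := 2 * (d * (4 * Real.log |(D : ℝ)| + Real.log 8192)) +
      d * (2 * Real.log 2 + Real.log |(D : ℝ)|)) (by positivity) (by positivity) (by
    rintro _ ⟨x, hx, rfl⟩ _ ⟨x', hx', rfl⟩ N hN
    have h1 := archHeight_le hD hN hx.1 hx.2 hx'.1 hx'.2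
    have h2 := norm_logPair_le hD hx.1 hx.2
    have h3 : (∑ i, |(logPair x' - (2 * N : ℝ) • logPair x) i|) ≤
        2 * d * ‖logPair x' - (2 * N : ℝ) • logPair x‖ := by
      refine (Finset.sum_le_card_nsmul _ _ _ fun i _ =>
        norm_le_pi_norm (logPair x' - (2 * N : ℝ) • logPair x) i).trans_eq ?_
      rw [Finset.card_univ, Fintype.card_sum, nsmul_eq_mul, hd]
      push_cast; ring
    have h4 := mul_le_mul_of_nonneg_left h2 (Nat.cast_nonneg (α := ℝ) N)
    rw [← hd] at h1 h4
    linarith)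
  have hfin := NumberField.Embeddings.finite_of_norm_le K ℂ (|(D : ℝ)| * Real.exp R)
  have hDK : (D : K) ≠ 0 := by exact_mod_cast hD
  refine Set.Finite.of_finite_image (f := fun x : K => (D : K) * x)
    (hfin.subset ?_) (mul_right_injective₀ hDK).injOn
  rintro _ ⟨x, hx, rfl⟩
  refine ⟨hx.1.2.1, fun σ => ?_⟩
  rw [map_mul, norm_mul, map_intCast, Complex.norm_intCast]
  refine mul_le_mul_of_nonneg_left ?_ (abs_nonneg _)
  have h0 : 0 < ‖σ x‖ := norm_pos_iff.mpr ((map_ne_zero σ).mpr hx.1.1)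
  rw [← Real.exp_log h0]
  refine Real.exp_le_exp.mpr ((le_abs_self _).trans ?_)
  exact (norm_le_pi_norm (logPair x) (Sum.inl σ)).trans (hR _ ⟨x, hx, rfl⟩)

theorem isIntegral_of_pow_eq_sum {R : Type*} [CommRing R] {y : R} {m : ℕ} {c : ℕ → R}
    (hc : ∀ j < m, IsIntegral ℤ (c j)) (hy : y ^ m = ∑ j ∈ Finset.range m, c j * y ^ j) :
    IsIntegral ℤ y := by
  let O := integralClosure ℤ R
  have hy' : IsIntegral O y := by
    refine ⟨X ^ m + -∑ j : Fin m, C (⟨c j, hc j j.2⟩ : O) * X ^ (j : ℕ), monic_X_pow_add ?_, ?_⟩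
    · rw [degree_neg]
      exact degree_sum_fin_lt _
    · simp only [eval₂_add, eval₂_neg, eval₂_finsetSum, eval₂_mul, eval₂_C, eval₂_X_pow, hy]
      rw [Finset.sum_range, add_neg_eq_zero]
      rfl
  exact isIntegral_trans y hy'

theorem isIntegral_coeff_of_X_sub_C_mul {R : Type*} [CommRing R] {α : R} {F G : R[X]}
    (hF : F = (X - C α) * G) (hi : ∀ k, IsIntegral ℤ (F.coeff k)) (k : ℕ) :
    IsIntegral ℤ (G.coeff k) ∧ IsIntegral ℤ (α * G.coeff k) := by
  have h0 : F.coeff 0 = -(α * G.coeff 0) := by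
    rw [hF, sub_mul, coeff_sub, coeff_C_mul, mul_coeff_zero, coeff_X_zero]; ring
  have hs : ∀ k, F.coeff (k + 1) = G.coeff k - α * G.coeff (k + 1) := fun k => by
    rw [hF, sub_mul, coeff_sub, coeff_C_mul, coeff_X_mul]
  have hsum : ∀ k, ∑ j ∈ Finset.range (k + 1), F.coeff j * α ^ j = -(α ^ (k + 1) * G.coeff k) := by
    intro k
    induction k with
    | zero => simp [h0]
    | succ k ih => rw [Finset.sum_range_succ, ih, hs]; ring
  have hmul : ∀ k, IsIntegral ℤ (G.coeff k) → IsIntegral ℤ (α * G.coeff k) := by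
    intro k hk
    refine isIntegral_of_pow_eq_sum (m := k + 1)
      (c := fun j => -(F.coeff j * G.coeff k ^ (k - j)))
      (fun j _ => ((hi j).mul (hk.pow _)).neg) ?_
    have h1 : ∀ j ∈ Finset.range (k + 1),
        -(F.coeff j * G.coeff k ^ (k - j)) * (α * G.coeff k) ^ j =
          -(G.coeff k ^ k * (F.coeff j * α ^ j)) := fun j hj => by
      have : G.coeff k ^ k = G.coeff k ^ (k - j) * G.coeff k ^ j := by
        rw [← pow_add, Nat.sub_add_cancel (Nat.lt_succ_iff.mp (Finset.mem_range.mp hj))]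
      rw [this, mul_pow]
      ring
    rw [Finset.sum_congr rfl h1, Finset.sum_neg_distrib, ← Finset.mul_sum, hsum]
    ring
  have hall : ∀ j k, G.natDegree < k + j → IsIntegral ℤ (G.coeff k) := by
    intro j
    induction j with
    | zero =>
      intro k hk
      rw [coeff_eq_zero_of_natDegree_lt (by simpa using hk)]
      exact isIntegral_zero
    | succ j ih =>
      intro k hk
      have h1 := ih (k + 1) (by omega)
      rw [show G.coeff k = F.coeff (k + 1) + α * G.coeff (k + 1) by rw [hs]; ring]
      exact (hi _).add (hmul _ h1)
  have := hall (G.natDegree + 1) k (by omega)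
  exact ⟨this, hmul k this⟩

/-- If `a ∏ (X - z)`, the product being over `M`, has integral coefficients, then `a` times any
subproduct of the roots is integral. -/
theorem isIntegral_mul_prod_of_le {R : Type*} [CommRing R] {M : Multiset R} {a : R}
    (hi : ∀ k, IsIntegral ℤ ((C a * (M.map fun z => X - C z).prod).coeff k)) {c : Multiset R}
    (hc : c ≤ M) : IsIntegral ℤ (a * c.prod) := by
  classical
  induction M using Multiset.induction generalizing a c with
  | empty =>
    obtain rfl := Multiset.le_zero.mp hc
    simpa using hi 0
  | cons z M ih =>
    have h := isIntegral_coeff_of_X_sub_C_mul (α := z) (G := C a * (M.map fun z => X - C z).prod)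
      (by rw [Multiset.map_cons, Multiset.prod_cons]; ring) hi
    by_cases hz : z ∈ c
    · obtain ⟨c', rfl⟩ := Multiset.exists_cons_of_mem hz
      rw [Multiset.prod_cons, ← mul_assoc]
      refine ih (fun k => ?_) ((Multiset.cons_le_cons_iff z).mp hc)
      rw [show C (a * z) * (M.map fun z => X - C z).prod =
        C z * (C a * (M.map fun z => X - C z).prod) by rw [C_mul]; ring, coeff_C_mul]
      exact (h k).2
    · exact ih (fun k => (h k).1) ((Multiset.le_cons_of_notMem hz).mp hc)

/-- `κ` clears the denominators of all products of sub-multisets of `M`. -/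
def IsDenominator {R : Type*} [CommRing R] (κ : R) (M : Multiset R) : Prop :=
  ∀ c ≤ M, IsIntegral ℤ (κ * c.prod)

theorem IsDenominator.add {R : Type*} [CommRing R] {κ κ' : R} {M M' : Multiset R}
    (h : IsDenominator κ M) (h' : IsDenominator κ' M') : IsDenominator (κ * κ') (M + M') := by
  classical
  intro c hc
  have h1 : IsIntegral ℤ (κ * (c ∩ M).prod) := h _ Multiset.inter_le_right
  have h2 : IsIntegral ℤ (κ' * (c - M).prod) := h' _ (tsub_le_iff_left.mpr hc)
  have h3 : c.prod = (c - M).prod * (c ∩ M).prod := by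
    rw [← Multiset.prod_add, Multiset.sub_add_inter]
  rw [h3]
  convert h1.mul h2 using 1
  ring

theorem IsDenominator.nsmul {R : Type*} [CommRing R] {κ : R} {M : Multiset R}
    (h : IsDenominator κ M) (k : ℕ) : IsDenominator (κ ^ k) (k • M) := by
  induction k with
  | zero =>
    intro c hc
    rw [zero_smul] at hc
    obtain rfl := Multiset.le_zero.mp hc
    simpa using isIntegral_one
  | succ k ih => rw [pow_succ, succ_nsmul]; exact ih.add h

theorem IsDenominator.isIntegral_mul_prod_sub {R : Type*} [CommRing R] {κ : R} {M : Multiset R}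
    (h : IsDenominator κ M) {E : Multiset (R × R)} (hE : E.bind (fun e => {e.1, e.2}) ≤ M) :
    IsIntegral ℤ (κ * (E.map fun e => e.1 - e.2).prod) := by
  suffices H : ∀ c : Multiset R, c + E.bind (fun e => {e.1, e.2}) ≤ M →
      IsIntegral ℤ (κ * c.prod * (E.map fun e => e.1 - e.2).prod) by
    simpa using H 0 (by simpa using hE)
  clear hE
  induction E using Multiset.induction with
  | empty => intro c hc; simpa using h c (by simpa using hc)
  | cons e E ih =>
    intro c hc
    have h0 : ({e.1, e.2} : Multiset R) = {e.1} + {e.2} := rfl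
    have h1 := ih ({e.1} + c) (le_trans (by
      rw [Multiset.cons_bind, h0, show c + ({e.1} + {e.2} + E.bind fun e => {e.1, e.2}) =
        {e.1} + c + (E.bind fun e => {e.1, e.2}) + {e.2} by abel]
      exact Multiset.le_add_right _ _) hc)
    have h2 := ih ({e.2} + c) (le_trans (by
      rw [Multiset.cons_bind, h0, show c + ({e.1} + {e.2} + E.bind fun e => {e.1, e.2}) =
        {e.2} + c + (E.bind fun e => {e.1, e.2}) + {e.1} by abel]
      exact Multiset.le_add_right _ _) hc)
    convert h1.sub h2 using 1
    simp
    ring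

theorem offDiag_bind_endpoints {R : Type*} [DecidableEq R] (s : Finset R) :
    s.offDiag.val.bind (fun e => ({e.1, e.2} : Multiset R)) = (2 * (s.card - 1)) • s.val := by
  ext v
  have h0 : ∀ e : R × R, Multiset.count v ({e.1, e.2} : Multiset R) =
      (if v = e.1 then 1 else 0) + if v = e.2 then 1 else 0 := fun e => by
    rw [show ({e.1, e.2} : Multiset R) = {e.1} + {e.2} from rfl, Multiset.count_add,
      Multiset.count_singleton, Multiset.count_singleton]
  have h1 : ∑ e ∈ s.offDiag, (if v = e.1 then 1 else 0) = if v ∈ s then s.card - 1 else 0 := by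
    rw [Finset.sum_boole, Nat.cast_id]
    split_ifs with hv
    · rw [← Finset.card_erase_of_mem hv]
      refine Finset.card_bij (fun e _ => e.2) ?_ ?_ ?_
      · rintro ⟨x, y⟩ h
        simp only [Finset.mem_filter, Finset.mem_offDiag] at h
        exact Finset.mem_erase.mpr ⟨fun h' => h.1.2.2 (h.2.symm.trans h'.symm), h.1.2.1⟩
      · rintro ⟨x, y⟩ h ⟨x', y'⟩ h' hy
        simp only [Finset.mem_filter] at h h'
        exact Prod.ext (h.2.symm.trans h'.2) hy
      · intro y hy
        rw [Finset.mem_erase] at hy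
        exact ⟨(v, y), by simp [hv, hy.2, hy.1.symm], rfl⟩
    · rw [Finset.card_eq_zero, Finset.filter_eq_empty_iff]
      rintro e he rfl
      exact hv (Finset.mem_offDiag.mp he).1
  have h2 : ∑ e ∈ s.offDiag, (if v = e.2 then 1 else 0) =
      ∑ e ∈ s.offDiag, (if v = e.1 then 1 else 0) :=
    Finset.sum_nbij' Prod.swap Prod.swap (by simp +contextual [eq_comm])
      (by simp +contextual [eq_comm]) (by simp) (by simp) (by simp)
  rw [Multiset.count_bind, Multiset.count_nsmul]
  simp only [h0]
  have h3 : Multiset.count v s.val = if v ∈ s then 1 else 0 := Multiset.count_eq_of_nodup s.nodup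
  rw [h3]
  change ∑ e ∈ s.offDiag, _ = _
  rw [Finset.sum_add_distrib, h2, h1]
  split_ifs <;> ring

/-- `s` is the set of complex roots of `f`, and all roots are simple. -/
def HasSimpleRoots (f : ℤ[X]) (s : Finset ℂ) : Prop :=
  f.map (Int.castRingHom ℂ) = C (f.leadingCoeff : ℂ) * ∏ z ∈ s, (X - C z)

/-- The product of all differences of distinct elements of `s`. -/
noncomputable def diffProd (s : Finset ℂ) : ℂ := ∏ e ∈ s.offDiag, (e.1 - e.2)

theorem HasSimpleRoots.isDenominator {f : ℤ[X]} {s : Finset ℂ} (h : HasSimpleRoots f s) :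
    IsDenominator (f.leadingCoeff : ℂ) s.val := fun c hc => by
  refine isIntegral_mul_prod_of_le (M := s.val) (fun k => ?_) hc
  have : (C (f.leadingCoeff : ℂ) * (s.val.map fun z => X - C z).prod) =
    f.map (Int.castRingHom ℂ) := h.symm
  rw [this, coeff_map]
  exact isIntegral_algebraMap (R := ℤ) (x := f.coeff k)

theorem prod_sq_sub_eq_diffProd {m : ℕ} {x : Fin m → ℂ} (hx : Function.Injective x) :
    ∃ ε : ℤ, (ε = 1 ∨ ε = -1) ∧ ∏ i, ∏ j ∈ Finset.Ioi i, (x j - x i) ^ 2 =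
      ε * diffProd (Finset.univ.image x) := by
  refine ⟨∏ i : Fin m, ∏ j ∈ Finset.Ioi i, -1, ?_, ?_⟩
  · simp only [Finset.prod_const, Finset.prod_pow_eq_pow_sum]
    exact neg_one_pow_eq_or ℤ _
  · have h1 : ∏ i, ∏ j ∈ Finset.Ioi i, (x j - x i) ^ 2 =
        ((∏ i : Fin m, ∏ j ∈ Finset.Ioi i, -1 : ℤ) : ℂ) *
        ∏ i, ∏ j ∈ Finset.Ioi i, (x j - x i) * (x i - x j) := by
      push_cast
      simp only [← Finset.prod_mul_distrib]
      exact Finset.prod_congr rfl fun i _ => Finset.prod_congr rfl fun j _ => by ring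
    rw [h1, Finset.prod_prod_Ioi_mul_eq_prod_prod_off_diag (fun j i => x j - x i), diffProd]
    congr 1
    have h2 : ∏ e ∈ (Finset.univ : Finset (Fin m)).offDiag, (x e.2 - x e.1) =
        ∏ i, ∏ j ∈ {i}ᶜ, (x j - x i) :=
      Finset.prod_finset_product' Finset.univ.offDiag Finset.univ (fun i => {i}ᶜ)
        (by simp [eq_comm]) (f := fun i j => x j - x i)
    rw [← h2]
    refine Finset.prod_bij (fun e _ => (x e.2, x e.1)) ?_ ?_ ?_ ?_
    · rintro ⟨i, j⟩ h
      have h' := (Finset.mem_offDiag.mp h).2.2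
      simpa using fun h'' => h' (hx h''.symm)
    · rintro ⟨i, j⟩ - ⟨i', j'⟩ - h
      rw [Prod.mk.injEq] at h
      exact Prod.ext (hx h.2) (hx h.1)
    · rintro ⟨z, w⟩ h
      simp only [Finset.mem_offDiag, Finset.mem_image, Finset.mem_univ, true_and] at h
      obtain ⟨⟨i, rfl⟩, ⟨j, rfl⟩, hne⟩ := h
      exact ⟨(j, i), by simpa using fun h => hne (by rw [h]), rfl⟩
    · simp

theorem hasSimpleRoots_of_card {g : ℤ[X]} {S : Finset ℂ} (hg : g ≠ 0) (hc : S.card = g.natDegree)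
    (hS : ∀ z ∈ S, aeval z g = 0) : HasSimpleRoots g S := by
  have hinj : Function.Injective (Int.castRingHom ℂ) := Int.cast_injective
  have hg0 : g.map (Int.castRingHom ℂ) ≠ 0 := (Polynomial.map_ne_zero_iff hinj).mpr hg
  have hd : (g.map (Int.castRingHom ℂ)).natDegree = g.natDegree := natDegree_map_eq_of_injective hinj g
  have hle : S.val ≤ (g.map (Int.castRingHom ℂ)).roots :=
    (Multiset.le_iff_subset S.nodup).mpr fun z hz =>
      (mem_roots hg0).mpr (by rw [IsRoot.def, eval_map]; exact hS z hz)
  have hroots : S.val = (g.map (Int.castRingHom ℂ)).roots :=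
    Multiset.eq_of_le_of_card_le hle ((card_roots' _).trans (by rw [hd, ← hc]; rfl))
  have h := C_leadingCoeff_mul_prod_multiset_X_sub_C (p := g.map (Int.castRingHom ℂ))
    (by rw [← hroots, hd]; exact hc)
  rw [← hroots, leadingCoeff_map_of_injective hinj] at h
  exact h.symm

theorem HasSimpleRoots.mem_iff {f : ℤ[X]} {s : Finset ℂ} (h : HasSimpleRoots f s) (hf : f ≠ 0)
    {z : ℂ} : z ∈ s ↔ aeval z f = 0 := by
  have h1 : aeval z f = eval z (f.map (Int.castRingHom ℂ)) := by rw [eval_map]; rfl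
  rw [h1, h, eval_mul, eval_C, eval_prod]
  simp [hf, Finset.prod_eq_zero_iff, sub_eq_zero]

theorem HasSimpleRoots.card_eq {f : ℤ[X]} {s : Finset ℂ} (h : HasSimpleRoots f s) (hf : f ≠ 0) :
    s.card = f.natDegree := by
  have h1 := congrArg natDegree h
  rw [natDegree_map_eq_of_injective Int.cast_injective,
    natDegree_C_mul (by simpa using hf), natDegree_prod_of_monic _ _ fun z _ => monic_X_sub_C z] at h1
  simpa using h1.symm

theorem exists_hasSimpleRoots {f : ℤ[X]} {D : ℤ} (hD : D ≠ 0) (hf : discC f = D) (h0 : f ≠ 0) :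
    ∃ s, HasSimpleRoots f s ∧ ∃ ε : ℤ, (ε = 1 ∨ ε = -1) ∧
      (D : ℂ) = ε * ((f.leadingCoeff : ℂ) ^ (2 * (f.natDegree - 1)) * diffProd s) := by
  have hsplit : (rootList f).length = f.natDegree := by
    rw [rootList, Multiset.length_toList, ← (IsAlgClosed.splits _).natDegree_eq_card_roots,
      natDegree_map_eq_of_injective Int.cast_injective]
  set x : Fin (rootList f).length → ℂ := (rootList f).get with hx
  have hprod : (∏ p : Fin (rootList f).length × Fin (rootList f).length,
      if (p.1 : ℕ) < (p.2 : ℕ) then (x p.1 - x p.2) ^ 2 else 1) =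
      ∏ i, ∏ j ∈ Finset.Ioi i, (x j - x i) ^ 2 := by
    rw [Fintype.prod_prod_type]
    refine Finset.prod_congr rfl fun i _ => ?_
    simp only [Fin.val_fin_lt]
    rw [Finset.prod_ite, Finset.prod_const_one, mul_one]
    refine Finset.prod_congr (by ext; simp) fun j _ => by ring
  rw [discC, hprod] at hf
  have hne : ∏ i, ∏ j ∈ Finset.Ioi i, (x j - x i) ^ 2 ≠ 0 := by
    intro h
    rw [h, mul_zero] at hf
    exact hD (by exact_mod_cast hf.symm)
  have hlt : ∀ i j, i < j → x i ≠ x j := fun i j hij h => by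
    refine hne (Finset.prod_eq_zero (Finset.mem_univ i)
      (Finset.prod_eq_zero (Finset.mem_Ioi.mpr hij) ?_))
    rw [h]; ring
  have hinj : Function.Injective x := fun i j h => by
    rcases lt_trichotomy i j with hij | hij | hij
    · exact absurd h (hlt i j hij)
    · exact hij
    · exact absurd h.symm (hlt j i hij)
  obtain ⟨ε, hε, he⟩ := prod_sq_sub_eq_diffProd hinj
  refine ⟨Finset.univ.image x, hasSimpleRoots_of_card h0 ?_ ?_, ε, hε, ?_⟩
  · rw [Finset.card_image_of_injective _ hinj, Finset.card_fin, hsplit]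
  · intro z hz
    obtain ⟨i, -, rfl⟩ := Finset.mem_image.mp hz
    have h1 : x i ∈ (f.map (Int.castRingHom ℂ)).roots := Multiset.mem_toList.mp (List.get_mem _ i)
    have h2 := (mem_roots'.mp h1).2
    rw [IsRoot.def, eval_map] at h2
    exact h2
  · rw [← hf, he, Nat.mul_sub]
    ring

theorem NumberField.abs_discr_le_of_isIntegral {K : Type*} [Field K] [NumberField K] {m : ℕ}
    (hm : m = Module.finrank ℚ K) {v : Fin m → K} (hv : ∀ i, IsIntegral ℤ (v i))
    (h0 : Algebra.discr ℚ v ≠ 0) : |(NumberField.discr K : ℚ)| ≤ |Algebra.discr ℚ v| := by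
  classical
  have hcard : Fintype.card (Module.Free.ChooseBasisIndex ℤ (NumberField.RingOfIntegers K)) =
      Fintype.card (Fin m) := by
    rw [Fintype.card_fin, hm, Module.finrank_eq_card_basis (NumberField.integralBasis K)]
  let b := (NumberField.integralBasis K).reindex (Fintype.equivOfCardEq hcard)
  have hb : Algebra.discr ℚ b = NumberField.discr K := by
    rw [NumberField.coe_discr, Module.Basis.coe_reindex, Algebra.discr_reindex]
  have hint : ∀ i j, ∃ z : ℤ, (z : ℚ) = b.toMatrix v i j := fun i j => by
    refine ⟨(NumberField.RingOfIntegers.basis K).repr ⟨v j, hv j⟩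
      ((Fintype.equivOfCardEq hcard).symm i), ?_⟩
    have := NumberField.integralBasis_repr_apply K ⟨v j, hv j⟩
      ((Fintype.equivOfCardEq hcard).symm i)
    rw [Module.Basis.toMatrix_apply, Module.Basis.repr_reindex_apply]
    exact this.symm
  choose P hP using hint
  have hP' : b.toMatrix v = (Matrix.of P).map (Int.castRingHom ℚ) := by
    ext i j; exact (hP i j).symm
  have hdisc : Algebra.discr ℚ v = (((Matrix.of P).det : ℤ) : ℚ) ^ 2 * NumberField.discr K := by
    rw [← hb, ← Module.Basis.toMatrix_map_vecMul b v, Algebra.discr_of_matrix_vecMul, hP']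
    congr 2
    exact (RingHom.map_det (Int.castRingHom ℚ) (Matrix.of P)).symm
  rw [hdisc] at h0 ⊢
  have h1 : (Matrix.of P).det ≠ 0 := by
    intro h; simp [h] at h0
  rw [abs_mul, abs_pow]
  refine le_mul_of_one_le_left (abs_nonneg _) (one_le_pow₀ ?_)
  exact_mod_cast Int.one_le_abs h1

/-- `f` has simple roots, with set of roots `s`, and discriminant `±D`. -/
structure HasRootsAndDisc (f : ℤ[X]) (s : Finset ℂ) (D : ℤ) : Prop where
  ne_zero : f ≠ 0
  roots : HasSimpleRoots f s
  disc : ∃ ε : ℤ, (ε = 1 ∨ ε = -1) ∧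
    (D : ℂ) = ε * ((f.leadingCoeff : ℂ) ^ (2 * (f.natDegree - 1)) * diffProd s)

/-- The cross-ratio of four complex numbers. -/
noncomputable def crossRatio (i j k l : ℂ) : ℂ := (i - j) * (k - l) / ((i - k) * (j - l))

theorem HasRootsAndDisc.isIntegral_mul_crossRatio {f : ℤ[X]} {s : Finset ℂ} {D : ℤ}
    (h : HasRootsAndDisc f s D) {i j k l : ℂ} (hi : i ∈ s) (hj : j ∈ s) (hk : k ∈ s) (hl : l ∈ s)
    (hij : i ≠ j) (hik : i ≠ k) (hjl : j ≠ l) :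
    IsIntegral ℤ ((D : ℂ) * crossRatio i j k l) := by
  have hden := h.roots.isDenominator.nsmul (2 * (f.natDegree - 1))
  set E := (s.offDiag.erase (i, k)).erase (j, l) with hE
  have hjl' : (j, l) ∈ s.offDiag.erase (i, k) := by
    simp [hj, hl, hjl, hij.symm]
  have hik' : (i, k) ∈ s.offDiag := by simp [hi, hk, hik]
  have hoff : s.offDiag.val = (i, k) ::ₘ (j, l) ::ₘ E.val := by
    rw [hE, Finset.erase_val, Multiset.cons_erase (by exact hjl'), Finset.erase_val,
      Multiset.cons_erase (by exact hik')]
  have hends := offDiag_bind_endpoints s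
  rw [h.roots.card_eq h.ne_zero] at hends
  have hint := hden.isIntegral_mul_prod_sub (E := (i, j) ::ₘ (k, l) ::ₘ E.val) (by
    rw [← hends, hoff]
    refine le_of_eq ?_
    simp only [Multiset.cons_bind, ← add_assoc]
    congr 1
    ext v
    simp only [Multiset.count_add, Multiset.insert_eq_cons, Multiset.count_cons,
      Multiset.count_singleton]
    ring)
  obtain ⟨ε, hε, hD⟩ := h.disc
  have hε' : IsIntegral ℤ (ε : ℂ) := isIntegral_algebraMap (R := ℤ) (x := ε)
  have hdp : diffProd s = (i - k) * ((j - l) * (E.val.map fun e => e.1 - e.2).prod) := by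
    rw [diffProd, Finset.prod, hoff]
    simp
  have h1 := sub_ne_zero.mpr hik
  have h2 := sub_ne_zero.mpr hjl
  have key : (D : ℂ) * crossRatio i j k l =
      ε * ((f.leadingCoeff : ℂ) ^ (2 * (f.natDegree - 1)) *
        (((i, j) ::ₘ (k, l) ::ₘ E.val).map fun e => e.1 - e.2).prod) := by
    rw [hD, hdp, crossRatio]
    simp only [Multiset.map_cons, Multiset.prod_cons]
    field_simp
  rw [key]
  exact hε'.mul hint

theorem IsAlmostUnit.of_crossRatio {f : ℤ[X]} {s : Finset ℂ} {D : ℤ}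
    (h : HasRootsAndDisc f s D) {i j k l : ℂ} (hi : i ∈ s) (hj : j ∈ s) (hk : k ∈ s) (hl : l ∈ s)
    (hij : i ≠ j) (hik : i ≠ k) (hjl : j ≠ l) (hkl : k ≠ l) :
    IsAlmostUnit D (crossRatio i j k l) := by
  have h1 := sub_ne_zero.mpr hij
  have h2 := sub_ne_zero.mpr hik
  have h3 := sub_ne_zero.mpr hjl
  have h4 := sub_ne_zero.mpr hkl
  refine ⟨by rw [crossRatio]; positivity, h.isIntegral_mul_crossRatio hi hj hk hl hij hik hjl, ?_⟩
  have : (crossRatio i j k l)⁻¹ = crossRatio i k j l := by rw [crossRatio, crossRatio, inv_div]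
  rw [this]
  exact h.isIntegral_mul_crossRatio hi hk hj hl hik hij hkl

theorem one_sub_crossRatio {i j k l : ℂ} (hik : i ≠ k) (hjl : j ≠ l) :
    1 - crossRatio i j k l = crossRatio i l k j := by
  have h1 := sub_ne_zero.mpr hik
  have h2 := sub_ne_zero.mpr hjl
  have h3 := sub_ne_zero.mpr hjl.symm
  rw [crossRatio, crossRatio]
  field_simp
  ring

theorem exists_irreducible_factor {f : ℤ[X]} (hf : f ≠ 0) {α : ℂ} (h : aeval α f = 0) :
    ∃ g h : ℤ[X], f = g * h ∧ Irreducible g ∧ aeval α g = 0 := by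
  induction f using WfDvdMonoid.induction_on_irreducible with
  | zero => exact absurd rfl hf
  | unit u hu =>
    have := (hu.map (aeval α : ℤ[X] →ₐ[ℤ] ℂ)).ne_zero
    exact absurd h this
  | mul a i ha hi ih =>
    rw [map_mul, mul_eq_zero] at h
    rcases h with h | h
    · exact ⟨i, a, rfl, hi, h⟩
    · obtain ⟨g, b, rfl, hg, hz⟩ := ih ha h
      exact ⟨g, i * b, by ring, hg, hz⟩

theorem minpoly_eq_of_irreducible_int {g : ℤ[X]} (hg : Irreducible g) {α : ℂ}
    (h : aeval α g = 0) :
    g.natDegree ≠ 0 ∧ (minpoly ℚ α).natDegree = g.natDegree ∧ IsIntegral ℚ α := by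
  have hd : g.natDegree ≠ 0 := fun h0 => by
    rw [eq_C_of_natDegree_eq_zero h0, aeval_C] at h
    have : g.coeff 0 = 0 := by simpa using h
    rw [eq_C_of_natDegree_eq_zero h0, this, C_0] at hg
    exact not_irreducible_zero hg
  have hirr : Irreducible (g.map (Int.castRingHom ℚ)) :=
    (IsPrimitive.Int.irreducible_iff_irreducible_map_cast (hg.isPrimitive hd)).mp hg
  have hz : aeval α (g.map (Int.castRingHom ℚ)) = 0 := by
    have := aeval_map_algebraMap ℚ α g
    rw [← h, ← this]; rfl
  have hm := minpoly.eq_of_irreducible hirr hz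
  refine ⟨hd, ?_, IsAlgebraic.isIntegral ⟨_, hirr.ne_zero, hz⟩⟩
  rw [← hm, natDegree_mul_C (by simpa using hirr.ne_zero),
    natDegree_map_eq_of_injective Int.cast_injective]

theorem exists_integral_family_discr {K : Type*} [Field K] [NumberField K] (pb : PowerBasis ℚ K)
    {g : ℤ[X]} (h : aeval pb.gen g = 0) (hd : pb.dim = g.natDegree) (h0 : g.natDegree ≠ 0) :
    ∃ v : Fin pb.dim → K, (∀ i, IsIntegral ℤ (v i)) ∧
      Algebra.discr ℚ v = (g.leadingCoeff : ℚ) ^ (2 * (g.natDegree - 1)) *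
        Algebra.discr ℚ pb.basis := by
  let P : Matrix (Fin pb.dim) (Fin pb.dim) ℚ := Matrix.of fun j i =>
    if (j : ℕ) = 0 then (if (i : ℕ) = 0 then 1 else 0)
    else if i ≤ j then (g.coeff (pb.dim - j + i) : ℚ) else 0
  refine ⟨Matrix.mulVec (P.map (algebraMap ℚ K)) pb.basis, fun j => ?_, ?_⟩
  · have hv : Matrix.mulVec (P.map (algebraMap ℚ K)) pb.basis j =
        ∑ i, (P j i : K) * pb.gen ^ (i : ℕ) := by
      simp [Matrix.mulVec, dotProduct]
    rw [hv]
    by_cases hj : (j : ℕ) = 0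
    · have : ∑ i, (P j i : K) * pb.gen ^ (i : ℕ) = 1 := by
        rw [Finset.sum_eq_single j]
        · simp [P, hj]
        · intro i _ hi
          have : (i : ℕ) ≠ 0 := fun h => hi (Fin.ext (by omega))
          simp [P, hj, this]
        · simp
      rw [this]
      exact isIntegral_one
    · set F := g.map (Int.castRingHom K) with hF
      have hroot : F.IsRoot pb.gen := by rw [IsRoot.def, hF, eval_map]; exact h
      have hFG := (mul_divByMonic_eq_iff_isRoot.mpr hroot).symm
      have hnd : F.natDegree = pb.dim := by
        rw [hF, natDegree_map_eq_of_injective Int.cast_injective, hd]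
      have hcoef := coeff_divByMonic_X_sub_C F pb.gen (pb.dim - 1 - j)
      have hi := (isIntegral_coeff_of_X_sub_C_mul hFG (fun k => by
        rw [hF, coeff_map]; exact isIntegral_algebraMap (R := ℤ) (x := g.coeff k))
        (pb.dim - 1 - j)).1
      rw [hcoef, hnd] at hi
      suffices key : ∑ i, (P j i : K) * pb.gen ^ (i : ℕ) =
          ∑ i ∈ Finset.Icc (pb.dim - 1 - j + 1) pb.dim,
            pb.gen ^ (i - (pb.dim - 1 - j + 1)) * F.coeff i by rw [key]; exact hi
      have hjlt := j.2
      rw [show pb.dim - 1 - (j : ℕ) + 1 = pb.dim - j by omega]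
      have h1 : ∑ i, (P j i : K) * pb.gen ^ (i : ℕ) =
          ∑ i : Fin pb.dim, if i ≤ j then (g.coeff (pb.dim - j + i) : K) * pb.gen ^ (i : ℕ)
            else 0 := by
        refine Finset.sum_congr rfl fun i _ => ?_
        simp only [P, Matrix.of_apply, hj, if_false]
        split_ifs <;> simp
      rw [h1, ← Finset.sum_filter]
      refine Finset.sum_nbij' (fun i : Fin pb.dim => pb.dim - j + i)
        (fun i => if hlt : i - (pb.dim - j) < pb.dim then ⟨i - (pb.dim - j), hlt⟩ else j) ?_ ?_ ?_ ?_ ?_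
      · intro i hi
        simp only [Finset.mem_filter, Finset.mem_univ, true_and, Fin.le_def] at hi
        rw [Finset.mem_Icc]
        omega
      · intro i hi
        rw [Finset.mem_Icc] at hi
        simp only [Finset.mem_filter, Finset.mem_univ, true_and]
        split_ifs
        · rw [Fin.le_def]; change i - (pb.dim - j) ≤ j; omega
        · exact le_rfl
      · intro i hi
        simp
      · intro i hi
        rw [Finset.mem_Icc] at hi
        rw [dif_pos (by omega)]
        change pb.dim - j + (i - (pb.dim - j)) = i
        omega
      · intro i hi
        rw [hF, coeff_map, Nat.add_sub_cancel_left]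
        simp [mul_comm]
  · rw [Algebra.discr_of_matrix_mulVec]
    congr 1
    have htri : P.IsLowerTriangular := by
      intro i j hij
      have hij' : i < j := hij
      have h1 : (j : ℕ) ≠ 0 := by
        have := Fin.lt_def.mp hij'; omega
      simp [P, h1, hij'.not_ge]
    have hdiag : ∀ i : Fin pb.dim, P i i = if (i : ℕ) = 0 then 1 else (g.leadingCoeff : ℚ) := by
      intro i
      have hi := i.2
      simp only [P, Matrix.of_apply, le_refl, if_true]
      split_ifs
      · rfl
      · rw [show pb.dim - (i : ℕ) + i = g.natDegree by omega]; rfl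
    have hcard : ({i : Fin pb.dim | ¬(i : ℕ) = 0} : Finset (Fin pb.dim)).card = g.natDegree - 1 := by
      have : ({i : Fin pb.dim | ¬(i : ℕ) = 0} : Finset (Fin pb.dim)) =
          Finset.univ.erase ⟨0, by omega⟩ := by
        ext i; simp [Fin.ext_iff]
      rw [this, Finset.card_erase_of_mem (Finset.mem_univ _), Finset.card_fin, hd]
    rw [Matrix.det_of_isLowerTriangular _ htri, Finset.prod_congr rfl fun i _ => hdiag i,
      Finset.prod_ite, Finset.prod_const_one, one_mul, Finset.prod_const, hcard, ← pow_mul, mul_comm]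

theorem HasSimpleRoots.right_of_mul {g h : ℤ[X]} {s S : Finset ℂ} (hs : HasSimpleRoots (g * h) s)
    (hS : HasSimpleRoots g S) (hg : g ≠ 0) (hsub : S ⊆ s) : HasSimpleRoots h (s \ S) := by
  have hg' : g.map (Int.castRingHom ℂ) ≠ 0 :=
    (Polynomial.map_ne_zero_iff Int.cast_injective).mpr hg
  refine mul_left_cancel₀ hg' ?_
  rw [← Polynomial.map_mul, hs, hS, leadingCoeff_mul, ← Finset.prod_sdiff hsub]
  push_cast
  rw [C_mul]
  ring

theorem HasRootsAndDisc.exists_mul_diffProd {g h : ℤ[X]} {s S : Finset ℂ} {D : ℤ}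
    (hs : HasRootsAndDisc (g * h) s D) (hS : HasSimpleRoots g S) (hd : g.natDegree ≠ 0) :
    ∃ w : ℂ, IsIntegral ℤ w ∧
      (D : ℂ) = w * ((g.leadingCoeff : ℂ) ^ (2 * (g.natDegree - 1)) * diffProd S) := by
  have hg : g ≠ 0 := left_ne_zero_of_mul hs.ne_zero
  have hh : h ≠ 0 := right_ne_zero_of_mul hs.ne_zero
  have hsub : S ⊆ s := fun z hz => by
    rw [hs.roots.mem_iff hs.ne_zero, map_mul, (hS.mem_iff hg).mp hz, zero_mul]
  have hT := hs.roots.right_of_mul hS hg hsub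
  have hdeg : (g * h).natDegree = g.natDegree + h.natDegree := natDegree_mul hg hh
  have hden := (hS.isDenominator.nsmul (2 * h.natDegree)).add
    (hT.isDenominator.nsmul (2 * ((g * h).natDegree - 1)))
  have hoff : S.offDiag ⊆ s.offDiag := Finset.offDiag_mono hsub
  have hval : s.val = S.val + (s \ S).val := by
    rw [Finset.sdiff_val, add_comm, Multiset.sub_add_cancel (Finset.val_le_iff.mpr hsub)]
  have hval' : s.offDiag.val = S.offDiag.val + (s.offDiag \ S.offDiag).val := by
    rw [Finset.sdiff_val, add_comm, Multiset.sub_add_cancel (Finset.val_le_iff.mpr hoff)]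
  have hends := offDiag_bind_endpoints s
  rw [hval', Multiset.add_bind, offDiag_bind_endpoints S, hval, hS.card_eq hg,
    hs.roots.card_eq hs.ne_zero, smul_add,
    show 2 * ((g * h).natDegree - 1) = 2 * (g.natDegree - 1) + 2 * h.natDegree by omega,
    add_smul _ _ S.val, add_assoc, add_left_cancel_iff] at hends
  have hint := hden.isIntegral_mul_prod_sub (E := (s.offDiag \ S.offDiag).val)
    (by rw [hends, hdeg]; exact le_of_eq (by congr 2; omega))
  obtain ⟨ε, -, hD⟩ := hs.disc
  have hε' : IsIntegral ℤ (ε : ℂ) := isIntegral_algebraMap (R := ℤ) (x := ε)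
  refine ⟨_, hε'.mul hint, ?_⟩
  have hdp : diffProd s = ((s.offDiag \ S.offDiag).val.map fun e => e.1 - e.2).prod *
      diffProd S := (Finset.prod_sdiff hoff).symm
  rw [hD, hdp, leadingCoeff_mul]
  push_cast
  rw [mul_pow, show 2 * ((g * h).natDegree - 1) = 2 * (g.natDegree - 1) + 2 * h.natDegree by omega,
    pow_add (g.leadingCoeff : ℂ)]
  ring

theorem HasRootsAndDisc.abs_discr_le {K : Type*} [Field K] [NumberField K] {g h : ℤ[X]}
    {s : Finset ℂ} {D : ℤ} (hD : D ≠ 0) (hf : HasRootsAndDisc (g * h) s D) (pb : PowerBasis ℚ K)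
    (hgen : aeval pb.gen g = 0) (hdim : pb.dim = g.natDegree) (hd : g.natDegree ≠ 0) :
    |NumberField.discr K| ≤ |D| := by
  have hg : g ≠ 0 := left_ne_zero_of_mul hf.ne_zero
  obtain ⟨v, hv, hdisc⟩ := exists_integral_family_discr pb hgen hdim hd
  have hcard : Fintype.card (K →ₐ[ℚ] ℂ) = Fintype.card (Fin pb.dim) := by
    rw [AlgHom.card, pb.finrank, Fintype.card_fin]
  let e : Fin pb.dim ≃ (K →ₐ[ℚ] ℂ) := (Fintype.equivOfCardEq hcard).symm
  have hinj : Function.Injective fun i => e i pb.gen := fun i j hij =>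
    e.injective (pb.algHom_ext hij)
  obtain ⟨ε, hε, hsq⟩ := prod_sq_sub_eq_diffProd hinj
  set S := Finset.univ.image fun i => e i pb.gen with hSdef
  have hpb := Algebra.discr_powerBasis_eq_prod ℚ ℂ pb e
  replace hpb := hpb.trans hsq
  have hS : HasSimpleRoots g S := by
    refine hasSimpleRoots_of_card hg ?_ ?_
    · rw [hSdef, Finset.card_image_of_injective _ hinj, Finset.card_fin, hdim]
    · intro z hz
      obtain ⟨i, -, rfl⟩ := Finset.mem_image.mp hz
      have := aeval_algHom_apply ((e i).restrictScalars ℤ) pb.gen g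
      rw [hgen, map_zero] at this
      exact this
  obtain ⟨w, hw, hDw⟩ := hf.exists_mul_diffProd hS hd
  have hDv : (D : ℂ) = ((ε : ℂ) * w) * (Algebra.discr ℚ v : ℚ) := by
    rw [hdisc, hDw]
    push_cast
    rw [eq_ratCast] at hpb
    rw [hpb]
    rcases hε with rfl | rfl <;> push_cast <;> ring
  have hDC : (D : ℂ) ≠ 0 := by exact_mod_cast hD
  have hv0 : Algebra.discr ℚ v ≠ 0 := fun h0 => by
    rw [h0, Rat.cast_zero, mul_zero] at hDv; exact hDC hDv
  have hεi : IsIntegral ℤ (ε : ℂ) := isIntegral_algebraMap (R := ℤ) (x := ε)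
  have hq : (ε : ℂ) * w = ((D / Algebra.discr ℚ v : ℚ) : ℂ) := by
    have : ((Algebra.discr ℚ v : ℚ) : ℂ) ≠ 0 := by exact_mod_cast hv0
    push_cast
    rw [hDv]
    field_simp
  have hqi : IsIntegral ℤ (D / Algebra.discr ℚ v : ℚ) := by
    have h1 := hεi.mul hw
    rw [hq, ← eq_ratCast (algebraMap ℚ ℂ)] at h1
    exact (isIntegral_algebraMap_iff (algebraMap ℚ ℂ).injective).mp h1
  obtain ⟨z, hz'⟩ := IsIntegrallyClosed.isIntegral_iff.mp hqi
  have hle := NumberField.abs_discr_le_of_isIntegral pb.finrank.symm hv hv0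
  have hz'' : (z : ℚ) * Algebra.discr ℚ v = D := by
    rw [show (z : ℚ) = _ from hz']
    field_simp
  have hz0 : z ≠ 0 := by
    rintro rfl
    rw [Int.cast_zero, zero_mul] at hz''
    exact hD (by exact_mod_cast hz''.symm)
  have hfinal : |(NumberField.discr K : ℚ)| ≤ |(D : ℚ)| := by
    refine hle.trans ?_
    rw [← hz'', abs_mul]
    exact le_mul_of_one_le_left (abs_nonneg _) (by exact_mod_cast Int.one_le_abs hz0)
  exact_mod_cast hfinal

open IntermediateField in
theorem HasRootsAndDisc.abs_discr_adjoin_le {f : ℤ[X]} {s : Finset ℂ} {D : ℤ} (hD : D ≠ 0)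
    (hf : HasRootsAndDisc f s D) {α : ℂ} (hα : α ∈ s) :
    ∃ h : FiniteDimensional ℚ ℚ⟮α⟯,
      haveI : NumberField ℚ⟮α⟯ := @NumberField.mk _ _ inferInstance h
      |NumberField.discr ℚ⟮α⟯| ≤ |D| := by
  obtain ⟨g, h, rfl, hg, hz⟩ :=
    exists_irreducible_factor hf.ne_zero ((hf.roots.mem_iff hf.ne_zero).mp hα)
  obtain ⟨hd, hmin, hint⟩ := minpoly_eq_of_irreducible_int hg hz
  have hfin : FiniteDimensional ℚ ℚ⟮α⟯ := adjoin.finiteDimensional hint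
  refine ⟨hfin, ?_⟩
  have : NumberField ℚ⟮α⟯ := @NumberField.mk _ _ inferInstance hfin
  let pb := adjoin.powerBasis hint
  have hdim : pb.dim = g.natDegree := (adjoin.powerBasis_dim hint).trans hmin
  have hgen : aeval pb.gen g = 0 := by
    have h1 : algebraMap ℚ⟮α⟯ ℂ (aeval pb.gen g) = 0 := by
      rw [← aeval_algebraMap_apply, adjoin.powerBasis_gen, AdjoinSimple.algebraMap_gen]
      exact hz
    exact (map_eq_zero _).mp h1
  exact hf.abs_discr_le hD pb hgen hdim hd

/-- The number fields in `ℂ` of absolute discriminant at most `N`. -/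
def fieldsOfDiscLE (N : ℕ) : Set { F : IntermediateField ℚ ℂ // FiniteDimensional ℚ F } :=
  {K | haveI : NumberField K := @NumberField.mk _ _ inferInstance K.prop
    |NumberField.discr K| ≤ N}

/-- The roots of all integer polynomials with simple roots and a given nonzero discriminant lie
in one number field. -/
theorem exists_numberField_mem_of_disc {D : ℤ} (hD : D ≠ 0) :
    ∃ L : IntermediateField ℚ ℂ, FiniteDimensional ℚ L ∧
      ∀ f s, HasRootsAndDisc f s D → ∀ α ∈ s, α ∈ L := by
  have hfin : (fieldsOfDiscLE D.natAbs).Finite := NumberField.finite_of_discr_bdd ℂ D.natAbs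
  have := hfin.to_subtype
  refine ⟨⨆ K : fieldsOfDiscLE D.natAbs, K.1.1, ?_, fun f s hf α hα => ?_⟩
  · have : ∀ K : fieldsOfDiscLE D.natAbs, FiniteDimensional ℚ K.1.1 := fun K => K.1.2
    exact IntermediateField.finiteDimensional_iSup_of_finite
  · obtain ⟨h1, h2⟩ := hf.abs_discr_adjoin_le hD hα
    rw [Int.abs_eq_natAbs D] at h2
    exact le_iSup (fun K : fieldsOfDiscLE D.natAbs => K.1.1) ⟨⟨_, h1⟩, h2⟩
      (IntermediateField.mem_adjoin_simple_self ℚ α)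

/-- All cross-ratios of roots of integer polynomials of given discriminant are bounded. -/
theorem exists_norm_crossRatio_le {D : ℤ} (hD : D ≠ 0) :
    ∃ B : ℝ, ∀ f s, HasRootsAndDisc f s D → ∀ i ∈ s, ∀ j ∈ s, ∀ k ∈ s, ∀ l ∈ s,
      i ≠ j → i ≠ k → i ≠ l → j ≠ k → j ≠ l → k ≠ l → ‖crossRatio i j k l‖ ≤ B := by
  obtain ⟨L, hL, hmem⟩ := exists_numberField_mem_of_disc hD
  have : NumberField L := @NumberField.mk _ _ inferInstance hL
  have hfin := (finite_isAlmostUnit_one_sub L hD).image (fun x : L => ‖(x : ℂ)‖)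
  obtain ⟨B, hB⟩ := hfin.bddAbove
  refine ⟨B, fun f s hf i hi j hj k hk l hl hij hik hil hjk hjl hkl => ?_⟩
  have hL' : crossRatio i j k l ∈ L := by
    have hm := fun z hz => hmem f s hf z hz
    exact L.div_mem (L.mul_mem (L.sub_mem (hm i hi) (hm j hj)) (L.sub_mem (hm k hk) (hm l hl)))
      (L.mul_mem (L.sub_mem (hm i hi) (hm k hk)) (L.sub_mem (hm j hj) (hm l hl)))
  have hdesc : ∀ x : L, IsAlmostUnit D (x : ℂ) → IsAlmostUnit D x := fun x hx => by
    have hinj : Function.Injective (algebraMap L ℂ) := (algebraMap L ℂ).injective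
    refine ⟨fun h => hx.1 (by rw [h]; rfl), ?_, ?_⟩
    · refine (isIntegral_algebraMap_iff (R := ℤ) hinj).mp ?_
      have h1 := hx.2.1
      rwa [show algebraMap L ℂ ((D : L) * x) = (D : ℂ) * x by rw [map_mul, map_intCast]; rfl]
    · refine (isIntegral_algebraMap_iff (R := ℤ) hinj).mp ?_
      have h1 := hx.2.2
      rwa [show algebraMap L ℂ ((D : L) * x⁻¹) = (D : ℂ) * (x : ℂ)⁻¹ by
        rw [map_mul, map_intCast, map_inv₀]; rfl]
  refine hB ⟨⟨_, hL'⟩, ⟨hdesc _ ?_, hdesc _ ?_⟩, rfl⟩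
  · exact IsAlmostUnit.of_crossRatio hf hi hj hk hl hij hik hjl hkl
  · change IsAlmostUnit D (1 - crossRatio i j k l)
    rw [one_sub_crossRatio hik hjl]
    exact IsAlmostUnit.of_crossRatio hf hi hl hk hj hil hik hjl.symm hjk.symm

/-- Reduction of positive definite binary quadratic forms. -/
theorem exists_reduced_binary_form {A B C : ℝ} (hA : 0 < A) (hΔ : B ^ 2 < A * C) :
    ∃ p q r s : ℤ, IsUnit (p * s - q * r) ∧
      |2 * (A * p * q + B * (p * s + q * r) + C * r * s)| ≤ A * p ^ 2 + 2 * B * p * r + C * r ^ 2 ∧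
      A * p ^ 2 + 2 * B * p * r + C * r ^ 2 ≤ A * q ^ 2 + 2 * B * q * s + C * s ^ 2 := by
  have hΔ' : 0 < A * C - B ^ 2 := sub_pos.mpr hΔ
  set y : ℝ := √(A * C - B ^ 2) / A with hy
  have hy0 : 0 < y := by positivity
  set x : ℝ := -B / A with hx
  have hxA : A * x = -B := by rw [hx]; field_simp
  have hyA : A * (x ^ 2 + y ^ 2) = C := by
    rw [hx, hy, div_pow, div_pow, Real.sq_sqrt hΔ'.le]; field_simp; ring
  obtain ⟨g, hg1, hg2⟩ := ModularGroup.exists_smul_mem_fd (⟨⟨x, y⟩, hy0⟩ : UpperHalfPlane)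
  have hdet := g.det_coe
  rw [Matrix.det_fin_two] at hdet
  rw [UpperHalfPlane.specialLinearGroup_apply] at hg1
  rw [← UpperHalfPlane.coe_re, UpperHalfPlane.specialLinearGroup_apply] at hg2
  simp only [algebraMap_int_eq, eq_intCast, Complex.ofReal_intCast] at hg1 hg2
  set N : ℂ := (g 0 0 : ℂ) * (⟨x, y⟩ : ℂ) + (g 0 1 : ℂ) with hN
  set E : ℂ := (g 1 0 : ℂ) * (⟨x, y⟩ : ℂ) + (g 1 1 : ℂ) with hE
  have hNre : N.re = g 0 0 * x + g 0 1 := by simp [hN]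
  have hNim : N.im = g 0 0 * y := by simp [hN]
  have hEre : E.re = g 1 0 * x + g 1 1 := by simp [hE]
  have hEim : E.im = g 1 0 * y := by simp [hE]
  have hE0 : 0 < Complex.normSq E := by
    refine Complex.normSq_pos.mpr fun h0 => ?_
    rw [h0, div_zero, map_zero] at hg1
    exact absurd hg1 (by norm_num)
  have hq (N : ℂ) (a b : ℤ) (h1 : N.re = a * x + b) (h2 : N.im = a * y) :
      A * b ^ 2 + 2 * B * b * (-a : ℤ) + C * (-a : ℤ) ^ 2 = A * Complex.normSq N := by
    rw [Complex.normSq_apply, h1, h2]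
    push_cast
    linear_combination (-a ^ 2 : ℝ) * hyA - 2 * a * b * hxA
  refine ⟨g 1 1, g 0 1, -g 1 0, -g 0 0, ?_, ?_, ?_⟩
  · rw [show g 1 1 * -g 0 0 - g 0 1 * -g 1 0 = -(g 0 0 * g 1 1 - g 0 1 * g 1 0) by ring, hdet]
    exact isUnit_one.neg
  · rw [hq E _ _ hEre hEim]
    have hre : (N / E).re * Complex.normSq E = N.re * E.re + N.im * E.im := by
      rw [Complex.div_re]
      field_simp
    have hval : 2 * (A * (g 1 1 : ℝ) * (g 0 1 : ℤ) + B * ((g 1 1 : ℤ) * (-g 0 0 : ℤ) +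
        (g 0 1 : ℤ) * (-g 1 0 : ℤ)) + C * (-g 1 0 : ℤ) * (-g 0 0 : ℤ)) =
        A * (2 * ((N / E).re * Complex.normSq E)) := by
      rw [hre, hNre, hNim, hEre, hEim]
      push_cast
      linear_combination (-2 * (g 0 0 : ℝ) * g 1 0) * hyA -
        2 * ((g 0 0 : ℝ) * g 1 1 + g 0 1 * g 1 0) * hxA
    rw [hval, abs_mul, abs_of_pos hA, abs_mul, abs_mul, abs_of_pos hE0, abs_two]
    refine mul_le_mul_of_nonneg_left ?_ hA.le
    nlinarith
  · rw [hq E _ _ hEre hEim, hq N _ _ hNre hNim]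
    refine mul_le_mul_of_nonneg_left ?_ hA.le
    rwa [map_div₀, le_div_iff₀ hE0, one_mul] at hg1

theorem prod_offDiag_mul {R M : Type*} [DecidableEq R] [CommMonoid M] (s : Finset R) (u : R → M) :
    ∏ e ∈ s.offDiag, u e.1 * u e.2 = (∏ z ∈ s, u z) ^ (2 * (s.card - 1)) := by
  have h := congrArg (fun m => (m.map u).prod) (offDiag_bind_endpoints s)
  simp only [Multiset.map_bind, Multiset.prod_bind, Multiset.map_nsmul, Multiset.prod_nsmul] at h
  rw [Finset.prod_eq_multiset_prod s u, ← h, Finset.prod_eq_multiset_prod]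
  simp

/-- If all cross-ratios of a finite set are bounded by `B`, weights can be chosen such that all
weighted distances are comparable. -/
theorem exists_weights_of_norm_crossRatio_le {s : Finset ℂ} {B : ℝ} (hB : 1 ≤ B)
    (hs : ∀ i ∈ s, ∀ j ∈ s, ∀ k ∈ s, ∀ l ∈ s,
      i ≠ j → i ≠ k → i ≠ l → j ≠ k → j ≠ l → k ≠ l → ‖crossRatio i j k l‖ ≤ B)
    (hne : s.Nonempty) :
    ∃ v : ℂ → ℝ, (∀ z, 0 < v z) ∧ ∃ r > 0, ∀ z ∈ s, ∀ w ∈ s, z ≠ w →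
      r ≤ B ^ 2 * (v z * v w * ‖z - w‖) ∧ v z * v w * ‖z - w‖ ≤ B ^ 2 * r := by
  obtain ⟨o, ho⟩ := hne
  have hB2 : 1 ≤ B ^ 2 := one_le_pow₀ hB
  set q : ℂ → ℂ → ℝ := fun i j => ‖i - o‖⁻¹ * ‖j - o‖⁻¹ * ‖i - j‖ with hq
  have hpos : ∀ {a b : ℂ}, a ≠ b → 0 < ‖a - b‖ := fun h => norm_pos_iff.mpr (sub_ne_zero.mpr h)
  have hq0 : ∀ {i j : ℂ}, i ≠ o → j ≠ o → i ≠ j → 0 < q i j := fun hi hj hij =>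
    mul_pos (mul_pos (inv_pos.mpr (hpos hi)) (inv_pos.mpr (hpos hj))) (hpos hij)
  have hsymm : ∀ i j, q i j = q j i := fun i j => by
    simp only [hq]; rw [norm_sub_rev i j]; ring
  have hstep : ∀ i ∈ s, ∀ j ∈ s, ∀ k ∈ s, i ≠ o → j ≠ o → k ≠ o → i ≠ j → i ≠ k →
      q i j ≤ B * q i k := by
    intro i hi j hj k hk hio hjo hko hij hik
    by_cases hjk : j = k
    · rw [hjk]; exact le_mul_of_one_le_left (hq0 hio hko hik).le hB
    have h := hs i hi j hj k hk o ho hij hik hio hjk hjo hko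
    rw [crossRatio, norm_div, norm_mul, norm_mul,
      div_le_iff₀ (mul_pos (hpos hik) (hpos hjo))] at h
    have h1 := hpos hio
    have h2 := hpos hjo
    have h3 := hpos hko
    simp only [hq]
    rw [← sub_nonneg] at h ⊢
    have : B * (‖i - o‖⁻¹ * ‖k - o‖⁻¹ * ‖i - k‖) - ‖i - o‖⁻¹ * ‖j - o‖⁻¹ * ‖i - j‖ =
        (B * (‖i - k‖ * ‖j - o‖) - ‖i - j‖ * ‖k - o‖) * (‖i - o‖⁻¹ * ‖j - o‖⁻¹ * ‖k - o‖⁻¹) := by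
      field_simp
    rw [this]
    positivity
  have htwo : ∀ i ∈ s, ∀ j ∈ s, ∀ k ∈ s, ∀ l ∈ s, i ≠ o → j ≠ o → k ≠ o → l ≠ o → i ≠ j →
      k ≠ l → q k l ≤ B ^ 2 * q i j := by
    intro i hi j hj k hk l hl hio hjo hko hlo hij hkl
    by_cases hkj : k = j
    · subst hkj
      refine (hstep k hk l hl i hi hko hlo hio hkl hij.symm).trans ?_
      rw [hsymm k i, sq]
      exact mul_le_mul_of_nonneg_right (le_mul_of_one_le_left (by linarith) hB) (hq0 hio hko hij).le
    · have h1 := hstep k hk l hl j hj hko hlo hjo hkl hkj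
      have h2 := hstep j hj k hk i hi hjo hko hio (Ne.symm hkj) hij.symm
      rw [hsymm k j] at h1
      rw [hsymm j i] at h2
      nlinarith
  obtain ⟨r, hr, hrq⟩ : ∃ r > 0, ∀ i ∈ s, ∀ j ∈ s, i ≠ o → j ≠ o → i ≠ j →
      r ≤ B ^ 2 * q i j ∧ q i j ≤ B ^ 2 * r := by
    by_cases h : ∃ k ∈ s, ∃ l ∈ s, k ≠ o ∧ l ≠ o ∧ k ≠ l
    · obtain ⟨k, hk, l, hl, hko, hlo, hkl⟩ := h
      exact ⟨q k l, hq0 hko hlo hkl, fun i hi j hj hio hjo hij =>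
        ⟨htwo i hi j hj k hk l hl hio hjo hko hlo hij hkl,
          htwo k hk l hl i hi j hj hko hlo hio hjo hkl hij⟩⟩
    · push Not at h
      exact ⟨1, one_pos, fun i hi j hj hio hjo hij => absurd (h i hi j hj hio hjo) hij⟩
  refine ⟨fun z => if z = o then r else ‖z - o‖⁻¹, fun z => ?_, r, hr, fun z hz w hw hzw => ?_⟩
  · dsimp only
    split_ifs with h
    · exact hr
    · exact inv_pos.mpr (hpos h)
  · have hcase : ∀ t, t = r → r ≤ B ^ 2 * t ∧ t ≤ B ^ 2 * r := fun t ht => by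
      rw [ht]; exact ⟨le_mul_of_one_le_left hr.le hB2, le_mul_of_one_le_left hr.le hB2⟩
    dsimp only
    split_ifs with h1 h2 h2
    · exact absurd (h1.trans h2.symm) hzw
    · subst h1
      refine hcase _ ?_
      rw [norm_sub_rev z w, mul_assoc, inv_mul_cancel₀ (hpos h2).ne', mul_one]
    · subst h2
      refine hcase _ ?_
      rw [mul_right_comm, inv_mul_cancel₀ (hpos h1).ne', one_mul]
    · exact hrq z hz w hw h1 h2 hzw

theorem HasRootsAndDisc.norm_eq {f : ℤ[X]} {s : Finset ℂ} {D : ℤ} (h : HasRootsAndDisc f s D) :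
    |(D : ℝ)| = |(f.leadingCoeff : ℝ)| ^ (2 * (s.card - 1)) *
      ∏ e ∈ s.offDiag, ‖e.1 - e.2‖ := by
  obtain ⟨ε, hε, hD⟩ := h.disc
  have := congrArg norm hD
  rw [norm_mul, norm_mul, norm_pow, diffProd, norm_prod, Complex.norm_intCast,
    Complex.norm_intCast, Complex.norm_intCast, ← h.roots.card_eq h.ne_zero] at this
  rw [this]
  rcases hε with rfl | rfl <;> simp

/-- A system of positive weights on the roots `s` of an integer polynomial with leading
coefficient `a`, for which all weighted distances lie between `C⁻¹` and `C`. -/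
structure IsBalanced (a : ℤ) (s : Finset ℂ) (C : ℝ) (u : ℂ → ℝ) : Prop where
  pos : ∀ z, 0 < u z
  prod_eq : ∏ z ∈ s, u z = |(a : ℝ)|
  one_le : ∀ z ∈ s, ∀ w ∈ s, z ≠ w → 1 ≤ C * (u z * u w * ‖z - w‖)
  le : ∀ z ∈ s, ∀ w ∈ s, z ≠ w → u z * u w * ‖z - w‖ ≤ C

theorem exists_isBalanced {D : ℤ} (hD : D ≠ 0) :
    ∃ C : ℝ, 1 ≤ C ∧ ∀ f s, HasRootsAndDisc f s D → 2 ≤ s.card →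
      ∃ u, IsBalanced f.leadingCoeff s C u := by
  obtain ⟨B', hB'⟩ := exists_norm_crossRatio_le hD
  set B := max B' 1
  have hB : 1 ≤ B := le_max_right _ _
  have hB2 : 1 ≤ B ^ 2 := one_le_pow₀ hB
  have hD1 : 1 ≤ |(D : ℝ)| := by exact_mod_cast Int.one_le_abs hD
  refine ⟨|(D : ℝ)| * (B ^ 2) ^ 2, one_le_mul_of_one_le_of_one_le hD1 (one_le_pow₀ hB2),
    fun f s hf hs => ?_⟩
  have hne : s.Nonempty := Finset.card_pos.mp (by omega)
  obtain ⟨v, hv0, r', hr', hv⟩ := exists_weights_of_norm_crossRatio_le hB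
    (fun i hi j hj k hk l hl h1 h2 h3 h4 h5 h6 =>
      (hB' f s hf i hi j hj k hk l hl h1 h2 h3 h4 h5 h6).trans (le_max_left _ _)) hne
  have hP : 0 < ∏ z ∈ s, v z := Finset.prod_pos fun z _ => hv0 z
  have hlc : 0 < |(f.leadingCoeff : ℝ)| :=
    abs_pos.mpr (by exact_mod_cast leadingCoeff_ne_zero.mpr hf.ne_zero)
  obtain ⟨τ, hτ, hτs⟩ : ∃ τ : ℝ, 0 < τ ∧ τ ^ s.card = |(f.leadingCoeff : ℝ)| / ∏ z ∈ s, v z :=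
    ⟨_, Real.rpow_pos_of_pos (div_pos hlc hP) _,
      Real.rpow_inv_natCast_pow (div_pos hlc hP).le (by omega)⟩
  set u : ℂ → ℝ := fun z => τ * v z with hu
  have hu0 : ∀ z, 0 < u z := fun z => mul_pos hτ (hv0 z)
  have hprod : ∏ z ∈ s, u z = |(f.leadingCoeff : ℝ)| := by
    rw [Finset.prod_mul_distrib, Finset.prod_const, hτs, div_mul_cancel₀ _ hP.ne']
  set r := τ ^ 2 * r' with hr
  have hr0 : 0 < r := by positivity
  have ht : ∀ z ∈ s, ∀ w ∈ s, z ≠ w →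
      r ≤ B ^ 2 * (u z * u w * ‖z - w‖) ∧ u z * u w * ‖z - w‖ ≤ B ^ 2 * r := by
    intro z hz w hw hzw
    obtain ⟨h1, h2⟩ := hv z hz w hw hzw
    have hτ2 : 0 ≤ τ ^ 2 := by positivity
    have h1' := mul_le_mul_of_nonneg_left h1 hτ2
    have h2' := mul_le_mul_of_nonneg_left h2 hτ2
    simp only [hu, hr]
    constructor <;> linarith
  have hdisc : |(D : ℝ)| = ∏ e ∈ s.offDiag, u e.1 * u e.2 * ‖e.1 - e.2‖ := by
    rw [Finset.prod_mul_distrib, prod_offDiag_mul, hprod, hf.norm_eq]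
  have hoff : s.offDiag.card ≠ 0 := by
    rw [Finset.offDiag_card]
    have : s.card * 2 ≤ s.card * s.card := Nat.mul_le_mul_left _ hs
    omega
  have hup : |(D : ℝ)| ≤ (B ^ 2 * r) ^ s.offDiag.card := by
    rw [hdisc, ← Finset.prod_const]
    refine Finset.prod_le_prod (fun e _ => ?_) fun e he => ?_
    · have := hu0 e.1
      have := hu0 e.2
      positivity
    · obtain ⟨h1, h2, h3⟩ := Finset.mem_offDiag.mp he
      exact (ht _ h1 _ h2 h3).2
  have hlow : (r / B ^ 2) ^ s.offDiag.card ≤ |(D : ℝ)| := by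
    rw [hdisc, ← Finset.prod_const]
    refine Finset.prod_le_prod (fun _ _ => by positivity) fun e he => ?_
    obtain ⟨h1, h2, h3⟩ := Finset.mem_offDiag.mp he
    rw [div_le_iff₀ (by positivity), mul_comm]
    exact (ht _ h1 _ h2 h3).1
  have hr1 : 1 ≤ B ^ 2 * r := by
    by_contra! h
    have := pow_lt_one₀ (by positivity) h hoff
    linarith
  have hr2 : r ≤ |(D : ℝ)| * B ^ 2 := by
    rw [← div_le_iff₀ (by positivity)]
    by_contra! h
    have := le_self_pow₀ (hD1.trans h.le) hoff
    linarith
  refine ⟨u, hu0, hprod, fun z hz w hw hzw => ?_, fun z hz w hw hzw => ?_⟩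
  · obtain ⟨h1, -⟩ := ht z hz w hw hzw
    have h2 : 1 ≤ (B ^ 2) ^ 2 * (u z * u w * ‖z - w‖) := by nlinarith
    rw [mul_assoc]
    nlinarith
  · obtain ⟨-, h2⟩ := ht z hz w hw hzw
    nlinarith

theorem HasRootsAndDisc.conj_mem {f : ℤ[X]} {s : Finset ℂ} {D : ℤ} (h : HasRootsAndDisc f s D)
    {z : ℂ} (hz : z ∈ s) : starRingEnd ℂ z ∈ s := by
  rw [h.roots.mem_iff h.ne_zero] at hz ⊢
  have := aeval_algHom_apply ((Complex.conjAe : ℂ →ₐ[ℝ] ℂ).restrictScalars ℤ) z f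
  rw [hz, map_zero] at this
  exact this

theorem prod_comp_conj {M : Type*} [CommMonoid M] {s : Finset ℂ}
    (hs : ∀ z ∈ s, starRingEnd ℂ z ∈ s) (u : ℂ → M) :
    ∏ z ∈ s, u (starRingEnd ℂ z) = ∏ z ∈ s, u z :=
  Finset.prod_nbij' (starRingEnd ℂ) (starRingEnd ℂ) hs hs (fun _ _ => Complex.conj_conj _)
    (fun _ _ => Complex.conj_conj _) fun _ _ => rfl

/-- Balanced weights can be made invariant under complex conjugation. -/
theorem IsBalanced.symmetrize {a : ℤ} {s : Finset ℂ} {C : ℝ} {u : ℂ → ℝ} (hC : 0 ≤ C)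
    (hs : ∀ z ∈ s, starRingEnd ℂ z ∈ s) (h : IsBalanced a s C u) :
    IsBalanced a s C fun z => √(u z * u (starRingEnd ℂ z)) := by
  have hconj : ∀ z w : ℂ, ‖starRingEnd ℂ z - starRingEnd ℂ w‖ = ‖z - w‖ := fun z w => by
    rw [← map_sub, Complex.norm_conj]
  have hval : ∀ z w : ℂ, √(u z * u (starRingEnd ℂ z)) * √(u w * u (starRingEnd ℂ w)) * ‖z - w‖ =
      √((u z * u w * ‖z - w‖) * (u (starRingEnd ℂ z) * u (starRingEnd ℂ w) *
        ‖starRingEnd ℂ z - starRingEnd ℂ w‖)) := fun z w => by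
    rw [hconj, ← Real.sqrt_mul (mul_pos (h.pos _) (h.pos _)).le,
      ← Real.sqrt_sq (norm_nonneg (z - w)), ← Real.sqrt_mul (mul_pos (mul_pos (h.pos _) (h.pos _))
        (mul_pos (h.pos _) (h.pos _))).le, Real.sqrt_sq (norm_nonneg (z - w))]
    congr 1
    ring
  have hne : ∀ z w : ℂ, z ≠ w → starRingEnd ℂ z ≠ starRingEnd ℂ w := fun z w hzw h' =>
    hzw ((starRingEnd ℂ).injective h')
  refine ⟨fun z => Real.sqrt_pos.mpr (mul_pos (h.pos _) (h.pos _)), ?_,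
    fun z hz w hw hzw => ?_, fun z hz w hw hzw => ?_⟩
  · rw [← Real.sqrt_prod _ fun z _ => (mul_pos (h.pos _) (h.pos _)).le, Finset.prod_mul_distrib,
      prod_comp_conj hs, h.prod_eq, Real.sqrt_mul_self (abs_nonneg _)]
  · rw [hval, ← Real.sqrt_sq hC, ← Real.sqrt_mul (sq_nonneg C), Real.one_le_sqrt]
    have h1 := h.one_le z hz w hw hzw
    have h2 := h.one_le _ (hs z hz) _ (hs w hw) (hne _ _ hzw)
    nlinarith
  · rw [hval]
    refine Real.sqrt_le_iff.mpr ⟨hC, ?_⟩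
    have h1 := h.le z hz w hw hzw
    have h2 := h.le _ (hs z hz) _ (hs w hw) (hne _ _ hzw)
    rw [sq]
    refine mul_le_mul h1 h2 ?_ hC
    have := h.pos (starRingEnd ℂ z)
    have := h.pos (starRingEnd ℂ w)
    positivity

/-- Lagrange's identity. -/
theorem sum_normSq_mul_sum_normSq_sub {ι : Type*} (s : Finset ι) (P Q : ι → ℂ) :
    2 * ((∑ i ∈ s, Complex.normSq (P i)) * (∑ i ∈ s, Complex.normSq (Q i)) -
      Complex.normSq (∑ i ∈ s, P i * starRingEnd ℂ (Q i))) =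
    ∑ i ∈ s, ∑ j ∈ s, Complex.normSq (P i * Q j - P j * Q i) := by
  have h1 : ∀ i j, Complex.normSq (P i * Q j - P j * Q i) =
      Complex.normSq (P i) * Complex.normSq (Q j) + Complex.normSq (P j) * Complex.normSq (Q i) -
      2 * ((P i * starRingEnd ℂ (Q i)) * starRingEnd ℂ (P j * starRingEnd ℂ (Q j))).re := by
    intro i j
    rw [Complex.normSq_sub, map_mul, map_mul, map_mul, map_mul, Complex.conj_conj]
    congr 3
    ring
  simp_rw [h1, Finset.sum_sub_distrib, Finset.sum_add_distrib]
  rw [Finset.sum_mul_sum, Finset.sum_comm (f := fun i j => Complex.normSq (P j) * _)]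
  have h2 : Complex.normSq (∑ i ∈ s, P i * starRingEnd ℂ (Q i)) =
      ∑ i ∈ s, ∑ j ∈ s,
        ((P i * starRingEnd ℂ (Q i)) * starRingEnd ℂ (P j * starRingEnd ℂ (Q j))).re := by
    rw [← Complex.ofReal_re (Complex.normSq _), Complex.normSq_eq_conj_mul_self, mul_comm,
      map_sum, Finset.sum_mul_sum, Complex.re_sum]
    simp_rw [Complex.re_sum]
  rw [h2]
  simp_rw [← Finset.mul_sum]
  ring

/-- Two families of complex numbers on a finite set `s`, thought of as the coefficients of the
linear forms `P i * X + Q i * Y`, which are pairwise independent with determinants between `C⁻¹`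
and `C`, and such that the associated positive definite binary form is reduced. -/
structure IsReducedFamily {ι : Type*} (s : Finset ι) (C : ℝ) (P Q : ι → ℂ) : Prop where
  one_le : ∀ i ∈ s, ∀ j ∈ s, i ≠ j → 1 ≤ C * ‖P i * Q j - P j * Q i‖
  le : ∀ i ∈ s, ∀ j ∈ s, i ≠ j → ‖P i * Q j - P j * Q i‖ ≤ C
  norm_sum_le : 2 * ‖∑ i ∈ s, P i * starRingEnd ℂ (Q i)‖ ≤ ∑ i ∈ s, Complex.normSq (P i)
  sum_le_sum : ∑ i ∈ s, Complex.normSq (P i) ≤ ∑ i ∈ s, Complex.normSq (Q i)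

/-- A set of balanced linear forms can be reduced by a unimodular substitution. -/
theorem IsBalanced.exists_isReducedFamily {a : ℤ} {S : Finset ℂ} {C : ℝ} {u : ℂ → ℝ}
    (h : IsBalanced a S C u) (hS : ∀ z ∈ S, starRingEnd ℂ z ∈ S)
    (hu : ∀ z, u (starRingEnd ℂ z) = u z) (hcard : 2 ≤ S.card) :
    ∃ p q r s : ℤ, IsUnit (p * s - q * r) ∧
      IsReducedFamily S C (fun z => u z * (p - z * r)) fun z => u z * (q - z * s) := by
  obtain ⟨z₀, hz₀, z₁, hz₁, hz₀₁⟩ := Finset.one_lt_card.mp hcard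
  set A : ℝ := ∑ z ∈ S, u z ^ 2 with hA
  set β : ℝ := ∑ z ∈ S, u z ^ 2 * z.re with hβ
  set B : ℝ := ∑ z ∈ S, u z ^ 2 * Complex.normSq z with hB
  have him : ∑ z ∈ S, u z ^ 2 * z.im = 0 := by
    have := prod_comp_conj hS fun z => Multiplicative.ofAdd (u z ^ 2 * z.im)
    rw [← ofAdd_sum, ← ofAdd_sum] at this
    have := Multiplicative.ofAdd.injective this
    simp only [hu, Complex.conj_im, mul_neg, Finset.sum_neg_distrib] at this
    linarith
  have hA0 : 0 < A := Finset.sum_pos (fun z _ => pow_pos (h.pos z) 2) ⟨z₀, hz₀⟩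
  have hsum : ∀ p q r s : ℝ, ∑ z ∈ S, (u z * (p - z * r) : ℂ) *
      starRingEnd ℂ (u z * (q - z * s)) = ((A * p * q - β * (p * s + q * r) + B * r * s : ℝ) : ℂ) := by
    intro p q r s
    apply Complex.ext
    · rw [Complex.re_sum, Complex.ofReal_re, hA, hβ, hB]
      simp only [Finset.sum_mul, ← Finset.sum_add_distrib, ← Finset.sum_sub_distrib]
      refine Finset.sum_congr rfl fun z _ => ?_
      simp [Complex.normSq_apply]
      ring
    · rw [Complex.im_sum, Complex.ofReal_im]
      rw [← zero_mul (p * s - q * r), ← him, Finset.sum_mul]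
      refine Finset.sum_congr rfl fun z _ => ?_
      simp
      ring
  have hnorm : ∀ p r : ℝ, ∑ z ∈ S, Complex.normSq (u z * (p - z * r) : ℂ) =
      A * p ^ 2 + 2 * -β * p * r + B * r ^ 2 := by
    intro p r
    have := hsum p p r r
    simp only [Complex.mul_conj] at this
    rw [← Complex.ofReal_sum] at this
    rw [Complex.ofReal_injective this]
    ring
  have hΔ : (-β) ^ 2 < A * B := by
    have h1 := sum_normSq_mul_sum_normSq_sub S (fun z => (u z * ((1 : ℝ) - z * (0 : ℝ)) : ℂ))
      fun z => (u z * ((0 : ℝ) - z * (1 : ℝ)) : ℂ)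
    rw [hsum, hnorm, hnorm, Complex.normSq_ofReal] at h1
    have h2 : 0 < ∑ i ∈ S, ∑ j ∈ S, Complex.normSq
        ((u i * ((1 : ℝ) - i * (0 : ℝ)) : ℂ) * (u j * ((0 : ℝ) - j * (1 : ℝ))) -
          (u j * ((1 : ℝ) - j * (0 : ℝ))) * (u i * ((0 : ℝ) - i * (1 : ℝ)))) := by
      refine Finset.sum_pos' (fun _ _ => Finset.sum_nonneg fun _ _ => Complex.normSq_nonneg _)
        ⟨z₀, hz₀, Finset.sum_pos' (fun _ _ => Complex.normSq_nonneg _) ⟨z₁, hz₁, ?_⟩⟩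
      rw [Complex.normSq_pos]
      have h3 : ((u z₀ : ℂ) * u z₁) * (z₀ - z₁) ≠ 0 := mul_ne_zero (mul_ne_zero
        (Complex.ofReal_ne_zero.mpr (h.pos _).ne') (Complex.ofReal_ne_zero.mpr (h.pos _).ne'))
        (sub_ne_zero.mpr hz₀₁)
      refine fun h4 => h3 ?_
      rw [← h4]
      push_cast
      ring
    rw [← h1] at h2
    nlinarith
  obtain ⟨p, q, r, s, hunit, h1, h2⟩ := exists_reduced_binary_form hA0 hΔ
  have hdet : ∀ z w : ℂ, ‖(u z * (p - z * r) : ℂ) * (u w * (q - w * s)) -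
      (u w * (p - w * r)) * (u z * (q - z * s))‖ = u z * u w * ‖z - w‖ := by
    intro z w
    rw [show (u z * (p - z * r) : ℂ) * (u w * (q - w * s)) -
      (u w * (p - w * r)) * (u z * (q - z * s)) =
        ((p * s - q * r : ℤ) : ℂ) * ((u z * u w : ℝ) * (z - w)) by push_cast; ring, norm_mul,
      norm_mul, Complex.norm_real, Real.norm_of_nonneg (mul_pos (h.pos z) (h.pos w)).le,
      Complex.norm_intCast]
    rcases Int.isUnit_iff.mp hunit with h | h <;> rw [h] <;> simp
  refine ⟨p, q, r, s, hunit, fun i hi j hj hij => ?_, fun i hi j hj hij => ?_, ?_, ?_⟩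
  · rw [hdet]; exact h.one_le i hi j hj hij
  · rw [hdet]; exact h.le i hi j hj hij
  · have h3 := hsum p q r s
    have h4 := hnorm p r
    simp only [Complex.ofReal_intCast] at h3 h4
    rw [h3, h4, Complex.norm_real, Real.norm_eq_abs]
    refine le_trans (le_of_eq ?_) h1
    rw [← abs_two, ← abs_mul, abs_two]
    congr 1
    ring
  · have h3 := hnorm p r
    have h4 := hnorm q s
    simp only [Complex.ofReal_intCast] at h3 h4
    rw [h3, h4]
    exact h2

theorem IsReducedFamily.mul_le {ι : Type*} {s : Finset ι} {C : ℝ} {P Q : ι → ℂ}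
    (h : IsReducedFamily s C P Q) :
    (∑ i ∈ s, Complex.normSq (P i)) * (∑ i ∈ s, Complex.normSq (Q i)) ≤ (s.card * C) ^ 2 := by
  have h1 := sum_normSq_mul_sum_normSq_sub s P Q
  have h2 : ∑ i ∈ s, ∑ j ∈ s, Complex.normSq (P i * Q j - P j * Q i) ≤ (s.card * C) ^ 2 := by
    calc _ ≤ ∑ i ∈ s, ∑ j ∈ s, C ^ 2 := by
            refine Finset.sum_le_sum fun i hi => Finset.sum_le_sum fun j hj => ?_
            by_cases hij : i = j
            · rw [hij, sub_self, map_zero]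
              positivity
            · rw [Complex.normSq_eq_norm_sq]
              exact pow_le_pow_left₀ (norm_nonneg _) (h.le i hi j hj hij) 2
      _ = _ := by simp only [Finset.sum_const, nsmul_eq_mul]; ring
  have h3 := h.norm_sum_le
  have h4 := h.sum_le_sum
  have h5 : 0 ≤ ∑ i ∈ s, Complex.normSq (P i) := Finset.sum_nonneg fun _ _ => Complex.normSq_nonneg _
  rw [Complex.normSq_eq_norm_sq] at h1
  have h6 := norm_nonneg (∑ i ∈ s, P i * starRingEnd ℂ (Q i))
  nlinarith [mul_le_mul h3 h3 (by positivity) h5]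

/-- The members of a reduced family are bounded, provided that the two top nonvanishing
coefficients of their product are bounded from below. -/
theorem IsReducedFamily.prod_le {ι : Type*} [DecidableEq ι] {s : Finset ι} {C : ℝ} {P Q : ι → ℂ}
    (hC : 1 ≤ C) (h : IsReducedFamily s C P Q) (hs : 2 ≤ s.card)
    (h₀ : (∀ i ∈ s, P i ≠ 0) → 1 ≤ ∏ i ∈ s, ‖P i‖)
    (h₁ : ∀ o ∈ s, P o = 0 → (∀ i ∈ s.erase o, P i ≠ 0) →
      1 ≤ ‖Q o‖ * ∏ i ∈ s.erase o, ‖P i‖) :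
    ∏ i ∈ s, (‖P i‖ + ‖Q i‖) ≤
      (2 * (C ^ (2 * s.card) * (s.card * C) ^ 2 + 1)) ^ s.card := by
  set n := s.card with hn
  set a := ∑ i ∈ s, Complex.normSq (P i) with ha
  set c := ∑ i ∈ s, Complex.normSq (Q i) with hc
  have hac : a * c ≤ (n * C) ^ 2 := h.mul_le
  have hle : a ≤ c := h.sum_le_sum
  have hPa : ∀ i ∈ s, ‖P i‖ ^ 2 ≤ a := fun i hi => by
    rw [← Complex.normSq_eq_norm_sq]
    exact Finset.single_le_sum (f := fun i => Complex.normSq (P i))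
      (fun _ _ => Complex.normSq_nonneg _) hi
  have hQc : ∀ i ∈ s, ‖Q i‖ ^ 2 ≤ c := fun i hi => by
    rw [← Complex.normSq_eq_norm_sq]
    exact Finset.single_le_sum (f := fun i => Complex.normSq (Q i))
      (fun _ _ => Complex.normSq_nonneg _) hi
  have hc0 : 0 ≤ c := Finset.sum_nonneg fun _ _ => Complex.normSq_nonneg _
  have hC1 : 1 ≤ C ^ (2 * n) := one_le_pow₀ hC
  have hfin : 1 ≤ C ^ (2 * n) * a → ∏ i ∈ s, (‖P i‖ + ‖Q i‖) ≤
      (2 * (C ^ (2 * n) * (n * C) ^ 2 + 1)) ^ n := by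
    intro h1
    have hcM : c ≤ C ^ (2 * n) * (n * C) ^ 2 := by
      calc c ≤ (C ^ (2 * n) * a) * c := le_mul_of_one_le_left hc0 h1
        _ = C ^ (2 * n) * (a * c) := by ring
        _ ≤ _ := by gcongr
    rw [hn, ← Finset.prod_const, ← hn]
    refine Finset.prod_le_prod (fun _ _ => by positivity) fun i hi => ?_
    have h2 := hPa i hi
    have h3 := hQc i hi
    nlinarith [sq_nonneg (‖P i‖ - 1), sq_nonneg (‖Q i‖ - 1)]
  by_cases hP : ∀ i ∈ s, P i ≠ 0
  · obtain ⟨i, hi, hi1⟩ : ∃ i ∈ s, 1 ≤ ‖P i‖ := by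
      by_contra! hlt
      have hlt' := Finset.prod_lt_prod_of_nonempty (g := fun _ => (1 : ℝ))
        (fun i hi => norm_pos_iff.mpr (hP i hi)) hlt (Finset.card_pos.mp (by omega))
      rw [Finset.prod_const_one] at hlt'
      exact absurd (h₀ hP) (not_le.mpr hlt')
    have := hPa i hi
    exact hfin (by nlinarith)
  push Not at hP
  obtain ⟨o, ho, hPo⟩ := hP
  have hone : ∀ w ∈ s.erase o, 1 ≤ C * (‖Q o‖ * ‖P w‖) := fun w hw => by
    have := h.one_le w (Finset.mem_of_mem_erase hw) o ho (Finset.ne_of_mem_erase hw)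
    rwa [hPo, zero_mul, sub_zero, norm_mul, mul_comm ‖P w‖] at this
  have hleC : ∀ w ∈ s.erase o, ‖Q o‖ * ‖P w‖ ≤ C := fun w hw => by
    have := h.le w (Finset.mem_of_mem_erase hw) o ho (Finset.ne_of_mem_erase hw)
    rwa [hPo, zero_mul, sub_zero, norm_mul, mul_comm ‖P w‖] at this
  have hP0 : ∀ i ∈ s.erase o, P i ≠ 0 := fun i hi h0 => by
    have := hone i hi
    rw [h0, norm_zero, mul_zero, mul_zero] at this
    linarith
  have hsec := h₁ o ho hPo hP0
  have hcard : (s.erase o).card = n - 1 := Finset.card_erase_of_mem ho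
  obtain ⟨w, hw⟩ : (s.erase o).Nonempty := Finset.card_pos.mp (by omega)
  have hQ0 := norm_nonneg (Q o)
  rcases hs.eq_or_lt with hs2 | hs3
  · have hsw : s.erase o = {w} := by
      obtain ⟨w', hw'⟩ := Finset.card_eq_one.mp (hcard.trans (by omega))
      rw [hw', Finset.mem_singleton] at hw
      rw [hw', hw]
    have hsplit : s = insert o {w} := by rw [← hsw, Finset.insert_erase ho]
    have how : o ∉ ({w} : Finset ι) := by
      rw [← hsw]; exact Finset.notMem_erase o s
    have hred := h.norm_sum_le
    rw [hsplit, Finset.sum_insert how, Finset.sum_insert how, Finset.sum_singleton,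
      Finset.sum_singleton, hPo, zero_mul, zero_add, map_zero, zero_add, norm_mul,
      Complex.norm_conj, Complex.normSq_eq_norm_sq] at hred
    have hPw : 0 < ‖P w‖ := norm_pos_iff.mpr (hP0 w hw)
    have hQw : 2 * ‖Q w‖ ≤ ‖P w‖ := by
      by_contra! hlt
      nlinarith
    have hprod : ∏ i ∈ s, (‖P i‖ + ‖Q i‖) = ‖Q o‖ * (‖P w‖ + ‖Q w‖) := by
      rw [hsplit, Finset.prod_insert how, Finset.prod_singleton, hPo, norm_zero, zero_add]
    have hb := hleC w hw
    have hX : 1 ≤ C ^ (2 * n) * (n * C) ^ 2 + 1 := by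
      have : 0 ≤ C ^ (2 * n) * (n * C) ^ 2 := by positivity
      linarith
    have hX2 : C ≤ C ^ (2 * n) * (n * C) ^ 2 + 1 := by
      have h1 : (1 : ℝ) ≤ n := by exact_mod_cast (by omega : 1 ≤ n)
      have h2 : C ≤ n * C := by nlinarith
      have h3 : n * C ≤ (n * C) ^ 2 := by nlinarith
      have h4 : (n * C) ^ 2 ≤ C ^ (2 * n) * (n * C) ^ 2 := le_mul_of_one_le_left (sq_nonneg _) hC1
      linarith
    rw [hprod]
    calc ‖Q o‖ * (‖P w‖ + ‖Q w‖) ≤ 2 * C := by nlinarith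
      _ ≤ 2 * (C ^ (2 * n) * (n * C) ^ 2 + 1) := by linarith
      _ ≤ _ := le_self_pow₀ (by linarith) (by omega)
  · refine hfin ?_
    have hQC : ‖Q o‖ ^ (n - 2) ≤ C ^ (n - 1) := by
      calc ‖Q o‖ ^ (n - 2) ≤ ‖Q o‖ ^ (n - 2) * (‖Q o‖ * ∏ i ∈ s.erase o, ‖P i‖) :=
            le_mul_of_one_le_right (by positivity) hsec
        _ = ∏ i ∈ s.erase o, ‖Q o‖ * ‖P i‖ := by
            rw [Finset.prod_mul_distrib, Finset.prod_const, hcard,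
              show n - 1 = n - 2 + 1 by omega, pow_succ, mul_assoc]
        _ ≤ ∏ i ∈ s.erase o, C := Finset.prod_le_prod (fun _ _ => by positivity) hleC
        _ = _ := by rw [Finset.prod_const, hcard]
    have hQ1 : ‖Q o‖ ≤ C ^ (n - 1) := by
      rcases le_total 1 ‖Q o‖ with h1 | h1
      · exact (le_self_pow₀ h1 (by omega)).trans hQC
      · exact h1.trans (one_le_pow₀ hC)
    have h1 : 1 ≤ C ^ n * ‖P w‖ := by
      calc (1 : ℝ) ≤ C * (‖Q o‖ * ‖P w‖) := hone w hw
        _ ≤ C * (C ^ (n - 1) * ‖P w‖) := by gcongr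
        _ = C ^ (n - 1 + 1) * ‖P w‖ := by rw [pow_succ]; ring
        _ = _ := by rw [Nat.sub_add_cancel (by omega)]
    calc (1 : ℝ) ≤ (C ^ n * ‖P w‖) ^ 2 := one_le_pow₀ h1
      _ = C ^ (2 * n) * ‖P w‖ ^ 2 := by rw [mul_pow, ← pow_mul, mul_comm n 2]
      _ ≤ _ := by
        gcongr
        exact hPa w (Finset.mem_of_mem_erase hw)

/-- Multiplying by a linear factor commutes with homogenization. -/
theorem sum_coeff_X_sub_C_mul {R A : Type*} [CommRing R] [CommRing A] [Algebra R A] {g : R[X]}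
    {m : ℕ} (hg : g.natDegree ≤ m) (z : R) (x y : A) :
    ∑ k ∈ Finset.range (m + 2),
      algebraMap R A (((X - C z) * g).coeff k) * x ^ k * y ^ (m + 1 - k) =
    (x - algebraMap R A z * y) *
      ∑ k ∈ Finset.range (m + 1), algebraMap R A (g.coeff k) * x ^ k * y ^ (m - k) := by
  have h1 : ∑ k ∈ Finset.range (m + 2), algebraMap R A ((X * g).coeff k) * x ^ k * y ^ (m + 1 - k) =
      x * ∑ k ∈ Finset.range (m + 1), algebraMap R A (g.coeff k) * x ^ k * y ^ (m - k) := by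
    rw [Finset.sum_range_succ', coeff_X_mul_zero, map_zero, zero_mul, zero_mul, add_zero,
      Finset.mul_sum]
    refine Finset.sum_congr rfl fun k _ => ?_
    rw [coeff_X_mul, Nat.add_sub_add_right]
    ring
  have h2 : ∑ k ∈ Finset.range (m + 2), algebraMap R A (g.coeff k) * x ^ k * y ^ (m + 1 - k) =
      y * ∑ k ∈ Finset.range (m + 1), algebraMap R A (g.coeff k) * x ^ k * y ^ (m - k) := by
    rw [Finset.sum_range_succ, coeff_eq_zero_of_natDegree_lt (n := m + 1) (by omega), map_zero,
      zero_mul, zero_mul, add_zero, Finset.mul_sum]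
    refine Finset.sum_congr rfl fun k hk => ?_
    rw [Finset.mem_range] at hk
    rw [show m + 1 - k = m - k + 1 by omega]
    ring
  simp only [sub_mul, coeff_sub, coeff_C_mul, map_sub, map_mul, Finset.sum_sub_distrib,
    mul_assoc] at h1 h2 ⊢
  rw [← Finset.mul_sum, h1, h2]

theorem sum_coeff_prod_X_sub_C {R A : Type*} [CommRing R] [CommRing A] [Algebra R A]
    (s : Finset R) (x y : A) :
    ∑ k ∈ Finset.range (s.card + 1),
      algebraMap R A ((∏ z ∈ s, (X - C z)).coeff k) * x ^ k * y ^ (s.card - k) =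
    ∏ z ∈ s, (x - algebraMap R A z * y) := by
  classical
  induction s using Finset.induction_on with
  | empty => simp
  | insert z s hz ih =>
    rw [Finset.prod_insert hz, Finset.prod_insert hz, Finset.card_insert_of_notMem hz,
      sum_coeff_X_sub_C_mul _ z x y, ih]
    refine (natDegree_prod_le _ _).trans ((Finset.sum_le_card_nsmul _ _ 1 fun z _ => ?_).trans
      (by simp))
    exact natDegree_X_sub_C_le z

theorem HasSimpleRoots.map_glTranslate {f : ℤ[X]} {S : Finset ℂ} (h : HasSimpleRoots f S)
    (p q r s : ℤ) :
    (glTranslate S.card f !![p, q; r, s]).map (Int.castRingHom ℂ) =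
      C (f.leadingCoeff : ℂ) *
        ∏ z ∈ S, (C ((p : ℂ) - z * r) * X + C ((q : ℂ) - z * s)) := by
  have hcoeff : ∀ k, (f.coeff k : ℂ) = f.leadingCoeff * (∏ z ∈ S, (X - C z)).coeff k := fun k => by
    rw [← coeff_C_mul, ← h, coeff_map, eq_intCast]
  have h1 := sum_coeff_prod_X_sub_C S (C (p : ℂ) * X + C (q : ℂ)) (C (r : ℂ) * X + C (s : ℂ))
  have h2 : ∀ z : ℂ, C ((p : ℂ) - z * r) * X + C ((q : ℂ) - z * s) =
      C (p : ℂ) * X + C (q : ℂ) - algebraMap ℂ ℂ[X] z * (C (r : ℂ) * X + C (s : ℂ)) := fun z => by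
    rw [algebraMap_eq, C_sub, C_sub, C_mul, C_mul]
    ring
  simp_rw [h2]
  rw [← h1, glTranslate, Polynomial.map_sum, Finset.mul_sum]
  refine Finset.sum_congr rfl fun k _ => ?_
  have h3 : (C (f.coeff k)).map (Int.castRingHom ℂ) =
      C (f.leadingCoeff : ℂ) * algebraMap ℂ ℂ[X] ((∏ z ∈ S, (X - C z)).coeff k) := by
    rw [map_C, eq_intCast, hcoeff, C_mul, algebraMap_eq]
  rw [Polynomial.map_mul, Polynomial.map_mul, h3]
  simp [mul_assoc]

theorem norm_coeff_prod_le {ι : Type*} (s : Finset ι) (P Q : ι → ℂ) (k : ℕ) :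
    ‖(∏ i ∈ s, (C (P i) * X + C (Q i))).coeff k‖ ≤ ∏ i ∈ s, (‖P i‖ + ‖Q i‖) := by
  classical
  induction s using Finset.induction_on generalizing k with
  | empty =>
    rw [Finset.prod_empty, Finset.prod_empty, coeff_one]
    split_ifs <;> simp
  | insert i s hi ih =>
    rw [Finset.prod_insert hi, Finset.prod_insert hi, add_mul, coeff_add, coeff_C_mul, mul_assoc,
      coeff_C_mul, add_mul]
    refine (norm_add_le _ _).trans (add_le_add ?_ ?_)
    · rw [norm_mul]
      refine mul_le_mul_of_nonneg_left ?_ (norm_nonneg _)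
      cases k with
      | zero => rw [coeff_X_mul_zero, norm_zero]; exact Finset.prod_nonneg fun _ _ => by positivity
      | succ k => rw [coeff_X_mul]; exact ih k
    · rw [norm_mul]
      exact mul_le_mul_of_nonneg_left (ih k) (norm_nonneg _)

theorem coeff_card_prod {ι R : Type*} [CommRing R] (s : Finset ι) (P Q : ι → R) :
    (∏ i ∈ s, (C (P i) * X + C (Q i))).coeff s.card = ∏ i ∈ s, P i := by
  have := coeff_prod_of_natDegree_le (s := s) (fun i => C (P i) * X + C (Q i)) 1
    fun i _ => natDegree_linear_le
  rw [mul_one] at this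
  rw [this]
  refine Finset.prod_congr rfl fun i _ => ?_
  simp

/-- Every integer polynomial with given nonzero discriminant has a translate with bounded
coefficients. -/
theorem exists_glTranslate_coeff_le {D : ℤ} (hD : D ≠ 0) {n : ℕ} (hn : 2 ≤ n) :
    ∃ K : ℝ, ∀ f S, HasRootsAndDisc f S D → S.card = n →
      ∃ M : Matrix (Fin 2) (Fin 2) ℤ, IsUnit M.det ∧ (glTranslate n f M).natDegree ≤ n ∧
        ∀ k, |((glTranslate n f M).coeff k : ℝ)| ≤ K := by
  obtain ⟨B, hB1, hB⟩ := exists_isBalanced hD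
  refine ⟨(2 * (B ^ (2 * n) * (n * B) ^ 2 + 1)) ^ n, fun f S hf hcard => ?_⟩
  subst hcard
  obtain ⟨v, hv⟩ := hB f S hf hn
  have hu := hv.symmetrize (by linarith) fun z hz => hf.conj_mem hz
  obtain ⟨p, q, r, s, hdet, hred⟩ := hu.exists_isReducedFamily (fun z hz => hf.conj_mem hz)
    (fun z => by simp only [Complex.conj_conj, mul_comm]) hn
  set u : ℂ → ℝ := fun z => √(v z * v (starRingEnd ℂ z))
  set g := glTranslate S.card f !![p, q; r, s] with hg
  set P : ℂ → ℂ := fun z => u z * (p - z * r) with hP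
  set Q : ℂ → ℂ := fun z => u z * (q - z * s) with hQ
  have hmap := hf.roots.map_glTranslate p q r s
  have hprod : ∏ z ∈ S, (C (P z) * X + C (Q z)) = C ((∏ z ∈ S, u z : ℝ) : ℂ) *
      ∏ z ∈ S, (C ((p : ℂ) - z * r) * X + C ((q : ℂ) - z * s)) := by
    rw [Complex.ofReal_prod, C_eq_algebraMap, map_prod, ← Finset.prod_mul_distrib]
    refine Finset.prod_congr rfl fun z _ => ?_
    rw [← C_eq_algebraMap, hP, hQ, C_mul, C_mul]
    ring
  have hnorm : ∀ k, ‖(∏ z ∈ S, (C (P z) * X + C (Q z))).coeff k‖ = |(g.coeff k : ℝ)| := by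
    intro k
    have h1 : ((g.coeff k : ℤ) : ℂ) = (g.map (Int.castRingHom ℂ)).coeff k := by
      rw [coeff_map, eq_intCast]
    rw [← Complex.norm_intCast, h1, hmap, hprod, coeff_C_mul, coeff_C_mul, norm_mul, norm_mul,
      hu.prod_eq, Complex.norm_real, Complex.norm_intCast, Real.norm_eq_abs, abs_abs]
  have hint : ∀ k, (∏ z ∈ S, (C (P z) * X + C (Q z))).coeff k ≠ 0 →
      1 ≤ ‖(∏ z ∈ S, (C (P z) * X + C (Q z))).coeff k‖ := by
    intro k hk
    have h1 := norm_pos_iff.mpr hk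
    rw [hnorm, abs_pos] at h1
    rw [hnorm]
    exact_mod_cast Int.one_le_abs (by exact_mod_cast h1)
  refine ⟨!![p, q; r, s], by simpa [Matrix.det_fin_two] using hdet, ?_, fun k => ?_⟩
  · rw [← natDegree_map_eq_of_injective (f := Int.castRingHom ℂ) Int.cast_injective, hmap]
    refine (natDegree_C_mul_le _ _).trans ((natDegree_prod_le _ _).trans
      ((Finset.sum_le_card_nsmul _ _ 1 fun z _ => natDegree_linear_le).trans (by simp)))
  · rw [← hnorm]
    refine (norm_coeff_prod_le S P Q k).trans (hred.prod_le hB1 hn (fun h0 => ?_)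
      fun o ho hPo h0 => ?_)
    · have h1 := hint S.card
      rw [coeff_card_prod, norm_prod] at h1
      exact h1 (Finset.prod_ne_zero_iff.mpr h0)
    · have h1 := hint (S.erase o).card
      rw [← Finset.mul_prod_erase S _ ho, hPo, C_0, zero_mul, zero_add, coeff_C_mul,
        coeff_card_prod, norm_mul, norm_prod] at h1
      refine h1 (mul_ne_zero (fun hQo => ?_) (Finset.prod_ne_zero_iff.mpr h0))
      obtain ⟨w, hw⟩ : (S.erase o).Nonempty :=
        Finset.card_pos.mp (by rw [Finset.card_erase_of_mem ho]; omega)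
      have h2 := hred.one_le o ho w (Finset.mem_of_mem_erase hw) (Finset.ne_of_mem_erase hw).symm
      rw [hPo, hQo, zero_mul, mul_zero, sub_zero, norm_zero, mul_zero] at h2
      exact absurd h2 (by norm_num)

theorem finite_setOf_natDegree_le_of_coeff_le (n : ℕ) (K : ℝ) :
    {g : ℤ[X] | g.natDegree ≤ n ∧ ∀ k, |(g.coeff k : ℝ)| ≤ K}.Finite := by
  refine ((Set.finite_Icc (fun _ : Fin (n + 1) => -⌈K⌉) fun _ => ⌈K⌉).image
    fun c => ∑ i : Fin (n + 1), C (c i) * X ^ (i : ℕ)).subset fun g hg => ?_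
  refine ⟨fun i => g.coeff i, ⟨fun i => ?_, fun i => ?_⟩, ?_⟩
  · have := (hg.2 i).trans (Int.le_ceil K)
    have h := (abs_le.mp this).1
    exact_mod_cast h
  · have := (hg.2 i).trans (Int.le_ceil K)
    have h := (abs_le.mp this).2
    exact_mod_cast h
  · dsimp only
    rw [Fin.sum_univ_eq_sum_range fun i => C (g.coeff i) * X ^ i]
    exact (g.as_sum_range_C_mul_X_pow' (by have := hg.1; omega)).symm

/-- polynomials in ℤ[X] of given degree `n ≥ 2` and given nonzero
discriminant `D` lie in finitely many `GL₂(ℤ)`-equivalence classes. -/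
theorem finitely_many_gl2_classes (n : ℕ) (hn : 2 ≤ n) (D : ℤ) (hD : D ≠ 0) :
    ∃ S : Finset (Polynomial ℤ), ∀ f : Polynomial ℤ,
      f.natDegree = n → discC f = (D : ℂ) → ∃ g ∈ S, GL2Equiv n f g := by
  obtain ⟨K, hK⟩ := exists_glTranslate_coeff_le hD hn
  refine ⟨(finite_setOf_natDegree_le_of_coeff_le n K).toFinset, fun f hf hdisc => ?_⟩
  have h0 : f ≠ 0 := by
    rintro rfl
    rw [natDegree_zero] at hf
    omega
  obtain ⟨S, hS, hSD⟩ := exists_hasSimpleRoots hD hdisc h0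
  obtain ⟨M, hM, hdeg, hcoeff⟩ := hK f S ⟨h0, hS, hSD⟩ ((hS.card_eq h0).trans hf)
  exact ⟨glTranslate n f M, (Set.Finite.mem_toFinset _).mpr ⟨hdeg, hcoeff⟩, M, hM, Or.inl rfl⟩
end

section
/- For every integer n ≥ 2 and every nonzero integer D, there exists a finite set S ⊆ ℤ[X] such that every polynomial f ∈ ℤ[X] of degree n with discriminant D(f) = D is Hermite equivalent to some polynomial in S. (Equivalently: the polynomials in ℤ[X] of given degree n and given nonzero discriminant D lie in only finitely many Hermite equivalence classes.) -/
open Polynomial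

open Matrix

/-- Every positive definite form is unimodularly equivalent to one that is, up to the constant `C`,
diagonal with weights `d`: its diagonal entries are at most `C * d i` and its inverse `H` satisfies
`|H i j| ≤ C / d i`. -/
def HasReducedBasis (ι : Type) [Fintype ι] [DecidableEq ι] (C : ℝ) : Prop :=
  ∀ G : Matrix ι ι ℝ, G.PosDef → ∃ (U : Matrix ι ι ℤ) (d : ι → ℝ) (H : Matrix ι ι ℝ),
    IsUnit U.det ∧ (∀ i, 0 < d i) ∧
    ((U.map (Int.cast : ℤ → ℝ))ᵀ * G * U.map (Int.cast : ℤ → ℝ)) * H = 1 ∧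
    (∀ i, ((U.map (Int.cast : ℤ → ℝ))ᵀ * G * U.map (Int.cast : ℤ → ℝ)) i i ≤ C * d i) ∧
    ∀ i j, d i * |H i j| ≤ C

theorem HasReducedBasis.of_equiv {ι κ : Type} [Fintype ι] [DecidableEq ι] [Fintype κ]
    [DecidableEq κ] (e : ι ≃ κ) {C : ℝ} (h : HasReducedBasis ι C) : HasReducedBasis κ C := by
  intro G hG
  obtain ⟨U, d, H, hU, hd, hH, h1, h2⟩ := h (G.submatrix e e) (hG.submatrix e.injective)
  have key : ((U.submatrix e.symm e.symm).map (Int.cast : ℤ → ℝ))ᵀ * G *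
      (U.submatrix e.symm e.symm).map (Int.cast : ℤ → ℝ) =
      ((U.map (Int.cast : ℤ → ℝ))ᵀ * G.submatrix e e * U.map (Int.cast : ℤ → ℝ)).submatrix
        e.symm e.symm := by
    have : G = (G.submatrix e e).submatrix e.symm e.symm := by ext; simp
    conv_lhs => rw [this]
    rw [← submatrix_map, transpose_submatrix, submatrix_mul_equiv, submatrix_mul_equiv]
  refine ⟨U.submatrix e.symm e.symm, d ∘ e.symm, H.submatrix e.symm e.symm, ?_, ?_, ?_, ?_, ?_⟩
  · rwa [det_submatrix_equiv_self]
  · intro i; exact hd _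
  · rw [key, submatrix_mul_equiv, hH, submatrix_one_equiv]
  · intro i; rw [key]; exact h1 _
  · intro i j; exact h2 _ _

theorem Matrix.PosDef.exists_pos_le_of_int {ι : Type} [Fintype ι] {G : Matrix ι ι ℝ}
    (hG : G.PosDef) :
    ∃ ε > 0, ∀ x : ι → ℤ, x ≠ 0 →
      ε ≤ (fun i => (x i : ℝ)) ⬝ᵥ G *ᵥ (fun i => (x i : ℝ)) := by
  classical
  rcases isEmpty_or_nonempty ι with hι | hι
  · exact ⟨1, one_pos, fun x hx => (hx (Subsingleton.elim _ _)).elim⟩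
  have hcont : Continuous fun y : ι → ℝ => y ⬝ᵥ G *ᵥ y := by fun_prop
  obtain ⟨y, hy, hmin⟩ := (isCompact_sphere (0 : ι → ℝ) 1).exists_isMinOn
    (NormedSpace.sphere_nonempty.2 zero_le_one) hcont.continuousOn
  have hy0 : y ≠ 0 := by
    rintro rfl
    simp at hy
  refine ⟨y ⬝ᵥ G *ᵥ y, by simpa using hG.dotProduct_mulVec_pos hy0, fun x hx => ?_⟩
  set z : ι → ℝ := fun i => (x i : ℝ) with hz
  obtain ⟨i, hi⟩ := Function.ne_iff.1 hx
  have h1 : 1 ≤ ‖z‖ := by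
    refine le_trans ?_ (norm_le_pi_norm z i)
    rw [hz, Real.norm_eq_abs, ← Int.cast_abs]
    exact_mod_cast Int.one_le_abs hi
  have hz0 : ‖z‖ ≠ 0 := by positivity
  have h2 : ‖z‖⁻¹ • z ∈ Metric.sphere (0 : ι → ℝ) 1 := by
    simp [norm_smul, hz0]
  have h3 : y ⬝ᵥ G *ᵥ y ≤ (‖z‖⁻¹ • z) ⬝ᵥ G *ᵥ (‖z‖⁻¹ • z) := hmin h2
  have h4 : z ⬝ᵥ G *ᵥ z = ‖z‖ ^ 2 * ((‖z‖⁻¹ • z) ⬝ᵥ G *ᵥ (‖z‖⁻¹ • z)) := by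
    simp only [mulVec_smul, dotProduct_smul, smul_dotProduct, smul_eq_mul]
    field_simp
  have h5 : 0 ≤ y ⬝ᵥ G *ᵥ y := by simpa using (hG.dotProduct_mulVec_pos hy0).le
  rw [h4]
  nlinarith [one_le_pow₀ h1 (n := 2)]

theorem Matrix.PosDef.exists_almost_minimal {ι : Type} [Fintype ι] [DecidableEq ι]
    {G : Matrix ι ι ℝ} (hG : G.PosDef) (i₀ : ι) :
    ∃ U : Matrix ι ι ℤ, IsUnit U.det ∧ ∀ (V : Matrix ι ι ℤ) (i : ι), IsUnit V.det →
      ((U.map (Int.cast : ℤ → ℝ))ᵀ * G * U.map (Int.cast : ℤ → ℝ)) i₀ i₀ ≤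
        2 * ((V.map (Int.cast : ℤ → ℝ))ᵀ * G * V.map (Int.cast : ℤ → ℝ)) i i := by
  obtain ⟨ε, hε, h⟩ := hG.exists_pos_le_of_int
  let q : {V : Matrix ι ι ℤ // IsUnit V.det} → ℝ := fun V =>
    ((V.1.map (Int.cast : ℤ → ℝ))ᵀ * G * V.1.map (Int.cast : ℤ → ℝ)) i₀ i₀
  have hq : ∀ V, ε ≤ q V := by
    intro V
    have hx : (fun j => V.1 j i₀) ≠ 0 := by
      intro h0
      have := det_eq_zero_of_column_eq_zero i₀ (fun j => congrFun h0 j)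
      exact V.2.ne_zero this
    convert h _ hx using 1
    simp only [q, Matrix.mul_assoc]
    simp only [Matrix.mul_apply, dotProduct, mulVec, transpose_apply, map_apply]
  have hne : Nonempty {V : Matrix ι ι ℤ // IsUnit V.det} := ⟨⟨1, by simp⟩⟩
  have hpos : 0 < ⨅ V, q V := lt_of_lt_of_le hε (le_ciInf hq)
  obtain ⟨U, hU⟩ := exists_lt_of_ciInf_lt (show ⨅ V, q V < 2 * ⨅ V, q V by linarith)
  refine ⟨U.1, U.2, fun V i hV => hU.le.trans ?_⟩
  have hW : IsUnit (V.submatrix id (Equiv.swap i₀ i)).det := by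
    rw [det_permute']
    exact ((Equiv.Perm.sign (Equiv.swap i₀ i)).isUnit.map (Int.castRingHom ℤ)).mul hV
  have := ciInf_le (f := q) ⟨ε, by rintro _ ⟨V, rfl⟩; exact hq V⟩ ⟨_, hW⟩
  have h3 : q ⟨_, hW⟩ = ((V.map (Int.cast : ℤ → ℝ))ᵀ * G * V.map (Int.cast : ℤ → ℝ)) i i := by
    simp [q, Matrix.mul_apply]
  linarith

theorem HasReducedBasis.sum_unit {ι : Type} [Fintype ι] [DecidableEq ι] {C : ℝ} (hC : 1 ≤ C)
    (h : HasReducedBasis ι C) :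
    HasReducedBasis (Unit ⊕ ι)
      (1 + 2 * C + Fintype.card ι * C + 2 * Fintype.card ι * C ^ 2 +
        Fintype.card ι ^ 2 * C ^ 2) := by
  intro G hG
  obtain ⟨U₀, hU₀, hmin⟩ := hG.exists_almost_minimal (Sum.inl ())
  have hU₀det : (U₀.map (Int.cast : ℤ → ℝ)).det ≠ 0 := by
    have : (U₀.map (Int.cast : ℤ → ℝ)).det = ((U₀.det : ℤ) : ℝ) := (Int.cast_det U₀).symm
    rw [this]
    exact_mod_cast hU₀.ne_zero
  set G₁ := (U₀.map (Int.cast : ℤ → ℝ))ᵀ * G * U₀.map (Int.cast : ℤ → ℝ) with hG₁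
  have hG₁pos : G₁.PosDef := by
    have := hG.conjTranspose_mul_mul_same (B := U₀.map (Int.cast : ℤ → ℝ))
      (mulVec_injective_iff_isUnit.2 ((isUnit_iff_isUnit_det _).2 hU₀det.isUnit))
    rwa [conjTranspose_eq_transpose_of_trivial] at this
  set a := G₁ (Sum.inl ()) (Sum.inl ()) with ha
  have ha0 : 0 < a := hG₁pos.diag_pos
  set B := G₁.toBlocks₁₂ with hB
  set E := G₁.toBlocks₂₂ with hE
  have hblocks : G₁ = fromBlocks (a • 1) B Bᵀ E := by
    have h21 : G₁.toBlocks₂₁ = Bᵀ := by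
      ext i j
      have := hG₁pos.isHermitian.apply (Sum.inr i) (Sum.inl j)
      simpa [hB, toBlocks₂₁, toBlocks₁₂] using this.symm
    have h11 : G₁.toBlocks₁₁ = a • 1 := by
      ext i j
      simp [toBlocks₁₁, ha]
    rw [← h21, ← h11]
    exact (fromBlocks_toBlocks G₁).symm
  set S := E - a⁻¹ • (Bᵀ * B) with hS
  have hSpos : S.PosDef := by
    have := hG₁pos.conjTranspose_mul_mul_same (B := fromRows (-(a⁻¹ • B)) (1 : Matrix ι ι ℝ)) (by
      intro x y hxy
      funext i
      simpa [fromRows_mulVec] using congrFun hxy (Sum.inr i))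
    convert this using 1
    rw [hblocks, conjTranspose_eq_transpose_of_trivial, transpose_fromRows, Matrix.mul_assoc,
      fromBlocks_mul_fromRows, fromCols_mul_fromRows]
    simp [hS, smul_smul, ha0.ne']
    abel
  obtain ⟨V, d, H, hV, hd, hH, hdiag, hHbd⟩ := h S hSpos
  set V' := V.map (Int.cast : ℤ → ℝ) with hV'
  set S' := V'ᵀ * S * V' with hS'
  set k : Matrix Unit ι ℤ := of fun i j => round ((a⁻¹ • (B * V')) i j) with hk
  set μ : Matrix Unit ι ℝ := a⁻¹ • (B * V') - k.map (Int.cast : ℤ → ℝ) with hμ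
  have hμbd : ∀ i j, |μ i j| ≤ 1 / 2 := fun i j => abs_sub_round _
  set W : Matrix (Unit ⊕ ι) (Unit ⊕ ι) ℤ := fromBlocks 1 (-k) 0 V with hW
  have hWdet : IsUnit (U₀ * W).det := by
    rw [det_mul, hW, det_fromBlocks_zero₂₁, det_one, one_mul]
    exact hU₀.mul hV
  have hcast : (U₀ * W).map (Int.cast : ℤ → ℝ) =
      U₀.map (Int.cast : ℤ → ℝ) * W.map (Int.cast : ℤ → ℝ) :=
    Matrix.map_mul (f := Int.castRingHom ℝ)
  have hWcast : W.map (Int.cast : ℤ → ℝ) = fromBlocks 1 (-k.map (Int.cast : ℤ → ℝ)) 0 V' := by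
    rw [hW, fromBlocks_map]
    congr 1
    · ext; simp
    · ext; simp
    · ext; simp
  have hG' : ((U₀ * W).map (Int.cast : ℤ → ℝ))ᵀ * G * (U₀ * W).map (Int.cast : ℤ → ℝ) =
      fromBlocks (a • 1) (a • μ) (a • μᵀ) (S' + a • (μᵀ * μ)) := by
    have hBV : B * V' = a • (μ + k.map (Int.cast : ℤ → ℝ)) := by
      rw [hμ, sub_add_cancel, smul_smul, mul_inv_cancel₀ ha0.ne', one_smul]
    have hBVt : V'ᵀ * Bᵀ = a • (μᵀ + (k.map (Int.cast : ℤ → ℝ))ᵀ) := by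
      rw [← transpose_mul, hBV, transpose_smul, transpose_add]
    have hEV : V'ᵀ * E * V' = S' + a • ((μᵀ + (k.map (Int.cast : ℤ → ℝ))ᵀ) *
        (μ + k.map (Int.cast : ℤ → ℝ))) := by
      have : a • ((μᵀ + (k.map (Int.cast : ℤ → ℝ))ᵀ) * (μ + k.map (Int.cast : ℤ → ℝ))) =
          a⁻¹ • ((V'ᵀ * Bᵀ) * (B * V')) := by
        rw [hBV, hBVt, Matrix.smul_mul, Matrix.mul_smul, smul_smul, smul_smul,
          inv_mul_cancel₀ ha0.ne', one_mul]
      rw [this, hS', hS, Matrix.mul_sub, Matrix.sub_mul]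
      simp [Matrix.mul_assoc]
    have : ((U₀ * W).map (Int.cast : ℤ → ℝ))ᵀ * G * (U₀ * W).map (Int.cast : ℤ → ℝ) =
        (W.map (Int.cast : ℤ → ℝ))ᵀ * G₁ * W.map (Int.cast : ℤ → ℝ) := by
      rw [hcast, transpose_mul, hG₁]
      simp only [Matrix.mul_assoc]
    rw [this, hWcast, hblocks, fromBlocks_transpose, fromBlocks_multiply, fromBlocks_multiply]
    congr 1
    · simp
    · simp [hBV]
    · simp [hBVt]
    · have e1 : (-k.map (Int.cast : ℤ → ℝ))ᵀ * B * V' =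
          (-k.map (Int.cast : ℤ → ℝ))ᵀ * (B * V') := Matrix.mul_assoc _ _ _
      simp only [Matrix.add_mul, e1, hEV, hBV, hBVt]
      simp [Matrix.mul_add, Matrix.add_mul]
      abel
  have hdiag' : ∀ j, S' j j + a * μ () j ^ 2 = (fromBlocks (a • 1) (a • μ) (a • μᵀ)
      (S' + a • (μᵀ * μ))) (Sum.inr j) (Sum.inr j) := by
    intro j
    simp [Matrix.mul_apply, sq]
  have hμsq : ∀ j, μ () j ^ 2 ≤ 1 / 4 := by
    intro j
    have := hμbd () j
    rw [← sq_abs]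
    nlinarith [abs_nonneg (μ () j)]
  have had : ∀ j, a ≤ 4 * C * d j := by
    intro j
    have h1 := hmin (U₀ * W) (Sum.inr j) hWdet
    rw [hG', ← hdiag' j] at h1
    nlinarith [hdiag j, hμsq j]
  have hC0 : 0 ≤ C := by linarith
  have hn : (0 : ℝ) ≤ Fintype.card ι := Nat.cast_nonneg _
  refine ⟨U₀ * W, Sum.elim (fun _ => a) d,
    fromBlocks (a⁻¹ • 1 + μ * H * μᵀ) (-(μ * H)) (-(H * μᵀ)) H, hWdet, ?_, ?_, ?_, ?_⟩
  · rintro (i | i)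
    · exact ha0
    · exact hd i
  · rw [hG', fromBlocks_multiply, ← fromBlocks_one]
    congr 1
    · simp [smul_smul, ha0.ne', Matrix.mul_assoc]
    · simp
    · have e1 : S' * (H * μᵀ) = μᵀ := by rw [← Matrix.mul_assoc, hH, Matrix.one_mul]
      simp [Matrix.mul_add, Matrix.add_mul, smul_smul, ha0.ne', Matrix.mul_assoc, e1]
    · simp [Matrix.add_mul, hH, Matrix.mul_assoc]
  · rw [hG']
    rintro (i | j)
    · simp
      nlinarith [mul_nonneg hn hC0, mul_nonneg hn (sq_nonneg C), sq_nonneg (Fintype.card ι * C)]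
    · rw [← hdiag' j]
      have : S' j j + a * μ () j ^ 2 ≤ 2 * C * d j := by nlinarith [hdiag j, hμsq j, had j]
      simp only [Sum.elim_inr]
      nlinarith [mul_nonneg hn hC0, mul_nonneg hn (sq_nonneg C), sq_nonneg (Fintype.card ι * C),
        hd j, mul_nonneg (mul_nonneg hn hC0) (hd j).le,
        mul_nonneg (mul_nonneg hn (sq_nonneg C)) (hd j).le,
        mul_nonneg (sq_nonneg (Fintype.card ι * C)) (hd j).le]
  · have hterm : ∀ i j, a * (|μ () i| * |H i j|) ≤ 2 * C ^ 2 := by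
      intro i j
      have h1 := had i
      have h2 := hHbd i j
      have h3 := hμbd () i
      have h4 := (hd i).le
      calc a * (|μ () i| * |H i j|) ≤ (4 * C * d i) * ((1 / 2) * |H i j|) := by gcongr
        _ = 2 * C * (d i * |H i j|) := by ring
        _ ≤ 2 * C * C := by gcongr
        _ = _ := by ring
    have hrow : ∀ j, a * |(μ * H) () j| ≤ 2 * Fintype.card ι * C ^ 2 := by
      intro j
      calc a * |(μ * H) () j| ≤ a * ∑ i, |μ () i| * |H i j| := by
            rw [Matrix.mul_apply]
            gcongr
            refine (Finset.abs_sum_le_sum_abs _ _).trans_eq ?_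
            simp [abs_mul]
        _ = ∑ i, a * (|μ () i| * |H i j|) := Finset.mul_sum _ _ _
        _ ≤ ∑ _i : ι, 2 * C ^ 2 := Finset.sum_le_sum fun i _ => hterm i j
        _ = _ := by simp; ring
    have hnC := mul_nonneg hn hC0
    have hnC2 := mul_nonneg hn (sq_nonneg C)
    have hn2C2 := sq_nonneg (Fintype.card ι * C)
    rintro (i | i) (j | j)
    · simp only [Sum.elim_inl, fromBlocks_apply₁₁]
      calc a * |(a⁻¹ • (1 : Matrix Unit Unit ℝ) + μ * H * μᵀ) i j|
          ≤ a * (a⁻¹ + ∑ l, |(μ * H) () l| * (1 / 2)) := by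
            gcongr
            rw [Matrix.add_apply, Matrix.mul_apply]
            refine (abs_add_le _ _).trans (add_le_add ?_ ?_)
            · simp [abs_of_pos ha0]
            · refine (Finset.abs_sum_le_sum_abs _ _).trans (Finset.sum_le_sum fun l _ => ?_)
              rw [abs_mul]
              exact mul_le_mul_of_nonneg_left (hμbd _ _) (abs_nonneg _)
        _ = 1 + ∑ l, a * |(μ * H) () l| * (1 / 2) := by
            rw [mul_add, mul_inv_cancel₀ ha0.ne', Finset.mul_sum]
            simp [mul_assoc]
        _ ≤ 1 + ∑ _l : ι, (2 * Fintype.card ι * C ^ 2) * (1 / 2) := by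
            refine add_le_add le_rfl (Finset.sum_le_sum fun l _ => ?_)
            exact mul_le_mul_of_nonneg_right (hrow l) (by norm_num)
        _ = 1 + Fintype.card ι ^ 2 * C ^ 2 := by simp; ring
        _ ≤ _ := by nlinarith
    · simp only [Sum.elim_inl, fromBlocks_apply₁₂, Matrix.neg_apply, abs_neg]
      have := hrow j
      nlinarith
    · simp only [Sum.elim_inr, fromBlocks_apply₂₁, Matrix.neg_apply, abs_neg]
      have : d i * |(H * μᵀ) i j| ≤ Fintype.card ι * C := by
        calc d i * |(H * μᵀ) i j| ≤ d i * ∑ l, |H i l| * |μ () l| := by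
              rw [Matrix.mul_apply]
              have := (hd i).le
              gcongr
              refine (Finset.abs_sum_le_sum_abs _ _).trans_eq ?_
              simp [abs_mul]
          _ = ∑ l, (d i * |H i l|) * |μ () l| := by
              rw [Finset.mul_sum]; simp [mul_assoc]
          _ ≤ ∑ _l : ι, C * 1 := by
              gcongr with l
              · exact hHbd i l
              · linarith [hμbd () l]
          _ = _ := by simp
      nlinarith
    · simp only [Sum.elim_inr, fromBlocks_apply₂₂]
      have := hHbd i j
      nlinarith

theorem exists_hasReducedBasis (n : ℕ) : ∃ C, 1 ≤ C ∧ HasReducedBasis (Fin n) C := by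
  induction n with
  | zero =>
    refine ⟨1, le_rfl, fun G _ => ⟨1, 1, 1, by simp, fun i => i.elim0, ?_, fun i => i.elim0,
      fun i => i.elim0⟩⟩
    exact Subsingleton.elim _ _
  | succ n ih =>
    obtain ⟨C, hC, h⟩ := ih
    refine ⟨_, ?_, (h.sum_unit hC).of_equiv
      (Fintype.equivFinOfCardEq (by simp [add_comm]))⟩
    have : (0 : ℝ) ≤ Fintype.card (Fin n) := Nat.cast_nonneg _
    have : 0 ≤ C := by linarith
    nlinarith [show 0 ≤ Fintype.card (Fin n) * C + 2 * Fintype.card (Fin n) * C ^ 2 +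
        Fintype.card (Fin n) ^ 2 * C ^ 2 by positivity]

/-- The product of the linear forms whose coefficients are the rows of `L`. -/
noncomputable def prodLinearForms {n : ℕ} (L : Matrix (Fin n) (Fin n) ℂ) :
    MvPolynomial (Fin n) ℂ :=
  ∏ i, ∑ j, MvPolynomial.C (L i j) * MvPolynomial.X j

/-- The exponent vector of the monomial `∏ i, X (φ i)`. -/
noncomputable def monomialOf {n : ℕ} (φ : Fin n → Fin n) : Fin n →₀ ℕ :=
  ∑ i, Finsupp.single (φ i) 1

theorem prod_comp_eq_prod_pow_monomialOf {R : Type*} [CommMonoid R] {n : ℕ}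
    (φ : Fin n → Fin n) (b : Fin n → R) :
    ∏ i, b (φ i) = ∏ j, b j ^ monomialOf φ j := by
  simp only [monomialOf, Finsupp.finsetSum_apply, ← Finset.prod_pow_eq_pow_sum]
  rw [Finset.prod_comm]
  refine Finset.prod_congr rfl fun i _ => ?_
  rw [Finset.prod_eq_single (φ i)]
  · simp
  · intro j _ hj
    simp [hj.symm]
  · simp

theorem coeff_prodLinearForms {n : ℕ} (L : Matrix (Fin n) (Fin n) ℂ) (m : Fin n →₀ ℕ) :
    (prodLinearForms L).coeff m =
      ∑ φ : Fin n → Fin n, if monomialOf φ = m then ∏ i, L i (φ i) else 0 := by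
  classical
  rw [prodLinearForms, Finset.prod_univ_sum, Fintype.piFinset_univ, MvPolynomial.coeff_sum]
  refine Finset.sum_congr rfl fun φ _ => ?_
  rw [Finset.prod_mul_distrib, ← map_prod, MvPolynomial.coeff_C_mul]
  have : ∏ i, (MvPolynomial.X (φ i) : MvPolynomial (Fin n) ℂ) =
      MvPolynomial.monomial (monomialOf φ) 1 := by
    rw [monomialOf, MvPolynomial.monomial_sum_one]
    rfl
  rw [this, MvPolynomial.coeff_monomial]
  split_ifs <;> simp

theorem coeff_prodLinearForms_eq_zero {n : ℕ} (L : Matrix (Fin n) (Fin n) ℂ) {m : Fin n →₀ ℕ}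
    (hm : m ∉ Set.range (monomialOf (n := n))) : (prodLinearForms L).coeff m = 0 := by
  rw [coeff_prodLinearForms]
  exact Finset.sum_eq_zero fun φ _ => if_neg fun h => hm ⟨φ, h⟩

theorem coeff_prodLinearForms_mul {n : ℕ} (L : Matrix (Fin n) (Fin n) ℂ) (r t : Fin n → ℂ)
    (m : Fin n →₀ ℕ) :
    (prodLinearForms (of fun i j => r i * L i j * t j)).coeff m =
      (∏ i, r i) * (prodLinearForms L).coeff m * ∏ j, t j ^ m j := by
  rw [coeff_prodLinearForms, coeff_prodLinearForms, Finset.mul_sum, Finset.sum_mul]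
  refine Finset.sum_congr rfl fun φ _ => ?_
  split_ifs with h
  · rw [← h, ← prod_comp_eq_prod_pow_monomialOf]
    simp [Finset.prod_mul_distrib]
  · simp

theorem norm_coeff_prodLinearForms_le {n : ℕ} (L : Matrix (Fin n) (Fin n) ℂ)
    (s b : Fin n → ℝ) (hb : ∀ j, 0 ≤ b j) (hs : ∀ i, 0 ≤ s i)
    (hL : ∀ i j, ‖L i j‖ ≤ s i * b j) (m : Fin n →₀ ℕ) :
    ‖(prodLinearForms L).coeff m‖ ≤ n ^ n * ((∏ i, s i) * ∏ j, b j ^ m j) := by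
  have h0 : 0 ≤ (∏ i, s i) * ∏ j, b j ^ m j :=
    mul_nonneg (Finset.prod_nonneg fun i _ => hs i)
      (Finset.prod_nonneg fun j _ => pow_nonneg (hb j) _)
  rw [coeff_prodLinearForms]
  calc _ ≤ ∑ φ : Fin n → Fin n, (∏ i, s i) * ∏ j, b j ^ m j := by
        refine norm_sum_le_of_le _ fun φ _ => ?_
        split_ifs with h
        · rw [← h, ← prod_comp_eq_prod_pow_monomialOf, norm_prod, ← Finset.prod_mul_distrib]
          exact Finset.prod_le_prod (fun i _ => norm_nonneg _) fun i _ => hL i _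
        · simpa using h0
    _ = _ := by simp

/-- The norms of the factors of a product of linear forms are controlled by its coefficients. -/
theorem exists_prod_norm_le_of_coeff_le (n : ℕ) : ∃ c : ℝ, 0 ≤ c ∧
    ∀ (L : Matrix (Fin n) (Fin n) ℂ) (K : ℝ), 0 ≤ K →
      (∀ m, ‖(prodLinearForms L).coeff m‖ ≤ K) → ∏ i, ‖L i‖ ≤ c * K := by
  classical
  let h : (Fin n → Fin n → ℂ) → ℝ := fun v =>
    ∑ φ : Fin n → Fin n, ‖(prodLinearForms (of v)).coeff (monomialOf φ)‖
  have hcont : Continuous h := by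
    refine continuous_finsetSum _ fun φ _ => Continuous.norm ?_
    simp only [coeff_prodLinearForms]
    refine continuous_finsetSum _ fun ψ _ => ?_
    split_ifs
    · simp only [of_apply]
      fun_prop
    · exact continuous_const
  have hK : IsCompact (Set.univ.pi fun _ : Fin n => Metric.sphere (0 : Fin n → ℂ) 1) :=
    isCompact_univ_pi fun _ => isCompact_sphere _ _
  have hne : (Set.univ.pi fun _ : Fin n => Metric.sphere (0 : Fin n → ℂ) 1).Nonempty := by
    refine ⟨fun i => Pi.single i 1, fun i _ => ?_⟩
    rw [mem_sphere_zero_iff_norm, Pi.norm_single, norm_one]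
  obtain ⟨v₀, hv₀, hmin⟩ := hK.exists_isMinOn hne hcont.continuousOn
  have hpos : 0 < h v₀ := by
    refine lt_of_le_of_ne (Finset.sum_nonneg fun _ _ => norm_nonneg _) fun h0 => ?_
    have hz : prodLinearForms (of v₀) = 0 := by
      ext m
      by_cases hm : m ∈ Set.range (monomialOf (n := n))
      · obtain ⟨φ, rfl⟩ := hm
        have := (Finset.sum_eq_zero_iff_of_nonneg fun _ _ => norm_nonneg _).1 h0.symm φ
          (Finset.mem_univ _)
        simpa using this
      · simpa using coeff_prodLinearForms_eq_zero _ hm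
    obtain ⟨i, -, hi⟩ := Finset.prod_eq_zero_iff.1 hz
    have hvi : v₀ i = 0 := by
      funext j
      have := congrArg (MvPolynomial.coeff (Finsupp.single j 1)) hi
      simpa [MvPolynomial.coeff_sum, MvPolynomial.coeff_C_mul, MvPolynomial.coeff_X,
        Finsupp.single_left_inj] using this
    have := hv₀ i (Set.mem_univ _)
    simp [hvi] at this
  refine ⟨n ^ n / h v₀, by positivity, fun L K hK0 hL => ?_⟩
  by_cases hrow : ∃ i, L i = 0
  · obtain ⟨i, hi⟩ := hrow
    rw [Finset.prod_eq_zero (Finset.mem_univ i) (by simp [hi])]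
    positivity
  push Not at hrow
  let v : Fin n → Fin n → ℂ := fun i => (‖L i‖⁻¹ : ℂ) • L i
  have hv : v ∈ Set.univ.pi fun _ : Fin n => Metric.sphere (0 : Fin n → ℂ) 1 := by
    intro i _
    have : ‖L i‖ ≠ 0 := norm_ne_zero_iff.2 (hrow i)
    simp [v, norm_smul, this]
  have hLv : L = of fun i j => (‖L i‖ : ℂ) * (of v) i j * 1 := by
    ext i j
    have : (‖L i‖ : ℂ) ≠ 0 := by exact_mod_cast norm_ne_zero_iff.2 (hrow i)
    simp [v, this]
  have h1 : (∏ i, ‖L i‖) * h v ≤ n ^ n * K := by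
    have h2 : ∀ φ : Fin n → Fin n, (∏ i, ‖L i‖) *
        ‖(prodLinearForms (of v)).coeff (monomialOf φ)‖ ≤ K := by
      intro φ
      have := hL (monomialOf φ)
      rw [hLv, coeff_prodLinearForms_mul (of v) (fun i => (‖L i‖ : ℂ)) (fun _ => 1)] at this
      simpa using this
    calc (∏ i, ‖L i‖) * h v = ∑ φ : Fin n → Fin n, (∏ i, ‖L i‖) *
          ‖(prodLinearForms (of v)).coeff (monomialOf φ)‖ := Finset.mul_sum _ _ _
      _ ≤ ∑ _φ : Fin n → Fin n, K := Finset.sum_le_sum fun φ _ => h2 φ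
      _ = _ := by simp
  have h3 : (∏ i, ‖L i‖) * h v₀ ≤ (∏ i, ‖L i‖) * h v :=
    mul_le_mul_of_nonneg_left (hmin hv) (Finset.prod_nonneg fun _ _ => norm_nonneg _)
  rw [div_mul_eq_mul_div, le_div_iff₀ hpos]
  exact h3.trans h1

theorem norm_det_le {n : ℕ} (M : Matrix (Fin n) (Fin n) ℂ) :
    ‖M.det‖ ≤ n.factorial * ∏ i, ‖M i‖ := by
  rw [det_apply']
  calc _ ≤ ∑ _σ : Equiv.Perm (Fin n), ∏ i, ‖M i‖ := by
        refine norm_sum_le_of_le _ fun σ _ => ?_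
        have h1 : ‖((Equiv.Perm.sign σ : ℤ) : ℂ)‖ = 1 := by
          rcases Int.units_eq_one_or (Equiv.Perm.sign σ) with h | h <;> simp [h]
        rw [norm_mul, h1, one_mul, norm_prod, ← Equiv.prod_comp σ (fun i => ‖M i‖)]
        exact Finset.prod_le_prod (fun i _ => norm_nonneg _) fun i _ => norm_le_pi_norm _ _
    _ = _ := by simp [Fintype.card_perm]

theorem norm_adjugate_apply_le {n : ℕ} (M : Matrix (Fin n) (Fin n) ℂ) (i j : Fin n) :
    ‖M.adjugate i j‖ ≤ n.factorial * ∏ k ∈ Finset.univ.erase j, ‖M k‖ := by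
  rw [adjugate_apply]
  refine (norm_det_le _).trans_eq ?_
  rw [← Finset.mul_prod_erase _ _ (Finset.mem_univ j), updateRow_self]
  congr 1
  have : ‖(Pi.single i 1 : Fin n → ℂ)‖ = 1 := by
    rw [Pi.norm_single, norm_one]
  rw [this, one_mul]
  exact Finset.prod_congr rfl fun k hk => by rw [updateRow_ne (Finset.ne_of_mem_erase hk)]

open scoped ComplexOrder in
theorem posDef_of_map_ofReal_eq {n : ℕ} {L : Matrix (Fin n) (Fin n) ℂ} (hL : L.det ≠ 0)
    {G : Matrix (Fin n) (Fin n) ℝ} (hG : G.map (Complex.ofReal) = Lᴴ * L) : G.PosDef := by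
  have hpos : (Lᴴ * L).PosDef := PosDef.conjTranspose_mul_self L
    (mulVec_injective_iff_isUnit.2 ((isUnit_iff_isUnit_det _).2 hL.isUnit))
  refine .of_dotProduct_mulVec_pos ?_ fun x hx => ?_
  · ext i j
    have := hpos.isHermitian.apply i j
    rw [← hG] at this
    simpa using this
  · have hx' : (fun i => (x i : ℂ)) ≠ 0 := by
      intro h
      exact hx (funext fun i => by simpa using congrFun h i)
    have := hpos.dotProduct_mulVec_pos hx'
    rw [← hG] at this
    have e : star (fun i => (x i : ℂ)) ⬝ᵥ G.map Complex.ofReal *ᵥ (fun i => (x i : ℂ)) =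
        ((star x ⬝ᵥ G *ᵥ x : ℝ) : ℂ) := by
      simp [dotProduct, mulVec]
    rw [e] at this
    exact_mod_cast this

theorem prod_prod_erase {n : ℕ} (f : Fin n → ℝ) :
    ∏ i, ∏ k ∈ Finset.univ.erase i, f k = (∏ k, f k) ^ (n - 1) := by
  rw [Finset.prod_comm' (t' := Finset.univ) (s' := fun k => Finset.univ.erase k)
    (by simp [eq_comm])]
  simp [Finset.prod_pow]

/-- A factorization of `L` through bounded data whose entries are controlled by weights `a`:
if the form `∏ L` has integral coefficients, and `L * H` is the inverse of `Lᴴ` with the rows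
of `H` controlled by `a⁻²`, then the coefficients of the form are bounded. -/
theorem exists_coeff_bound_of_reduced (n : ℕ) (C δ : ℝ) (hC : 1 ≤ C) (hδ : 0 < δ) :
    ∃ K : ℝ, ∀ (L H : Matrix (Fin n) (Fin n) ℂ) (d : Fin n → ℝ), ‖L.det‖ = δ →
      (∀ m, ∃ z : ℤ, (prodLinearForms L).coeff m = z) → (∀ j, 0 < d j) →
      Lᴴ * (L * H) = 1 → (∀ i j, ‖L i j‖ ^ 2 ≤ C * d j) → (∀ i j, d i * ‖H i j‖ ≤ C) →
      ∀ m, ‖(prodLinearForms L).coeff m‖ ≤ K := by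
  obtain ⟨c, hc0, hc⟩ := exists_prod_norm_le_of_coeff_le n
  have hC0 : 0 ≤ C := by linarith
  set C₁ : ℝ := n ^ n * C ^ n with hC₁
  have hC₁0 : 0 ≤ C₁ := by positivity
  refine ⟨n ^ n * ((δ * n.factorial) ^ n * ((n * C) ^ n * (c * C₁ ^ 2)) ^ (n - 1)),
    fun L H d hdet hint hd hLH hLd hHd m => ?_⟩
  set a : Fin n → ℝ := fun j => √(d j) with ha
  have ha0 : ∀ j, 0 < a j := fun j => Real.sqrt_pos.2 (hd j)
  have hasq : ∀ j, a j ^ 2 = d j := fun j => Real.sq_sqrt (hd j).le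
  have hLa : ∀ i j, ‖L i j‖ ≤ C * a j := by
    intro i j
    refine abs_le_of_sq_le_sq' ?_ (mul_nonneg hC0 (ha0 j).le) |>.2
    rw [mul_pow, hasq]
    nlinarith [hLd i j, mul_le_mul_of_nonneg_right hC (mul_nonneg hC0 (hd j).le)]
  have hcoeff : ∀ m, ‖(prodLinearForms L).coeff m‖ ≤ C₁ * ∏ j, a j ^ m j := by
    intro m
    refine (norm_coeff_prodLinearForms_le L (fun _ => C) a (fun j => (ha0 j).le)
      (fun _ => hC0) hLa m).trans_eq ?_
    simp [hC₁, mul_assoc]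
  set N : Matrix (Fin n) (Fin n) ℂ := of fun i j => 1 * L i j * ((d j : ℂ)⁻¹) with hN
  have hNcoeff : ∀ m, ‖(prodLinearForms N).coeff m‖ ≤ C₁ ^ 2 := by
    intro m
    have hP : 0 < ∏ j, a j ^ m j := Finset.prod_pos fun j _ => pow_pos (ha0 j) _
    have e : ‖(prodLinearForms N).coeff m‖ =
        ‖(prodLinearForms L).coeff m‖ / (∏ j, a j ^ m j) ^ 2 := by
      rw [hN, coeff_prodLinearForms_mul L (fun _ => 1), div_eq_mul_inv, ← Finset.prod_pow,
        ← Finset.prod_inv_distrib]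
      simp only [Finset.prod_const_one, one_mul, norm_mul, norm_prod]
      congr 1
      refine Finset.prod_congr rfl fun j _ => ?_
      rw [← pow_mul, mul_comm (m j), pow_mul, hasq]
      simp [abs_of_pos (hd j)]
    rw [e]
    obtain ⟨z, hz⟩ := hint m
    rcases eq_or_ne z 0 with rfl | hz0
    · rw [hz]
      simp
      positivity
    · have h1 : 1 ≤ ‖(prodLinearForms L).coeff m‖ := by
        rw [hz, Complex.norm_intCast]
        exact_mod_cast Int.one_le_abs hz0
      have h2 := hcoeff m
      rw [div_le_iff₀ (by positivity)]
      nlinarith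
  have hNprod : ∏ i, ‖N i‖ ≤ c * C₁ ^ 2 := hc N _ (sq_nonneg _) hNcoeff
  set M := L * H with hM
  have hMrow : ∀ i, ‖M i‖ ≤ n * C * ‖N i‖ := by
    intro i
    refine (pi_norm_le_iff_of_nonneg (by positivity)).2 fun j => ?_
    rw [hM, Matrix.mul_apply]
    calc _ ≤ ∑ _k : Fin n, C * ‖N i‖ := by
          refine norm_sum_le_of_le _ fun k _ => ?_
          have e : L i k * H k j = (d k * H k j) * N i k := by
            have : (d k : ℂ) ≠ 0 := by exact_mod_cast (hd k).ne'
            simp [hN]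
            field_simp
          rw [e, norm_mul]
          refine mul_le_mul ?_ (norm_le_pi_norm _ _) (norm_nonneg _) hC0
          simpa [abs_of_pos (hd k)] using hHd k j
      _ = _ := by simp [mul_assoc]
  have hMprod : ∏ i, ‖M i‖ ≤ (n * C) ^ n * (c * C₁ ^ 2) := by
    calc ∏ i, ‖M i‖ ≤ ∏ i, n * C * ‖N i‖ :=
          Finset.prod_le_prod (fun _ _ => norm_nonneg _) fun i _ => hMrow i
      _ = (n * C) ^ n * ∏ i, ‖N i‖ := by simp [Finset.prod_mul_distrib]
      _ ≤ _ := by gcongr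
  have hdetM : δ * ‖M.det‖ = 1 := by
    have := congrArg (fun A => ‖det A‖) hLH
    simpa [hdet, det_conjTranspose] using this
  have hadj : M.adjugate = M.det • Lᴴ := by
    have hML : M * Lᴴ = 1 := mul_eq_one_comm.1 hLH
    calc M.adjugate = M.adjugate * (M * Lᴴ) := by rw [hML, mul_one]
      _ = _ := by rw [← mul_assoc, adjugate_mul, smul_mul_assoc, one_mul]
  set s : Fin n → ℝ := fun i => δ * n.factorial * ∏ k ∈ Finset.univ.erase i, ‖M k‖ with hs
  have hs0 : ∀ i, 0 ≤ s i := fun i =>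
    mul_nonneg (by positivity) (Finset.prod_nonneg fun _ _ => norm_nonneg _)
  have hLs : ∀ i j, ‖L i j‖ ≤ s i * 1 := by
    intro i j
    have h1 : ‖M.adjugate j i‖ = ‖M.det‖ * ‖L i j‖ := by
      rw [hadj]
      simp
    have h2 := norm_adjugate_apply_le M j i
    calc ‖L i j‖ = δ * ‖M.adjugate j i‖ := by rw [h1, ← mul_assoc, hdetM, one_mul]
      _ ≤ δ * (n.factorial * ∏ k ∈ Finset.univ.erase i, ‖M k‖) := by gcongr
      _ = _ := by simp [hs, mul_assoc]
  refine (norm_coeff_prodLinearForms_le L s (fun _ => 1) (fun _ => zero_le_one) hs0 hLs m).trans ?_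
  have e : (∏ i, s i) * ∏ j, (1 : ℝ) ^ m j =
      (δ * n.factorial) ^ n * (∏ k, ‖M k‖) ^ (n - 1) := by
    simp [hs, Finset.prod_mul_distrib, prod_prod_erase]
  rw [e]
  have : 0 ≤ ∏ k, ‖M k‖ := Finset.prod_nonneg fun _ _ => norm_nonneg _
  gcongr

theorem exists_unimodular_coeff_bound (n : ℕ) (δ : ℝ) (hδ : 0 < δ) :
    ∃ K : ℝ, ∀ (L : Matrix (Fin n) (Fin n) ℂ), ‖L.det‖ = δ →
      (∃ G : Matrix (Fin n) (Fin n) ℝ, G.map Complex.ofReal = Lᴴ * L) →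
      (∀ (U : Matrix (Fin n) (Fin n) ℤ) (m), ∃ z : ℤ,
        (prodLinearForms (L * U.map (Int.cast : ℤ → ℂ))).coeff m = z) →
      ∃ U : Matrix (Fin n) (Fin n) ℤ, IsUnit U.det ∧
        ∀ m, ‖(prodLinearForms (L * U.map (Int.cast : ℤ → ℂ))).coeff m‖ ≤ K := by
  obtain ⟨C, hC, hred⟩ := exists_hasReducedBasis n
  obtain ⟨K, hK⟩ := exists_coeff_bound_of_reduced n C δ hC hδ
  refine ⟨K, ?_⟩
  rintro L hdet ⟨G, hG⟩ hint
  have hL0 : L.det ≠ 0 := norm_pos_iff.1 (hdet ▸ hδ)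
  obtain ⟨U, d, H, hU, hd, hH, hdiag, hHd⟩ := hred G (posDef_of_map_ofReal_eq hL0 hG)
  set G' := (U.map (Int.cast : ℤ → ℝ))ᵀ * G * U.map (Int.cast : ℤ → ℝ) with hG'
  set L' := L * U.map (Int.cast : ℤ → ℂ) with hL'
  have hG'L' : G'.map Complex.ofReal = L'ᴴ * L' := by
    have e1 : (U.map (Int.cast : ℤ → ℝ)).map Complex.ofReal = U.map (Int.cast : ℤ → ℂ) := by
      ext; simp
    have e2 : ((U.map (Int.cast : ℤ → ℝ))ᵀ).map Complex.ofReal =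
        (U.map (Int.cast : ℤ → ℂ))ᴴ := by
      ext; simp
    have e3 : ∀ A B : Matrix (Fin n) (Fin n) ℝ, (A * B).map Complex.ofReal =
        A.map Complex.ofReal * B.map Complex.ofReal := fun A B =>
      Matrix.map_mul (f := Complex.ofRealHom)
    rw [hG', e3, e3, e1, e2, hG, hL', conjTranspose_mul]
    simp only [Matrix.mul_assoc]
  refine ⟨U, hU, hK L' (H.map Complex.ofReal) d ?_ (hint U) hd ?_ ?_ ?_⟩
  · have : (U.map (Int.cast : ℤ → ℂ)).det = ((U.det : ℤ) : ℂ) := (Int.cast_det U).symm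
    rw [hL', det_mul, norm_mul, hdet, this]
    rcases Int.isUnit_iff.1 hU with h | h <;> simp [h]
  · rw [← Matrix.mul_assoc, ← hG'L', ← Matrix.map_one Complex.ofReal rfl rfl, ← hH]
    exact (Matrix.map_mul (f := Complex.ofRealHom)).symm
  · intro i j
    refine le_trans ?_ (hdiag j)
    have e : G' j j = ∑ k, ‖L' k j‖ ^ 2 := by
      have h1 := congrFun (congrFun hG'L' j) j
      have h2 : (L'ᴴ * L') j j = ((∑ k, ‖L' k j‖ ^ 2 : ℝ) : ℂ) := by
        rw [Matrix.mul_apply]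
        push_cast
        refine Finset.sum_congr rfl fun k _ => ?_
        rw [conjTranspose_apply]
        exact Complex.conj_mul' _
      rw [h2, Matrix.map_apply] at h1
      exact_mod_cast h1
    rw [e]
    exact Finset.single_le_sum (f := fun k => ‖L' k j‖ ^ 2) (fun _ _ => sq_nonneg _)
      (Finset.mem_univ i)
  · intro i j
    simpa using hHd i j

theorem bind₁_prodLinearForms {n : ℕ} (L U : Matrix (Fin n) (Fin n) ℂ) :
    MvPolynomial.bind₁ (fun i : Fin n => ∑ j : Fin n, MvPolynomial.C (U i j) * MvPolynomial.X j)
      (prodLinearForms L) = prodLinearForms (L * U) := by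
  simp only [prodLinearForms, map_prod, map_sum, map_mul, MvPolynomial.bind₁_X_right,
    MvPolynomial.bind₁_C_right, Matrix.mul_apply, Finset.mul_sum, Finset.sum_mul, ← mul_assoc]
  exact Finset.prod_congr rfl fun i _ => Finset.sum_comm

theorem bind₁_bind₁_linear {n : ℕ} (U V : Matrix (Fin n) (Fin n) ℤ)
    (p : MvPolynomial (Fin n) ℂ) :
    MvPolynomial.bind₁
        (fun i : Fin n => ∑ j : Fin n, MvPolynomial.C ((V i j : ℂ)) * MvPolynomial.X j)
      (MvPolynomial.bind₁
        (fun i : Fin n => ∑ j : Fin n, MvPolynomial.C ((U i j : ℂ)) * MvPolynomial.X j) p) =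
    MvPolynomial.bind₁
      (fun i : Fin n => ∑ j : Fin n, MvPolynomial.C (((U * V) i j : ℤ) : ℂ) * MvPolynomial.X j)
      p := by
  rw [MvPolynomial.bind₁_bind₁]
  congr 2
  funext i
  simp only [map_sum, map_mul, MvPolynomial.bind₁_X_right, MvPolynomial.bind₁_C_right,
    Matrix.mul_apply, Finset.mul_sum, Finset.sum_mul, ← mul_assoc, Int.cast_sum, Int.cast_mul]
  exact Finset.sum_comm

theorem bind₁_linear_one {n : ℕ} (p : MvPolynomial (Fin n) ℂ) :
    MvPolynomial.bind₁
      (fun i : Fin n => ∑ j : Fin n,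
        MvPolynomial.C (((1 : Matrix (Fin n) (Fin n) ℤ) i j : ℤ) : ℂ) * MvPolynomial.X j) p =
      p := by
  convert MvPolynomial.aeval_X_left_apply p using 2
  rw [MvPolynomial.bind₁]
  congr 1
  funext i
  rw [Finset.sum_eq_single i (fun j _ hj => by simp [Matrix.one_apply_ne hj.symm]) (by simp)]
  simp

/-- The Hermite form is a resultant, hence has integral coefficients. -/
theorem exists_map_eq_hermiteForm {n : ℕ} (f : Polynomial ℤ) :
    ∃ P : MvPolynomial (Fin n) ℤ, MvPolynomial.map (Int.castRingHom ℂ) P = hermiteForm n f := by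
  let p (R : Type) [CommRing R] : Polynomial (MvPolynomial (Fin n) R) :=
    ∑ j : Fin n, C (MvPolynomial.X j) * X ^ (n - 1 - (j : ℕ))
  have hp : (p ℂ).natDegree ≤ n - 1 :=
    natDegree_sum_le_of_forall_le _ _ fun j _ => (natDegree_C_mul_X_pow_le _ _).trans (by omega)
  have hmap : (p ℤ).map (MvPolynomial.map (Int.castRingHom ℂ)) = p ℂ := by
    simp only [p, Polynomial.map_sum, Polynomial.map_mul, Polynomial.map_pow, map_C, map_X,
      MvPolynomial.map_X]
  have hsplit := IsAlgClosed.splits (f.map (Int.castRingHom ℂ))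
  have hinj : Function.Injective (MvPolynomial.C : ℂ →+* MvPolynomial (Fin n) ℂ) :=
    MvPolynomial.C_injective _ _
  have hfmap : (f.map (MvPolynomial.C : ℤ →+* MvPolynomial (Fin n) ℤ)).map
      (MvPolynomial.map (Int.castRingHom ℂ)) =
      (f.map (Int.castRingHom ℂ)).map (MvPolynomial.C : ℂ →+* MvPolynomial (Fin n) ℂ) := by
    rw [Polynomial.map_map, Polynomial.map_map]
    congr 1
    exact RingHom.ext_int _ _
  have key := resultant_eq_prod_eval ((f.map (Int.castRingHom ℂ)).map
    (MvPolynomial.C : ℂ →+* MvPolynomial (Fin n) ℂ)) (p ℂ) (n - 1) hp (hsplit.map _)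
  refine ⟨resultant (f.map MvPolynomial.C) (p ℤ)
    ((f.map (Int.castRingHom ℂ)).map
      (MvPolynomial.C : ℂ →+* MvPolynomial (Fin n) ℂ)).natDegree (n - 1), ?_⟩
  rw [← resultant_map_map, hmap, hfmap, key, hsplit.roots_map_of_injective hinj, hermiteForm,
    leadingCoeff_map_of_injective hinj,
    leadingCoeff_map_of_injective (RingHom.injective_int (Int.castRingHom ℂ)), Multiset.map_map]
  congr 1
  · simp
  · refine congrArg _ (Multiset.map_congr rfl fun α _ => ?_)
    simp only [p, Function.comp_apply, eval_finsetSum, eval_mul, eval_pow, eval_C, eval_X,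
      map_pow, mul_comm]

theorem exists_int_coeff_bind₁_hermiteForm {n : ℕ} (f : Polynomial ℤ)
    (U : Matrix (Fin n) (Fin n) ℤ) (m : Fin n →₀ ℕ) :
    ∃ z : ℤ, (MvPolynomial.bind₁
        (fun i : Fin n => ∑ j : Fin n, MvPolynomial.C ((U i j : ℂ)) * MvPolynomial.X j)
        (hermiteForm n f)).coeff m = z := by
  obtain ⟨P, hP⟩ := exists_map_eq_hermiteForm (n := n) f
  refine ⟨(MvPolynomial.bind₁
    (fun i : Fin n => ∑ j : Fin n, MvPolynomial.C (U i j) * MvPolynomial.X j) P).coeff m, ?_⟩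
  have : (fun i : Fin n => ∑ j : Fin n, MvPolynomial.C ((U i j : ℂ)) * MvPolynomial.X j) =
      fun i => MvPolynomial.map (Int.castRingHom ℂ)
        (∑ j : Fin n, MvPolynomial.C (U i j) * MvPolynomial.X j) := by
    simp
  rw [← hP, this, ← MvPolynomial.map_bind₁, MvPolynomial.coeff_map]
  rfl

theorem exists_roots_discC {n : ℕ} {f : Polynomial ℤ} (hf : f.natDegree = n) :
    ∃ α : Fin n → ℂ, (f.map (Int.castRingHom ℂ)).roots = Finset.univ.val.map α ∧
      discC f = (f.leadingCoeff : ℂ) ^ (2 * n - 2) *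
        ∏ i, ∏ j ∈ Finset.Ioi i, (α j - α i) ^ 2 := by
  have hlen : (rootList f).length = n := by
    rw [rootList, Multiset.length_toList,
      ← (IsAlgClosed.splits (f.map (Int.castRingHom ℂ))).natDegree_eq_card_roots,
      natDegree_map_eq_of_injective (RingHom.injective_int (Int.castRingHom ℂ)), hf]
  rw [discC, hf]
  subst hlen
  refine ⟨(rootList f).get, ?_, ?_⟩
  · have h : ((rootList f : List ℂ) : Multiset ℂ) = (f.map (Int.castRingHom ℂ)).roots :=
      Multiset.coe_toList _
    rw [← h, Fin.univ_val_map, List.ofFn_get]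
  · rw [Fintype.prod_prod_type]
    congr 1
    refine Finset.prod_congr rfl fun i _ => ?_
    rw [← Finset.prod_filter]
    refine Finset.prod_congr ?_ fun j _ => by ring
    ext j
    rw [Finset.mem_filter, Finset.mem_Ioi, Fin.lt_def, and_iff_right (Finset.mem_univ j)]

theorem exists_hermiteForm_eq_prodLinearForms {n : ℕ} (hn : n ≠ 0) {f : Polynomial ℤ}
    (hf : f.natDegree = n) :
    ∃ (L : Matrix (Fin n) (Fin n) ℂ) (s : ℤ), (s = 1 ∨ s = -1) ∧
      hermiteForm n f = MvPolynomial.C (s : ℂ) * prodLinearForms L ∧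
      ‖L.det‖ ^ 2 = ‖discC f‖ ∧
      ∃ G : Matrix (Fin n) (Fin n) ℝ, G.map Complex.ofReal = Lᴴ * L := by
  obtain ⟨α, hα, hdisc⟩ := exists_roots_discC hf
  obtain ⟨r, hr0, hr⟩ : ∃ r : ℝ, 0 ≤ r ∧ r ^ n = |(f.leadingCoeff : ℝ)| ^ (n - 1) :=
    ⟨_, by positivity, Real.rpow_inv_natCast_pow (by positivity) hn⟩
  obtain ⟨s, hs, hs'⟩ : ∃ s : ℤ, (s = 1 ∨ s = -1) ∧
      (f.leadingCoeff : ℝ) ^ (n - 1) = s * |(f.leadingCoeff : ℝ)| ^ (n - 1) := by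
    rw [← abs_pow]
    rcases abs_choice ((f.leadingCoeff : ℝ) ^ (n - 1)) with h | h
    · exact ⟨1, Or.inl rfl, by simp [h]⟩
    · exact ⟨-1, Or.inr rfl, by simp [h]⟩
  let L : Matrix (Fin n) (Fin n) ℂ := (r : ℂ) • (vandermonde α).submatrix id Fin.revPerm
  have hL : ∀ i j, L i j = r * α i ^ (n - 1 - (j : ℕ)) := by
    intro i j
    simp [L, vandermonde_apply, Fin.val_rev, Nat.sub_sub, add_comm]
  refine ⟨L, s, hs, ?_, ?_, ?_⟩
  · have h1 : prodLinearForms L = MvPolynomial.C ((r : ℂ) ^ n) *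
        ∏ i, ∑ j : Fin n, MvPolynomial.C (α i ^ (n - 1 - (j : ℕ))) * MvPolynomial.X j := by
      simp only [prodLinearForms, hL, map_mul, mul_assoc, ← Finset.mul_sum,
        Finset.prod_mul_distrib]
      simp
    have h2 : (f.leadingCoeff : ℂ) ^ (n - 1) = s * (r : ℂ) ^ n := by
      rw [← hr] at hs'
      exact_mod_cast hs'
    rw [hermiteForm, hα, Multiset.map_map, h1, h2, map_mul, mul_assoc]
    rfl
  · rw [det_smul, det_permute', det_vandermonde, hdisc]
    have h1 : ‖((Equiv.Perm.sign (Fin.revPerm (n := n)) : ℤ) : ℂ)‖ = 1 := by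
      rcases Int.units_eq_one_or (Equiv.Perm.sign (Fin.revPerm (n := n))) with h | h <;> simp [h]
    simp only [norm_mul, norm_pow, norm_prod, h1, Fintype.card_fin, Complex.norm_real, one_mul,
      Real.norm_eq_abs, abs_of_nonneg hr0, hr, Complex.norm_intCast, Finset.prod_pow, mul_pow]
    rw [← pow_mul, Nat.sub_mul, mul_comm n 2]
  · refine ⟨of fun j k => ((Lᴴ * L) j k).re, ?_⟩
    ext j k
    refine Complex.conj_eq_iff_re.1 ?_
    have hconj : ((f.map (Int.castRingHom ℂ)).roots).map (starRingEnd ℂ) =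
        (f.map (Int.castRingHom ℂ)).roots := by
      rw [← (IsAlgClosed.splits (f.map (Int.castRingHom ℂ))).roots_map, Polynomial.map_map]
      congr 2
      exact RingHom.ext_int _ _
    have hsum : ∀ g : ℂ → ℂ, ∑ i, g (α i) = ∑ i, g (starRingEnd ℂ (α i)) := by
      intro g
      rw [hα, Multiset.map_map] at hconj
      have := congrArg (fun S : Multiset ℂ => (S.map g).sum) hconj
      simp only [Multiset.map_map] at this
      exact this.symm
    let g : ℂ → ℂ := fun z =>
      (r : ℂ) * starRingEnd ℂ z ^ (n - 1 - (j : ℕ)) * (r * z ^ (n - 1 - (k : ℕ)))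
    have e : (Lᴴ * L) j k = ∑ i, g (α i) := by
      rw [Matrix.mul_apply]
      refine Finset.sum_congr rfl fun i _ => ?_
      simp [conjTranspose_apply, hL, g]
    rw [e, map_sum, hsum g]
    refine Finset.sum_congr rfl fun i _ => ?_
    simp [g]

theorem finite_integral_bounded (n : ℕ) (K : ℝ) :
    {p : MvPolynomial (Fin n) ℂ | (∀ m ∉ Set.range (monomialOf (n := n)), p.coeff m = 0) ∧
      (∀ m, ∃ z : ℤ, p.coeff m = z) ∧ ∀ m, ‖p.coeff m‖ ≤ K}.Finite := by
  let F : MvPolynomial (Fin n) ℂ → (Fin n → Fin n) → ℂ := fun p φ => p.coeff (monomialOf φ)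
  have hB : (Set.univ.pi fun _ : Fin n → Fin n =>
      (Int.cast : ℤ → ℂ) '' Set.Icc (-⌊K⌋) ⌊K⌋).Finite :=
    Set.Finite.pi fun _ => (Set.finite_Icc _ _).image _
  refine Set.Finite.of_finite_image (f := F) (hB.subset ?_) ?_
  · rintro _ ⟨p, ⟨-, hint, hbd⟩, rfl⟩ φ -
    obtain ⟨z, hz⟩ := hint (monomialOf φ)
    refine ⟨z, abs_le.1 (Int.le_floor.2 ?_), hz.symm⟩
    have := hbd (monomialOf φ)
    rw [hz, Complex.norm_intCast] at this
    exact_mod_cast this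
  · rintro p ⟨hp, -⟩ q ⟨hq, -⟩ hpq
    ext m
    by_cases hm : m ∈ Set.range (monomialOf (n := n))
    · obtain ⟨φ, rfl⟩ := hm
      exact congrFun hpq φ
    · rw [hp m hm, hq m hm]

theorem hermiteEquiv_of_bind₁_eq {n : ℕ} {f g : Polynomial ℤ} {U V : Matrix (Fin n) (Fin n) ℤ}
    (hU : IsUnit U.det) (hV : IsUnit V.det)
    (h : MvPolynomial.bind₁
        (fun i : Fin n => ∑ j : Fin n, MvPolynomial.C ((U i j : ℂ)) * MvPolynomial.X j)
        (hermiteForm n f) =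
      MvPolynomial.bind₁
        (fun i : Fin n => ∑ j : Fin n, MvPolynomial.C ((V i j : ℂ)) * MvPolynomial.X j)
        (hermiteForm n g)) :
    HermiteEquiv n f g := by
  refine ⟨V * U⁻¹, 1, ?_, Or.inl rfl, ?_⟩
  · rw [det_mul]
    exact hV.mul (isUnit_nonsing_inv_det _ hU)
  · rw [← bind₁_bind₁_linear, ← h, bind₁_bind₁_linear, mul_nonsing_inv _ hU, bind₁_linear_one]
    simp

theorem exists_bounded_bind₁_hermiteForm {n : ℕ} (hn : n ≠ 0) {D : ℤ} (hD : D ≠ 0) :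
    ∃ K : ℝ, ∀ f : Polynomial ℤ, f.natDegree = n → discC f = (D : ℂ) →
      ∃ U : Matrix (Fin n) (Fin n) ℤ, IsUnit U.det ∧
        MvPolynomial.bind₁
          (fun i : Fin n => ∑ j : Fin n, MvPolynomial.C ((U i j : ℂ)) * MvPolynomial.X j)
          (hermiteForm n f) ∈
        {p : MvPolynomial (Fin n) ℂ | (∀ m ∉ Set.range (monomialOf (n := n)), p.coeff m = 0) ∧
          (∀ m, ∃ z : ℤ, p.coeff m = z) ∧ ∀ m, ‖p.coeff m‖ ≤ K} := by
  have hDpos : 0 < |(D : ℝ)| := by simpa using hD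
  obtain ⟨K, hK⟩ := exists_unimodular_coeff_bound n (√|(D : ℝ)|) (Real.sqrt_pos.2 hDpos)
  refine ⟨K, fun f hf hdisc => ?_⟩
  obtain ⟨L, s, hs, hform, hdet, hG⟩ := exists_hermiteForm_eq_prodLinearForms hn hf
  have hbind : ∀ U : Matrix (Fin n) (Fin n) ℤ, MvPolynomial.bind₁
      (fun i : Fin n => ∑ j : Fin n, MvPolynomial.C ((U i j : ℂ)) * MvPolynomial.X j)
      (hermiteForm n f) =
      MvPolynomial.C (s : ℂ) * prodLinearForms (L * U.map (Int.cast : ℤ → ℂ)) := by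
    intro U
    rw [hform, map_mul, MvPolynomial.bind₁_C_right, ← bind₁_prodLinearForms]
    rfl
  have hss : (s : ℂ) * s = 1 := by rcases hs with rfl | rfl <;> simp
  have hdet' : ‖L.det‖ = √|(D : ℝ)| := by
    rw [eq_comm, Real.sqrt_eq_iff_mul_self_eq hDpos.le (norm_nonneg _), ← sq, hdet, hdisc,
      Complex.norm_intCast]
  obtain ⟨U, hU, hbd⟩ := hK L hdet' hG fun U m => by
    obtain ⟨z, hz⟩ := exists_int_coeff_bind₁_hermiteForm f U m
    refine ⟨s * z, ?_⟩
    rw [hbind, MvPolynomial.coeff_C_mul] at hz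
    rw [Int.cast_mul, ← hz, ← mul_assoc, hss, one_mul]
  refine ⟨U, hU, fun m hm => ?_, exists_int_coeff_bind₁_hermiteForm f U, fun m => ?_⟩
  · rw [hbind, MvPolynomial.coeff_C_mul, coeff_prodLinearForms_eq_zero _ hm, mul_zero]
  · have : ‖(s : ℂ)‖ = 1 := by rcases hs with rfl | rfl <;> simp
    rw [hbind, MvPolynomial.coeff_C_mul, norm_mul, this, one_mul]
    exact hbd m

/-- polynomials in ℤ[X] of given degree `n ≥ 2` and given nonzero
discriminant `D` lie in finitely many Hermite equivalence classes. -/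
theorem finitely_many_hermite_classes (n : ℕ) (hn : 2 ≤ n) (D : ℤ) (hD : D ≠ 0) :
    ∃ S : Finset (Polynomial ℤ), ∀ f : Polynomial ℤ,
      f.natDegree = n → discC f = (D : ℂ) → ∃ g ∈ S, HermiteEquiv n f g := by
  classical
  obtain ⟨K, hK⟩ := exists_bounded_bind₁_hermiteForm (show n ≠ 0 by omega) hD
  choose! U hU hUmem using hK
  let T : Polynomial ℤ → MvPolynomial (Fin n) ℂ := fun f => MvPolynomial.bind₁
    (fun i : Fin n => ∑ j : Fin n, MvPolynomial.C ((U f i j : ℂ)) * MvPolynomial.X j)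
    (hermiteForm n f)
  let A : Set (Polynomial ℤ) := {f | f.natDegree = n ∧ discC f = (D : ℂ)}
  have hfin : (T '' A).Finite := (finite_integral_bounded n K).subset (by
    rintro _ ⟨f, ⟨hf, hd⟩, rfl⟩
    exact hUmem f hf hd)
  obtain ⟨S, hSA, hS⟩ := Finset.subset_set_image_iff.1 hfin.coe_toFinset.subset
  refine ⟨S, fun f hf hd => ?_⟩
  obtain ⟨g, hg, hgf⟩ : ∃ g ∈ S, T g = T f := by
    rw [← Finset.mem_image, hS, hfin.mem_toFinset]
    exact ⟨f, ⟨hf, hd⟩, rfl⟩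
  exact ⟨g, hg, hermiteEquiv_of_bind₁_eq (hU f hf hd) (hU g (hSA hg).1 (hSA hg).2) hgf.symm⟩
end
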